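/- arXiv:2204.00936 — 5 statements merged into one kernel-verified Lean document; each statement's English description precedes it below -/
import Mathlib

section
/- Let V be a finite-dimensional real vector space, B ⊂ V a convex body with 0 in its interior, and x ∈ ∂B. Then the set of all vectors tangent to ∂B at x is a linear subspace of V. -/
open Filter Topology

/-- `v` is *forward tangent* to `∂B` at `x` if there are a sequence `p i ∈ ∂B` with `p i → x`
and positive reals `c i` with `c i • (p i - x) → v`. -/
def IsForwardTangent {X : Type*} [NormedAddCommGroup X] [NormedSpace ℝ X]
    (B : Set X) (x v : X) : Prop :=
  ∃ (p : ℕ → X) (c : ℕ → ℝ), (∀ i, p i ∈ frontier B) ∧ (∀ i, 0 < c i) ∧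
    Tendsto p atTop (𝓝 x) ∧ Tendsto (fun i => c i • (p i - x)) atTop (𝓝 v)

/-- `v` is *tangent* to `∂B` at `x` if both `v` and `-v` are forward tangent to `∂B` at `x`. -/
def IsTangentVec {X : Type*} [NormedAddCommGroup X] [NormedSpace ℝ X]
    (B : Set X) (x v : X) : Prop :=
  IsForwardTangent B x v ∧ IsForwardTangent B x (-v)

/-- The one-sided directional derivative of `g` at `x` along `v` is `≤ 0` (where `g x = 1`). -/
def DirNonpos {X : Type*} [NormedAddCommGroup X] [NormedSpace ℝ X]
    (g : X → ℝ) (x v : X) : Prop :=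
  ∀ ε > 0, ∃ δ > 0, ∀ t, 0 < t → t ≤ δ → g (x + t • v) ≤ 1 + ε * t

lemma DirNonpos.of_exists {X : Type*} [NormedAddCommGroup X] [NormedSpace ℝ X]
    {g : X → ℝ} {x v : X} (hadd : ∀ a b, g (a + b) ≤ g a + g b)
    (hsm : ∀ (r : ℝ) a, 0 ≤ r → g (r • a) = r * g a) (hx : g x = 1)
    (h : ∀ ε > 0, ∃ t > 0, g (x + t • v) ≤ 1 + ε * t) : DirNonpos g x v := by
  intro ε hε
  obtain ⟨s, hs, h⟩ := h ε hε
  refine ⟨s, hs, fun t ht hts => ?_⟩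
  have e : x + t • v = (1 - t / s) • x + (t / s) • (x + s • v) := by
    rw [smul_add, smul_smul, div_mul_cancel₀ _ hs.ne', sub_smul, one_smul]; abel
  have h1 : t / s ≤ 1 := (div_le_one hs).2 hts
  have h2 : 0 < t / s := div_pos ht hs
  have h3 := hadd ((1 - t / s) • x) ((t / s) • (x + s • v))
  rw [hsm _ _ (by linarith), hsm _ _ h2.le, hx] at h3
  rw [e]
  have h4 := mul_le_mul_of_nonneg_left h h2.le
  have h5 : t / s * (1 + ε * s) = t / s + ε * t := by field_simp
  linarith

lemma DirNonpos.add {X : Type*} [NormedAddCommGroup X] [NormedSpace ℝ X]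
    {g : X → ℝ} {x v w : X} (hadd : ∀ a b, g (a + b) ≤ g a + g b)
    (hsm : ∀ (r : ℝ) a, 0 ≤ r → g (r • a) = r * g a)
    (hv : DirNonpos g x v) (hw : DirNonpos g x w) : DirNonpos g x (v + w) := by
  intro ε hε
  obtain ⟨a, ha, hv⟩ := hv (ε / 2) (by positivity)
  obtain ⟨b, hb, hw⟩ := hw (ε / 2) (by positivity)
  refine ⟨min a b / 2, by positivity, fun t ht hts => ?_⟩
  have h1 := hv (2 * t) (by positivity) (by linarith [min_le_left a b])
  have h2 := hw (2 * t) (by positivity) (by linarith [min_le_right a b])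
  have e : x + t • (v + w) =
      (1 / 2 : ℝ) • (x + (2 * t) • v) + (1 / 2 : ℝ) • (x + (2 * t) • w) := by
    module
  have h3 := hadd ((1 / 2 : ℝ) • (x + (2 * t) • v)) ((1 / 2 : ℝ) • (x + (2 * t) • w))
  rw [hsm _ _ (by norm_num), hsm _ _ (by norm_num), ← e] at h3
  linarith

lemma DirNonpos.smul {X : Type*} [NormedAddCommGroup X] [NormedSpace ℝ X]
    {g : X → ℝ} {x v : X} (hx : g x = 1) (hv : DirNonpos g x v) {r : ℝ} (hr : 0 ≤ r) :
    DirNonpos g x (r • v) := by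
  intro ε hε
  rcases hr.eq_or_lt with rfl | hr
  · refine ⟨1, one_pos, fun t ht _ => ?_⟩
    simp only [zero_smul, smul_zero, add_zero, hx]
    have := mul_pos hε ht
    linarith
  obtain ⟨a, ha, hv⟩ := hv (ε / r) (by positivity)
  refine ⟨a / r, by positivity, fun t ht hts => ?_⟩
  have h1 := hv (t * r) (by positivity) ((le_div_iff₀ hr).1 hts)
  rw [smul_smul]
  have : ε / r * (t * r) = ε * t := by field_simp
  linarith

lemma IsForwardTangent.dirNonpos {X : Type*} [NormedAddCommGroup X] [NormedSpace ℝ X]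
    {B : Set X} {g : X → ℝ} {x v : X} (hadd : ∀ a b, g (a + b) ≤ g a + g b)
    (hsm : ∀ (r : ℝ) a, 0 ≤ r → g (r • a) = r * g a) (hx : g x = 1)
    (hf : ∀ y, g y = 1 ↔ y ∈ frontier B) (hc : Continuous g)
    (h : IsForwardTangent B x v) : DirNonpos g x v := by
  refine DirNonpos.of_exists hadd hsm hx fun ε hε => ?_
  obtain ⟨p, c, hp, hcpos, -, hlim⟩ := h
  have g0 : g 0 = 0 := by simpa using hsm 0 0 le_rfl
  have hl : Tendsto (fun i => g (v - c i • (p i - x))) atTop (𝓝 0) := by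
    have h1 : Tendsto (fun i => v - c i • (p i - x)) atTop (𝓝 (v - v)) :=
      tendsto_const_nhds.sub hlim
    rw [sub_self] at h1
    have := (hc.tendsto 0).comp h1
    rwa [g0] at this
  obtain ⟨i, hi⟩ := (hl.eventually (gt_mem_nhds hε)).exists
  have hci := hcpos i
  refine ⟨(c i)⁻¹, inv_pos.2 hci, ?_⟩
  have e : x + (c i)⁻¹ • v = p i + (c i)⁻¹ • (v - c i • (p i - x)) := by
    rw [smul_sub, smul_smul, inv_mul_cancel₀ hci.ne', one_smul]; abel
  have h3 := hadd (p i) ((c i)⁻¹ • (v - c i • (p i - x)))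
  rw [hsm _ _ (inv_pos.2 hci).le, (hf _).2 (hp i), ← e] at h3
  have := mul_le_mul_of_nonneg_left hi.le (inv_pos.2 hci).le
  linarith

lemma DirNonpos.isForwardTangent {X : Type*} [NormedAddCommGroup X] [NormedSpace ℝ X]
    {B : Set X} {g : X → ℝ} {x v : X} (hadd : ∀ a b, g (a + b) ≤ g a + g b)
    (hsm : ∀ (r : ℝ) a, 0 ≤ r → g (r • a) = r * g a) (hx : g x = 1)
    (hf : ∀ y, g y = 1 ↔ y ∈ frontier B) (hc : Continuous g)
    (h : DirNonpos g x v) (h' : DirNonpos g x (-v)) : IsForwardTangent B x v := by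
  -- the difference quotient tends to zero
  have hq : Tendsto (fun t : ℝ => (1 - g (x + t • v)) / t) (𝓝[>] 0) (𝓝 0) := by
    rw [Metric.tendsto_nhds]
    intro ε hε
    obtain ⟨a, ha, h⟩ := h (ε / 2) (by positivity)
    obtain ⟨b, hb, h'⟩ := h' (ε / 2) (by positivity)
    have hm : Set.Ioc (0 : ℝ) (min a b) ∈ 𝓝[>] (0 : ℝ) := Ioc_mem_nhdsGT (by positivity)
    filter_upwards [hm] with t ht
    obtain ⟨ht, hts⟩ := ht
    have h1 := h t ht (hts.trans (min_le_left _ _))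
    have h2 := h' t ht (hts.trans (min_le_right _ _))
    have h3 := hadd (x + t • v) (x + t • -v)
    have e : x + t • v + (x + t • -v) = (2 : ℝ) • x := by module
    rw [e, hsm _ _ (by norm_num), hx] at h3
    have hεt := mul_pos hε ht
    rw [Real.dist_eq, sub_zero, abs_div, abs_of_pos ht, div_lt_iff₀ ht, abs_lt]
    constructor <;> linarith
  have hg : Tendsto (fun t : ℝ => g (x + t • v)) (𝓝[>] 0) (𝓝 1) := by
    have : Continuous fun t : ℝ => g (x + t • v) := by fun_prop
    have h1 := this.tendsto 0
    simp only [zero_smul, add_zero, hx] at h1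
    exact h1.mono_left nhdsWithin_le_nhds
  have hxt : Tendsto (fun t : ℝ => x + t • v) (𝓝[>] 0) (𝓝 x) := by
    have : Continuous fun t : ℝ => x + t • v := by fun_prop
    have h1 := this.tendsto 0
    simp only [zero_smul, add_zero] at h1
    exact h1.mono_left nhdsWithin_le_nhds
  have hgi : Tendsto (fun t : ℝ => (g (x + t • v))⁻¹) (𝓝[>] 0) (𝓝 1) := by
    simpa using hg.inv₀ one_ne_zero
  have hgood : ∀ᶠ t : ℝ in 𝓝[>] 0, 0 < t ∧ 0 < g (x + t • v) :=
    (eventually_mem_nhdsWithin (a := (0 : ℝ)) (s := Set.Ioi 0)).and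
      (hg.eventually (lt_mem_nhds one_pos))
  have hu : Tendsto (fun n : ℕ => 1 / ((n : ℝ) + 1)) atTop (𝓝[>] 0) :=
    tendsto_nhdsWithin_iff.2 ⟨tendsto_one_div_add_atTop_nhds_zero_nat,
      Eventually.of_forall fun n => by simp only [Set.mem_Ioi]; positivity⟩
  obtain ⟨N, hN⟩ := eventually_atTop.1 (hu.eventually hgood)
  have hu' := hu.comp (tendsto_add_atTop_nat N)
  set u : ℕ → ℝ := (fun n : ℕ => 1 / ((n : ℝ) + 1)) ∘ (fun n => n + N) with hudef
  have hpos : ∀ n, 0 < u n ∧ 0 < g (x + u n • v) := fun n => hN (n + N) (by omega)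
  refine ⟨fun n => (g (x + u n • v))⁻¹ • (x + u n • v), fun n => (u n)⁻¹, fun n => ?_,
    fun n => inv_pos.2 (hpos n).1, ?_, ?_⟩
  · rw [← hf, hsm _ _ (inv_pos.2 (hpos n).2).le, inv_mul_cancel₀ (hpos n).2.ne']
  · have := (hgi.smul hxt).comp hu'
    rwa [one_smul] at this
  · have h1 := ((hgi.smul_const v).add ((hq.mul hgi).smul_const x)).comp hu'
    simp only [one_smul, zero_mul, zero_smul, add_zero] at h1
    refine h1.congr fun n => ?_
    obtain ⟨a, b⟩ := hpos n
    simp only [Function.comp_apply]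
    change (g (x + u n • v))⁻¹ • v + ((1 - g (x + u n • v)) / u n * (g (x + u n • v))⁻¹) • x = _
    generalize g (x + u n • v) = G at b ⊢
    have hb := b.ne'
    have ha := a.ne'
    match_scalars <;> field_simp

/-- If `B` is a convex body with `0` in its interior and `x ∈ ∂B`, then the set of all vectors
tangent to `∂B` at `x` is a linear subspace of `V`. -/
theorem tangent_vectors_form_subspace
    {V : Type*} [NormedAddCommGroup V] [NormedSpace ℝ V] [FiniteDimensional ℝ V]
    (B : Set V) (hBcomp : IsCompact B) (hBconv : Convex ℝ B)
    (h0 : (0 : V) ∈ interior B)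
    (x : V) (hx : x ∈ frontier B) :
    ∃ S : Submodule ℝ V, (S : Set V) = {v | IsTangentVec B x v} := by
  have hnhds : B ∈ 𝓝 (0 : V) := mem_interior_iff_mem_nhds.1 h0
  have habs : Absorbent ℝ B := absorbent_nhds_zero hnhds
  have hadd : ∀ a b, gauge B (a + b) ≤ gauge B a + gauge B b := gauge_add_le hBconv habs
  have hsm : ∀ (r : ℝ) a, 0 ≤ r → gauge B (r • a) = r * gauge B a := fun r a hr => by
    rw [gauge_smul_of_nonneg hr, smul_eq_mul]
  have hf : ∀ y, gauge B y = 1 ↔ y ∈ frontier B := fun y =>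
    gauge_eq_one_iff_mem_frontier hBconv hnhds
  have hc : Continuous (gauge B) := continuous_gauge hBconv hnhds
  have hx1 := (hf x).2 hx
  have key : ∀ v, IsTangentVec B x v ↔ DirNonpos (gauge B) x v ∧ DirNonpos (gauge B) x (-v) := by
    intro v
    constructor
    · rintro ⟨h, h'⟩
      exact ⟨h.dirNonpos hadd hsm hx1 hf hc, h'.dirNonpos hadd hsm hx1 hf hc⟩
    · rintro ⟨h, h'⟩
      exact ⟨h.isForwardTangent hadd hsm hx1 hf hc h',
        h'.isForwardTangent hadd hsm hx1 hf hc (by rwa [neg_neg])⟩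
  have hz : DirNonpos (gauge B) x 0 := by
    intro ε hε
    refine ⟨1, one_pos, fun t ht _ => ?_⟩
    simp only [smul_zero, add_zero, hx1]
    have := mul_pos hε ht
    linarith
  refine ⟨{ carrier := {v | IsTangentVec B x v}, add_mem' := ?_, zero_mem' := ?_,
            smul_mem' := ?_ }, rfl⟩
  · intro v w hv hw
    simp only [Set.mem_setOf_eq, key] at hv hw ⊢
    refine ⟨hv.1.add hadd hsm hw.1, ?_⟩
    rw [neg_add]
    exact hv.2.add hadd hsm hw.2
  · simp only [Set.mem_setOf_eq, key, neg_zero]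
    exact ⟨hz, hz⟩
  · intro r v hv
    simp only [Set.mem_setOf_eq, key] at hv ⊢
    rcases le_total 0 r with hr | hr
    · refine ⟨hv.1.smul hx1 hr, ?_⟩
      rw [← smul_neg]
      exact hv.2.smul hx1 hr
    · have hr' : 0 ≤ -r := by linarith
      have h1 := hv.2.smul hx1 hr'
      have h2 := hv.1.smul hx1 hr'
      rw [neg_smul_neg] at h1
      rw [neg_smul] at h2
      exact ⟨h1, h2⟩
end

section
/- Let V be a real vector space with dim V = n+1 ≥ 3 and let B ⊂ V be a convex body with 0 in its interior such that all intersections of B with n-dimensional linear subspaces of V are linearly equivalent to one another. Let A : ΛⁿV → ℝ be the affine cross-section area function of B, let σ ∈ ΛⁿV∖{0} be a point at which A is differentiable, and let X = Π_σ. Then there exist a vector ν ∈ V∖X and a linear map R : X* → Hom(X,X) such that for every λ ∈ X* the operator R_λ = R(λ) satisfies: (1) tr R_λ = 0, and (2) for every x ∈ ∂B ∩ X, the vector R_λ(x) + λ(x)·ν is tangent to ∂B at x. -/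
open Filter Topology MeasureTheory

/-- Two subsets `A`, `B` of a real vector space are *linearly equivalent* if there is a
linear bijection `L` from the linear span of `A` to the linear span of `B` with `L(A) = B`. -/
def LinearlyEquivalent {V : Type*} [AddCommGroup V] [Module ℝ V] (A B : Set V) : Prop :=
  ∃ L : (Submodule.span ℝ A) ≃ₗ[ℝ] (Submodule.span ℝ B),
    (fun x : Submodule.span ℝ A => (L x : V)) '' {x | (x : V) ∈ A} = B

namespace TTR

/-- nonpositive one-sided directional derivative of `g` at `x` in direction `u`. -/
def Np {V : Type*} [AddCommGroup V] [Module ℝ V] (g : V → ℝ) (x u : V) : Prop :=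
  ∀ ε > 0, ∃ t > 0, g (x + t • u) ≤ g x + ε * t

/-- Asymmetric norms comparable with the norm. -/
structure Gg {V : Type*} [NormedAddCommGroup V] [NormedSpace ℝ V] (g : V → ℝ) (C c : ℝ) :
    Prop where
  add : ∀ x y, g (x + y) ≤ g x + g y
  hom : ∀ t : ℝ, 0 ≤ t → ∀ x, g (t • x) = t * g x
  up : ∀ x, g x ≤ C * ‖x‖
  lo : ∀ x, c * ‖x‖ ≤ g x
  cpos : 0 < c
  Cpos : 0 < C

section
variable {V : Type*} [NormedAddCommGroup V] [NormedSpace ℝ V] {g : V → ℝ} {C c : ℝ}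

lemma Gg.diff (hg : Gg g C c) (x y : V) : g x ≤ g y + C * ‖x - y‖ := by
  have h := hg.add y (x - y)
  have h2 := hg.up (x - y)
  simp only [add_sub_cancel] at h
  linarith

lemma Gg.zero (hg : Gg g C c) : g 0 = 0 := by
  have := hg.hom 0 le_rfl 0
  simpa using this

lemma Gg.cont (hg : Gg g C c) : Continuous g := by
  have : LipschitzWith (Real.toNNReal C) g := by
    apply LipschitzWith.of_le_add_mul
    intro x y
    rw [dist_eq_norm, Real.coe_toNNReal _ hg.Cpos.le]
    exact hg.diff x y
  exact this.continuous

lemma Gg.eq_zero (hg : Gg g C c) {x : V} (h : g x = 0) : x = 0 := by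
  have h1 := hg.lo x
  have := hg.cpos
  have h3 : ‖x‖ ≤ 0 := by
    by_contra h4
    push Not at h4
    nlinarith [mul_pos this h4]
  exact norm_le_zero_iff.1 h3

lemma Gg.nonneg (hg : Gg g C c) (x : V) : 0 ≤ g x :=
  le_trans (mul_nonneg hg.cpos.le (norm_nonneg _)) (hg.lo x)

/-- by convexity, difference quotients are monotone -/
lemma Gg.mono (hg : Gg g C c) {x u : V} {ε t s : ℝ} (ht : 0 < t) (hs : 0 < s) (hst : s ≤ t)
    (h : g (x + t • u) ≤ g x + ε * t) : g (x + s • u) ≤ g x + ε * s := by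
  have e : x + s • u = (1 - s / t) • x + (s / t) • (x + t • u) := by
    rw [smul_add, smul_smul, div_mul_cancel₀ _ ht.ne', ← add_assoc, ← add_smul]
    simp
  have h1 : s / t ≤ 1 := (div_le_one ht).2 hst
  have h0 : 0 ≤ s / t := by positivity
  have h2 := hg.add ((1 - s / t) • x) ((s / t) • (x + t • u))
  rw [hg.hom _ (by linarith), hg.hom _ h0, ← e] at h2
  have h3 := mul_le_mul_of_nonneg_left h h0
  have h4 : s / t * (ε * t) = ε * s := by field_simp
  nlinarith

lemma Np.ev (hg : Gg g C c) {x u : V} (h : Np g x u) {ε : ℝ} (hε : 0 < ε) :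
    ∃ t > 0, ∀ s, 0 < s → s ≤ t → g (x + s • u) ≤ g x + ε * s := by
  obtain ⟨t, ht, h1⟩ := h ε hε
  exact ⟨t, ht, fun s hs hst => hg.mono ht hs hst h1⟩

lemma Np.of_le {x u : V} {t : ℝ} (ht : 0 < t) (h : g (x + t • u) ≤ g x) : Np g x u :=
  fun ε hε => ⟨t, ht, by nlinarith [mul_pos hε ht]⟩

lemma Np.zero {x : V} : Np g x 0 := Np.of_le one_pos (by simp)

lemma Np.smul {x u : V} (h : Np g x u) {r : ℝ} (hr : 0 ≤ r) : Np g x (r • u) := by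
  rcases hr.eq_or_lt with rfl | hr
  · simpa using Np.zero
  intro ε hε
  obtain ⟨t, ht, h1⟩ := h (ε / r) (by positivity)
  refine ⟨t / r, by positivity, ?_⟩
  rw [smul_smul, div_mul_cancel₀ _ hr.ne']
  convert h1 using 2
  field_simp

lemma Np.add (hg : Gg g C c) {x u w : V} (hu : Np g x u) (hw : Np g x w) : Np g x (u + w) := by
  intro ε hε
  obtain ⟨t, ht, h1⟩ := hu.ev hg (half_pos hε)
  obtain ⟨s, hs, h2⟩ := hw.ev hg (half_pos hε)
  set r := min t s with hr
  have hr0 : 0 < r := lt_min ht hs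
  refine ⟨r / 2, by positivity, ?_⟩
  have e : x + (r / 2) • (u + w) = (1 / 2 : ℝ) • (x + r • u) + (1 / 2 : ℝ) • (x + r • w) := by
    module
  rw [e]
  have h3 := hg.add ((1 / 2 : ℝ) • (x + r • u)) ((1 / 2 : ℝ) • (x + r • w))
  rw [hg.hom _ (by norm_num), hg.hom _ (by norm_num)] at h3
  have h4 := h1 r hr0 (min_le_left _ _)
  have h5 := h2 r hr0 (min_le_right _ _)
  linarith

lemma Np.lim (hg : Gg g C c) {x : V} {u : ℕ → V} {w : V} (hu : ∀ i, Np g x (u i))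
    (h : Tendsto u atTop (𝓝 w)) : Np g x w := by
  intro ε hε
  have hC := hg.Cpos
  obtain ⟨i, hi⟩ := (Metric.tendsto_atTop.1 h (ε / (2 * C)) (by positivity))
  have hi := hi i le_rfl
  rw [dist_comm, dist_eq_norm] at hi
  obtain ⟨t, ht, h1⟩ := hu i (ε / 2) (half_pos hε)
  refine ⟨t, ht, ?_⟩
  have h2 := hg.diff (x + t • w) (x + t • u i)
  rw [add_sub_add_left_eq_sub, ← smul_sub, norm_smul, Real.norm_of_nonneg ht.le] at h2
  have h3 : C * (t * ‖w - u i‖) ≤ ε / 2 * t := by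
    have : C * (t * ‖w - u i‖) ≤ C * (t * (ε / (2 * C))) := by gcongr
    refine this.trans (le_of_eq ?_)
    field_simp
  linarith

/-- lineality space -/
def lin (hg : Gg g C c) (x : V) : Submodule ℝ V where
  carrier := {u | Np g x u ∧ Np g x (-u)}
  zero_mem' := ⟨Np.zero, by simpa using Np.zero⟩
  add_mem' := by
    rintro a b ⟨h1, h2⟩ ⟨h3, h4⟩
    refine ⟨h1.add hg h3, ?_⟩
    rw [neg_add]
    exact h2.add hg h4
  smul_mem' := by
    rintro r a ⟨h1, h2⟩
    rcases le_total 0 r with hr | hr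
    · exact ⟨h1.smul hr, by rw [← smul_neg]; exact h2.smul hr⟩
    · have hr' : 0 ≤ -r := by linarith
      refine ⟨?_, ?_⟩
      · have := h2.smul hr'
        simpa using this
      · have := h1.smul hr'
        simpa using this

/-- the final step -/
lemma forward (hg : Gg g C c) {B : Set V} (hB : ∀ x, g x = 1 → x ∈ frontier B) {x u : V}
    (hx : g x = 1) (hu : Np g x u) (hu' : Np g x (-u)) :
    ∃ (p : ℕ → V) (c : ℕ → ℝ), (∀ i, p i ∈ frontier B) ∧ (∀ i, 0 < c i) ∧
    Tendsto p atTop (𝓝 x) ∧ Tendsto (fun i => c i • (p i - x)) atTop (𝓝 u) := by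
  -- quotient tends to zero
  have hq : Tendsto (fun t : ℝ => (1 - g (x + t • u)) / t) (𝓝[>] 0) (𝓝 0) := by
    rw [Metric.tendsto_nhds]
    intro ε hε
    obtain ⟨t, ht, h1⟩ := hu.ev hg (half_pos hε)
    obtain ⟨s, hs, h2⟩ := hu'.ev hg (half_pos hε)
    have : Set.Ioc (0 : ℝ) (min t s) ∈ 𝓝[>] (0 : ℝ) := Ioc_mem_nhdsGT (lt_min ht hs)
    filter_upwards [this] with r hr
    have h3 := h1 r hr.1 (hr.2.trans (min_le_left _ _))
    have h4 := h2 r hr.1 (hr.2.trans (min_le_right _ _))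
    have h5 := hg.add (x + r • u) (x + r • (-u))
    have e : x + r • u + (x + r • (-u)) = (2 : ℝ) • x := by module
    rw [e, hg.hom _ (by norm_num), hx] at h5
    rw [hx] at h3 h4
    have hr0 := hr.1
    rw [dist_zero_right, norm_div, Real.norm_eq_abs, Real.norm_of_nonneg hr0.le, div_lt_iff₀ hr0,
      abs_lt]
    have := mul_pos hε hr0
    constructor <;> linarith
  set t : ℕ → ℝ := fun i => 1 / ((i : ℝ) + 1 + C * ‖u‖) with htd
  have hCu : 0 ≤ C * ‖u‖ := mul_nonneg hg.Cpos.le (norm_nonneg _)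
  have ht0 : ∀ i, 0 < t i := fun i => by positivity
  have htl : Tendsto t atTop (𝓝 0) := by
    have : Tendsto (fun i : ℕ => (i : ℝ) + 1 + C * ‖u‖) atTop atTop :=
      tendsto_atTop_add_const_right _ _
        (tendsto_atTop_add_const_right _ _ tendsto_natCast_atTop_atTop)
    simp only [htd, one_div]
    exact this.inv_tendsto_atTop
  have htl' : Tendsto t atTop (𝓝[>] 0) :=
    tendsto_nhdsWithin_iff.2 ⟨htl, Eventually.of_forall ht0⟩
  have hxt : Tendsto (fun i => x + t i • u) atTop (𝓝 x) := by
    have := (htl.smul_const u).const_add x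
    simpa using this
  have hgt : Tendsto (fun i => g (x + t i • u)) atTop (𝓝 1) := by
    have := (hg.cont.tendsto x).comp hxt
    rwa [hx] at this
  have hpos : ∀ i, 0 < g (x + t i • u) := by
    intro i
    have h1 := hg.nonneg (x + t i • u)
    refine lt_of_le_of_ne h1 ?_
    intro h2
    have h3 := hg.eq_zero h2.symm
    have h4 : x = (t i) • (-u) := by rw [smul_neg]; exact eq_neg_of_add_eq_zero_left h3
    have h5 := hg.up (-u)
    have h6 := hg.hom (t i) (ht0 i).le (-u)
    rw [← h4, hx] at h6
    rw [norm_neg] at h5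
    have h7 : t i * g (-u) ≤ t i * (C * ‖u‖) := by gcongr
    have h8 : t i * (C * ‖u‖) < 1 := by
      simp only [htd]
      rw [one_div, inv_mul_lt_iff₀ (by positivity)]
      have : (0 : ℝ) ≤ i := by positivity
      linarith
    linarith
  refine ⟨fun i => (g (x + t i • u))⁻¹ • (x + t i • u), fun i => (t i)⁻¹, ?_, ?_, ?_, ?_⟩
  · intro i
    apply hB
    rw [hg.hom _ (inv_nonneg.2 (hpos i).le), inv_mul_cancel₀ (hpos i).ne']
  · exact fun i => inv_pos.2 (ht0 i)
  · have := (hgt.inv₀ one_ne_zero).smul hxt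
    simpa using this
  · have h1 := (hgt.inv₀ one_ne_zero).smul (((hq.comp htl').smul_const x).const_add u)
    simp only [inv_one, zero_smul, add_zero, one_smul] at h1
    refine h1.congr ?_
    intro i
    have e1 := (hpos i).ne'
    have e2 := (ht0 i).ne'
    simp only [Function.comp]
    generalize g (x + t i • u) = G at *
    match_scalars <;> field_simp

end

end TTR


namespace TTR

section det
variable {n : ℕ}

/-- trace of an endomorphism of the coordinate space -/
noncomputable def tr (Q : (Fin n → ℝ) →L[ℝ] (Fin n → ℝ)) : ℝ :=
  LinearMap.trace ℝ (Fin n → ℝ) (Q : (Fin n → ℝ) →ₗ[ℝ] (Fin n → ℝ))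

lemma det_eq (M : (Fin n → ℝ) →L[ℝ] (Fin n → ℝ)) :
    M.det = (LinearMap.toMatrix' (M : (Fin n → ℝ) →ₗ[ℝ] (Fin n → ℝ))).det := by
  rw [LinearMap.det_toMatrix']

lemma det_diff : Differentiable ℝ (fun M : (Fin n → ℝ) →L[ℝ] (Fin n → ℝ) => M.det) := by
  simp only [det_eq, Matrix.det_apply, LinearMap.toMatrix'_apply]
  apply Differentiable.fun_sum
  intro σ _
  apply Differentiable.const_smul
  simp only [ContinuousLinearMap.coe_coe]
  fun_prop

lemma det_line (Q : (Fin n → ℝ) →L[ℝ] (Fin n → ℝ)) :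
    HasDerivAt (fun t : ℝ => ((1 : (Fin n → ℝ) →L[ℝ] (Fin n → ℝ)) + t • Q).det) (tr Q) 0 := by
  set P := LinearMap.toMatrix' (Q : (Fin n → ℝ) →ₗ[ℝ] (Fin n → ℝ)) with hP
  have h4 : HasDerivAt (fun t : ℝ => 1 + P.trace * t +
      ((1 + (Polynomial.X : Polynomial ℝ) • P.map Polynomial.C).det.divX.divX).eval t * t ^ 2)
        P.trace 0 := by
    have hp := ((Polynomial.hasDerivAt
      ((1 + (Polynomial.X : Polynomial ℝ) • P.map Polynomial.C).det.divX.divX) 0).mul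
        (hasDerivAt_pow 2 (0 : ℝ)))
    have := ((((hasDerivAt_id (0 : ℝ)).const_mul P.trace).const_add 1).add hp)
    refine HasDerivAt.congr_deriv this ?_
    simp
  have e1 : tr Q = P.trace := by
    rw [tr, hP, ← LinearMap.toMatrix_eq_toMatrix', LinearMap.trace_eq_matrix_trace ℝ (Pi.basisFun ℝ (Fin n))]
  rw [e1]
  convert h4 using 1
  ext t
  rw [← Matrix.det_one_add_smul, det_eq]
  congr 1
  simp [hP]

lemma det_hasF : ∃ D : ((Fin n → ℝ) →L[ℝ] (Fin n → ℝ)) →L[ℝ] ℝ,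
    HasFDerivAt (fun M : (Fin n → ℝ) →L[ℝ] (Fin n → ℝ) => M.det) D 1 ∧ ∀ Q, D Q = tr Q := by
  refine ⟨_, (det_diff (n := n) 1).hasFDerivAt, ?_⟩
  intro Q
  have h1 : HasDerivAt (fun t : ℝ => (1 : (Fin n → ℝ) →L[ℝ] (Fin n → ℝ)) + t • Q) Q 0 := by
    have := ((hasDerivAt_id (0 : ℝ)).smul_const Q).const_add (1 : (Fin n → ℝ) →L[ℝ] (Fin n → ℝ))
    refine HasDerivAt.congr_deriv this ?_
    simp
  have h2 := (det_diff (n := n) 1).hasFDerivAt.comp_hasDerivAt_of_eq (0 : ℝ) h1 (by simp)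
  exact h2.unique (det_line Q)

lemma det_lim {Q : ℕ → (Fin n → ℝ) →L[ℝ] (Fin n → ℝ)} {Q0 : (Fin n → ℝ) →L[ℝ] (Fin n → ℝ)}
    (hQ : Tendsto Q atTop (𝓝 Q0)) {r : ℕ → ℝ} (hr0 : ∀ i, 0 < r i)
    (hr : Tendsto r atTop (𝓝 0)) :
    Tendsto (fun i => ((1 + r i • Q i).det - 1) / r i) atTop (𝓝 (tr Q0)) := by
  obtain ⟨D, h2, hD⟩ := det_hasF (n := n)
  rw [← hD]
  have h3 : Tendsto (fun i => r i • Q i) atTop (𝓝 0) := by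
    simpa using hr.smul hQ
  have h4 := (hasFDerivWithinAt_univ.2 h2).lim (l := atTop) (c := fun i => (r i)⁻¹)
    (d := fun i => r i • Q i) (v := Q0) h3 (by simp) ?_
  · refine h4.congr ?_
    intro i
    have : (1 : (Fin n → ℝ) →L[ℝ] (Fin n → ℝ)).det = 1 := by simp [ContinuousLinearMap.det]
    rw [this, smul_eq_mul, div_eq_inv_mul]
  · refine hQ.congr fun i => ?_
    rw [smul_smul, inv_mul_cancel₀ (hr0 i).ne', one_smul]

lemma det_mul' (M N : (Fin n → ℝ) →L[ℝ] (Fin n → ℝ)) : (M * N).det = M.det * N.det := by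
  have : ((M * N : (Fin n → ℝ) →L[ℝ] (Fin n → ℝ)) : (Fin n → ℝ) →ₗ[ℝ] (Fin n → ℝ)) =
    (M : (Fin n → ℝ) →ₗ[ℝ] (Fin n → ℝ)) * (N : (Fin n → ℝ) →ₗ[ℝ] (Fin n → ℝ)) := rfl
  simp only [ContinuousLinearMap.det, this, map_mul]

lemma exp_add_smul (T : (Fin n → ℝ) →L[ℝ] (Fin n → ℝ)) (a b : ℝ) :
    NormedSpace.exp ((a + b) • T) = NormedSpace.exp (a • T) * NormedSpace.exp (b • T) := by
  let _ : NormedAlgebra ℚ ((Fin n → ℝ) →L[ℝ] (Fin n → ℝ)) := NormedAlgebra.restrictScalars ℚ ℝ _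
  rw [add_smul, NormedSpace.exp_add_of_commute]
  exact ((Commute.refl T).smul_left a).smul_right _

lemma det_exp_one {T : (Fin n → ℝ) →L[ℝ] (Fin n → ℝ)} (hT : tr T = 0) (s : ℝ) :
    (NormedSpace.exp (s • T)).det = 1 := by
  have hd : ∀ s : ℝ, HasDerivAt (fun s : ℝ => (NormedSpace.exp (s • T)).det) 0 s := by
    intro s
    obtain ⟨D, h2, hD⟩ := det_hasF (n := n)
    have h1 := hasDerivAt_exp_smul_const (𝕂 := ℝ) T 0
    have h3 := h2.comp_hasDerivAt_of_eq (0 : ℝ) h1 (by simp)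
    rw [zero_smul, NormedSpace.exp_zero, one_mul, hD, hT] at h3
    have h3' : HasDerivAt ((fun M : (Fin n → ℝ) →L[ℝ] (Fin n → ℝ) => M.det) ∘
      fun u : ℝ => NormedSpace.exp (u • T)) 0 (s - s) := by simpa using h3
    have h4 := (h3'.comp_sub_const s s).const_mul ((NormedSpace.exp (s • T)).det)
    rw [mul_zero] at h4
    refine h4.congr_of_eventuallyEq (Eventually.of_forall fun t => ?_)
    simp only [Function.comp]
    rw [← det_mul', ← exp_add_smul]
    congr 3
    ring
  have := is_const_of_deriv_eq_zero (fun s => (hd s).differentiableAt) (fun s => (hd s).deriv) s 0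
  rw [this]
  simp [ContinuousLinearMap.det]

end det

end TTR


namespace TTR

section key
variable {V : Type*} [NormedAddCommGroup V] [NormedSpace ℝ V] {g : V → ℝ} {C c : ℝ} {n : ℕ}

lemma vol_rigid {h : (Fin n → ℝ) → ℝ} (hh : Gg h C c) {P : (Fin n → ℝ) →L[ℝ] (Fin n → ℝ)}
    (hP : P.det = 1) (hle : ∀ x, h (P x) ≤ h x) (x0 : Fin n → ℝ) : h (P x0) = h x0 := by
  by_contra hne
  have hlt : h (P x0) < h x0 := lt_of_le_of_ne (hle x0) hne
  obtain ⟨a, ha1, ha2⟩ := exists_between hlt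
  have ha : 0 < a := lt_of_le_of_lt (hh.nonneg _) ha1
  set U : Set (Fin n → ℝ) := {x | h (P x) < 1} ∩ {x | 1 < h x} with hU
  have hUo : IsOpen U := (isOpen_lt (hh.cont.comp P.continuous) continuous_const).inter
    (isOpen_lt continuous_const hh.cont)
  have hUn : U.Nonempty := by
    refine ⟨a⁻¹ • x0, ?_, ?_⟩
    · simp only [Set.mem_ofPred_eq, map_smul]
      rw [hh.hom _ (by positivity), inv_mul_lt_iff₀ ha]; simpa using ha1
    · simp only [Set.mem_ofPred_eq]
      rw [hh.hom _ (by positivity), lt_inv_mul_iff₀ ha]; simpa using ha2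
  have hUpos : 0 < volume U := hUo.measure_pos _ hUn
  set K : Set (Fin n → ℝ) := {x | h x ≤ 1} with hK
  have hKfin : volume K < ⊤ := by
    refine lt_of_le_of_lt (measure_mono (?_ : K ⊆ Metric.closedBall 0 (1 / c)))
      (measure_closedBall_lt_top)
    intro x hx
    rw [mem_closedBall_zero_iff, le_div_iff₀ hh.cpos, mul_comm]
    exact (hh.lo x).trans hx
  have hpre : volume ((P : (Fin n → ℝ) →ₗ[ℝ] (Fin n → ℝ)) ⁻¹' K) = volume K := by
    have hP' : LinearMap.det (P : (Fin n → ℝ) →ₗ[ℝ] (Fin n → ℝ)) = 1 := hP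
    rw [Measure.addHaar_preimage_linearMap _ (by rw [hP']; exact one_ne_zero), hP']
    simp
  have hsub : K ∪ U ⊆ (P : (Fin n → ℝ) →ₗ[ℝ] (Fin n → ℝ)) ⁻¹' K := by
    rintro x (hx | hx)
    · exact (hle x).trans hx
    · have h1 : h (P x) < 1 := hx.1
      exact h1.le
  have hdis : Disjoint K U := by
    rw [Set.disjoint_left]
    intro x hx hx2
    have h1 : 1 < h x := hx2.2
    have h2 : h x ≤ 1 := hx
    linarith
  have h1 := measure_mono (μ := volume) hsub
  rw [measure_union hdis hUo.measurableSet, hpre] at h1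
  have h2 : volume K < volume K + volume U := ENNReal.lt_add_right hKfin.ne hUpos.ne'
  exact absurd h1 (not_le.2 h2)

lemma key_le {h : (Fin n → ℝ) → ℝ} (hh : Gg h C c) {T : (Fin n → ℝ) →L[ℝ] (Fin n → ℝ)}
    (hN : ∀ x, Np h x (T x)) (x : Fin n → ℝ) {b : ℝ} (hb : 0 ≤ b) :
    h (NormedSpace.exp (b • T) x) ≤ h x := by
  have hder : ∀ s : ℝ, HasDerivAt (fun s : ℝ => (NormedSpace.exp (s • T)) x)
      (T ((NormedSpace.exp (s • T)) x)) s := by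
    intro s
    have h1 := hasDerivAt_exp_smul_const' (𝕂 := ℝ) T s
    exact h1.clm_apply (hasDerivAt_const s x) |>.congr_deriv (by simp)
  have hcont : Continuous (fun s : ℝ => (NormedSpace.exp (s • T)) x) :=
    continuous_iff_continuousAt.2 fun s => (hder s).continuousAt
  have := image_le_of_liminf_slope_right_le_deriv_boundary
    (f := fun s : ℝ => h ((NormedSpace.exp (s • T)) x)) (a := 0) (b := b)
    (B := fun _ => h x) (B' := fun _ => 0) (hh.cont.comp hcont).continuousOn (by simp)
    continuousOn_const (fun s _ => hasDerivWithinAt_const _ _ _) ?_ ⟨hb, le_rfl⟩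
  · exact this
  intro s _ r hr
  apply Eventually.frequently
  set y := (NormedSpace.exp (s • T)) x with hy
  obtain ⟨t, ht, h1⟩ := (hN y).ev hh (show 0 < r / 3 by linarith)
  have hC := hh.Cpos
  have ho := (hasDerivAt_iff_isLittleO.1 (hder s)).def (show 0 < r / (3 * C) by positivity)
  have hIoc : Set.Ioc s (s + t) ∈ 𝓝[>] s := Ioc_mem_nhdsGT (by linarith)
  filter_upwards [hIoc, nhdsWithin_le_nhds ho] with z hz hoz
  have hzs : 0 < z - s := by linarith [hz.1]
  rw [slope_def_field, div_lt_iff₀ hzs]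
  have h2 := h1 (z - s) hzs (by linarith [hz.2])
  have h3 := hh.diff ((NormedSpace.exp (z • T)) x) (y + (z - s) • T y)
  rw [← sub_sub] at h3
  rw [Real.norm_of_nonneg hzs.le] at hoz
  have h4 := mul_le_mul_of_nonneg_left hoz hC.le
  have h5 : C * (r / (3 * C) * (z - s)) = r / 3 * (z - s) := by field_simp
  have h6 := mul_pos hr hzs
  linarith

lemma key {h : (Fin n → ℝ) → ℝ} (hh : Gg h C c) {T : (Fin n → ℝ) →L[ℝ] (Fin n → ℝ)}
    (hT : tr T = 0) (hN : ∀ x, Np h x (T x)) (s : ℝ) (x : Fin n → ℝ) :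
    h (NormedSpace.exp (s • T) x) = h x := by
  have hp : ∀ s : ℝ, 0 ≤ s → ∀ x, h (NormedSpace.exp (s • T) x) = h x := fun s hs x =>
    vol_rigid hh (det_exp_one hT s) (fun x => key_le hh hN x hs) x
  rcases le_total 0 s with hs | hs
  · exact hp s hs x
  · have h1 := hp (-s) (by linarith) (NormedSpace.exp (s • T) x)
    have h2 : NormedSpace.exp ((-s) • T) (NormedSpace.exp (s • T) x) = x := by
      have := exp_add_smul T (-s) s
      rw [neg_add_cancel, zero_smul, NormedSpace.exp_zero] at this
      have h3 := congrArg (fun f => f x) this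
      simpa using h3.symm
    rw [h2] at h1
    exact h1.symm

lemma exp_deriv0 (T : (Fin n → ℝ) →L[ℝ] (Fin n → ℝ)) :
    HasDerivAt (fun s : ℝ => NormedSpace.exp (s • T)) T 0 := by
  have h1 := hasDerivAt_exp_smul_const' (𝕂 := ℝ) T 0
  simpa using h1

lemma key_neg {h : (Fin n → ℝ) → ℝ} (hh : Gg h C c) {T : (Fin n → ℝ) →L[ℝ] (Fin n → ℝ)}
    (hT : tr T = 0) (hN : ∀ x, Np h x (T x)) (x : Fin n → ℝ) : Np h x (- T x) := by
  have h1 : HasDerivAt (fun s : ℝ => (NormedSpace.exp (s • T)) x) (T x) 0 :=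
    ((exp_deriv0 T).clm_apply (hasDerivAt_const 0 x)).congr_deriv (by simp)
  have h2 := (hasFDerivWithinAt_univ.2 h1.hasFDerivAt).lim (l := atTop)
    (c := fun i : ℕ => ((i : ℝ) + 1)) (d := fun i => -(1 / ((i : ℝ) + 1))) (v := -1)
    (by simpa using (tendsto_one_div_add_atTop_nhds_zero_nat (𝕜 := ℝ)).neg) (by simp)
    (by
      refine tendsto_const_nhds.congr fun i => ?_
      have : (i : ℝ) + 1 ≠ 0 := by positivity
      rw [smul_eq_mul]
      field_simp)
  simp only [zero_add, zero_smul, NormedSpace.exp_zero, ContinuousLinearMap.toSpanSingleton_apply,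
    neg_smul, one_smul, one_apply_eq_self] at h2
  refine Np.lim hh (fun i => ?_) h2
  have hi : (0 : ℝ) < i + 1 := by positivity
  refine Np.of_le (t := 1 / ((i : ℝ) + 1)) (by positivity) (le_of_eq ?_)
  rw [smul_smul, one_div, inv_mul_cancel₀ hi.ne', one_smul, add_sub_cancel]
  exact key hh hT hN _ _

lemma Gg.comp (hg : Gg g C c) (φ : (Fin n → ℝ) →L[ℝ] V) {κ : ℝ} (hκ : 0 < κ)
    (hφ : ∀ x, κ * ‖x‖ ≤ ‖φ x‖) :
    Gg (fun x => g (φ x)) (C * (‖φ‖ + 1)) (c * κ) where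
  add x y := by simpa using hg.add (φ x) (φ y)
  hom t ht x := by simpa using hg.hom t ht (φ x)
  up x := by
    refine (hg.up _).trans ?_
    rw [mul_assoc]
    have h1 := φ.le_opNorm x
    have h2 := norm_nonneg x
    refine mul_le_mul_of_nonneg_left ?_ hg.Cpos.le
    nlinarith
  lo x := by
    refine le_trans ?_ (hg.lo _)
    rw [mul_assoc]
    exact mul_le_mul_of_nonneg_left (hφ x) hg.cpos.le
  cpos := mul_pos hg.cpos hκ
  Cpos := mul_pos hg.Cpos (by positivity)

lemma Np.comp {φ : (Fin n → ℝ) →L[ℝ] V} {x u : Fin n → ℝ} :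
    Np (fun x => g (φ x)) x u ↔ Np g (φ x) (φ u) := by
  simp [Np]

end key

end TTR


namespace TTR

section core
variable {V : Type*} [NormedAddCommGroup V] [NormedSpace ℝ V] {g : V → ℝ} {C c : ℝ} {n : ℕ}

/-- the set of linear maps carrying the central section onto the section of slope `t • l` -/
def S (g : V → ℝ) (φ : (Fin n → ℝ) →L[ℝ] V) (ν : V) (l : (Fin n → ℝ) →L[ℝ] ℝ) (t : ℝ) :
    Set ((Fin n → ℝ) →L[ℝ] (Fin n → ℝ)) :=
  {M | ∀ x, g (φ (M x) + (t * l (M x)) • ν) = g (φ x)}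

lemma mem_S {φ : (Fin n → ℝ) →L[ℝ] V} {ν : V} {l : (Fin n → ℝ) →L[ℝ] ℝ} {t : ℝ}
    {M : (Fin n → ℝ) →L[ℝ] (Fin n → ℝ)} :
    M ∈ S g φ ν l t ↔ ∀ x, g (φ (M x) + (t * l (M x)) • ν) = g (φ x) := Iff.rfl

lemma S_mul {φ : (Fin n → ℝ) →L[ℝ] V} {ν : V} {l : (Fin n → ℝ) →L[ℝ] ℝ} {t : ℝ}
    {M J : (Fin n → ℝ) →L[ℝ] (Fin n → ℝ)} (hM : M ∈ S g φ ν l t)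
    (hJ : ∀ x, g (φ (J x)) = g (φ x)) : M * J ∈ S g φ ν l t := by
  intro x
  rw [← hJ x]
  exact hM (J x)

lemma S_inj (hg : Gg g C c) {φ : (Fin n → ℝ) →L[ℝ] V} (hφ : ∀ x, φ x = 0 → x = 0)
    {ν : V} {l : (Fin n → ℝ) →L[ℝ] ℝ} {t : ℝ}
    {M : (Fin n → ℝ) →L[ℝ] (Fin n → ℝ)} (hM : M ∈ S g φ ν l t) :
    Function.Injective M := by
  rw [injective_iff_map_eq_zero]
  intro x hx
  have := hM x
  rw [hx] at this
  simp only [map_zero, mul_zero, zero_smul, add_zero, hg.zero] at this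
  exact hφ x (hg.eq_zero this.symm)

lemma core_a (hg : Gg g C c) (φ : (Fin n → ℝ) →L[ℝ] V) {κ : ℝ} (hκ : 0 < κ)
    (hφ : ∀ x, κ * ‖x‖ ≤ ‖φ x‖) (ν : V) (l : (Fin n → ℝ) →L[ℝ] ℝ)
    (hM : ∀ t : ℝ, (S g φ ν l t).Nonempty) :
    ∃ (t : ℕ → ℝ) (N : ℕ → (Fin n → ℝ) →L[ℝ] (Fin n → ℝ)), (∀ i, 0 < t i) ∧
      Tendsto t atTop (𝓝 0) ∧ (∀ i, N i ∈ S g φ ν l (t i)) ∧ Tendsto N atTop (𝓝 1) ∧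
      ∀ i, ∀ M ∈ S g φ ν l (t i), ‖N i - 1‖ ≤ ‖M - 1‖ := by
  have hφ0 : ∀ x, φ x = 0 → x = 0 := by
    intro x hx
    have := hφ x
    rw [hx, norm_zero] at this
    have h2 : ‖x‖ ≤ 0 := by
      by_contra h
      push Not at h
      nlinarith [mul_pos hκ h]
    exact norm_le_zero_iff.1 h2
  set δ := κ / (2 * (‖l‖ * ‖ν‖ + 1)) with hδ
  have hδ0 : 0 < δ := by positivity
  have hc := hg.cpos
  have hC := hg.Cpos
  have hlow : ∀ t, 0 ≤ t → t ≤ δ → ∀ y, κ / 2 * ‖y‖ ≤ ‖φ y + (t * l y) • ν‖ := by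
    intro t ht htδ y
    have h1 := norm_sub_le (φ y + (t * l y) • ν) ((t * l y) • ν)
    rw [add_sub_cancel_right] at h1
    have h2 : ‖(t * l y) • ν‖ ≤ κ / 2 * ‖y‖ := by
      rw [norm_smul, norm_mul, Real.norm_of_nonneg ht]
      calc t * ‖l y‖ * ‖ν‖ ≤ δ * (‖l‖ * ‖y‖) * ‖ν‖ := by
            gcongr
            exact l.le_opNorm y
        _ = δ * (‖l‖ * ‖ν‖) * ‖y‖ := by ring
        _ ≤ δ * (‖l‖ * ‖ν‖ + 1) * ‖y‖ := by gcongr; linarith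
        _ = κ / 2 * ‖y‖ := by rw [hδ]; field_simp
    have h3 := hφ y
    linarith
  set K := (C * ‖φ‖) / (c * (κ / 2)) with hK
  have hbd : ∀ t, 0 ≤ t → t ≤ δ → S g φ ν l t ⊆ Metric.closedBall 0 K := by
    intro t ht htδ M hMt
    rw [mem_closedBall_zero_iff]
    refine M.opNorm_le_bound (by positivity) fun x => ?_
    have h1 := hlow t ht htδ (M x)
    have h2 := hg.lo (φ (M x) + (t * l (M x)) • ν)
    rw [hMt x] at h2
    have h3 := hg.up (φ x)
    have h4 := φ.le_opNorm x
    rw [hK, div_mul_eq_mul_div, le_div_iff₀ (by positivity)]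
    have h5 : c * (κ / 2 * ‖M x‖) ≤ c * ‖φ (M x) + (t * l (M x)) • ν‖ := by gcongr
    have h6 : C * ‖φ x‖ ≤ C * (‖φ‖ * ‖x‖) := by gcongr
    linarith
  have hcl : ∀ t, IsClosed (S g φ ν l t) := by
    intro t
    have hgc := hg.cont
    have : S g φ ν l t = ⋂ x, {M | g (φ (M x) + (t * l (M x)) • ν) = g (φ x)} := by
      ext M; simp [mem_S]
    rw [this]
    refine isClosed_iInter fun x => isClosed_eq ?_ continuous_const
    fun_prop
  have hcomp : ∀ t, 0 ≤ t → t ≤ δ → IsCompact (S g φ ν l t) := fun t ht htδ =>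
    (isCompact_closedBall 0 K).of_isClosed_subset (hcl t) (hbd t ht htδ)
  set t : ℕ → ℝ := fun i => δ * (1 / ((i : ℝ) + 1)) with htd
  have ht0 : ∀ i, 0 < t i := fun i => by positivity
  have htδ : ∀ i, t i ≤ δ := by
    intro i
    have : (1 / ((i : ℝ) + 1)) ≤ 1 := by
      rw [div_le_one (by positivity)]
      have : (0 : ℝ) ≤ i := by positivity
      linarith
    simp only [htd]
    nlinarith
  have htl : Tendsto t atTop (𝓝 0) := by
    simpa [htd] using (tendsto_one_div_add_atTop_nhds_zero_nat (𝕜 := ℝ)).const_mul δ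
  have hmin : ∀ i, ∃ N ∈ S g φ ν l (t i), ∀ M ∈ S g φ ν l (t i), ‖N - 1‖ ≤ ‖M - 1‖ := by
    intro i
    obtain ⟨N, hN, hN2⟩ := (hcomp (t i) (ht0 i).le (htδ i)).exists_isMinOn (hM (t i))
      (f := fun M => ‖M - 1‖) (by fun_prop)
    exact ⟨N, hN, fun M hM => hN2 hM⟩
  choose N hNS hNmin using hmin
  choose M hMS using fun i => hM (t i)
  obtain ⟨M0, -, a, ha, haM⟩ := (isCompact_closedBall (0 : (Fin n → ℝ) →L[ℝ] (Fin n → ℝ))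
    K).tendsto_subseq (fun i => hbd (t i) (ht0 i).le (htδ i) (hMS i))
  have hta : Tendsto (fun i => t (a i)) atTop (𝓝 0) := htl.comp ha.tendsto_atTop
  have hM0 : M0 ∈ S g φ ν l 0 := by
    intro x
    have hgc := hg.cont
    have h1 : Tendsto (fun i => M (a i) x) atTop (𝓝 (M0 x)) := 
      ((ContinuousLinearMap.apply ℝ (Fin n → ℝ) x).continuous.tendsto M0).comp haM
    have h2 : Tendsto (fun i => g (φ (M (a i) x) + (t (a i) * l (M (a i) x)) • ν)) atTop
        (𝓝 (g (φ (M0 x) + (0 * l (M0 x)) • ν))) := by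
      refine (hgc.tendsto _).comp ?_
      refine ((φ.continuous.tendsto _).comp h1).add ?_
      exact (hta.mul ((l.continuous.tendsto _).comp h1)).smul_const ν
    refine tendsto_nhds_unique h2 ?_
    refine tendsto_const_nhds.congr fun i => ?_
    exact (hMS (a i) x).symm
  have hinj := S_inj hg hφ0 hM0
  set J : (Fin n → ℝ) →L[ℝ] (Fin n → ℝ) := LinearMap.toContinuousLinearMap
    ((LinearEquiv.ofInjectiveEndo (M0 : (Fin n → ℝ) →ₗ[ℝ] (Fin n → ℝ)) hinj).symm :
      (Fin n → ℝ) →ₗ[ℝ] (Fin n → ℝ)) with hJ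
  have hMJ : ∀ x, M0 (J x) = x := fun x =>
    (LinearEquiv.ofInjectiveEndo (M0 : (Fin n → ℝ) →ₗ[ℝ] (Fin n → ℝ)) hinj).apply_symm_apply x
  have hJS : ∀ x, g (φ (J x)) = g (φ x) := by
    intro x
    have := hM0 (J x)
    rw [hMJ] at this
    simpa using this.symm
  have hMJ1 : Tendsto (fun i => M (a i) * J) atTop (𝓝 1) := by
    have : M0 * J = 1 := by ext1 x; exact hMJ x
    rw [← this]
    exact haM.mul_const J
  refine ⟨fun i => t (a i), fun i => N (a i), fun i => ht0 _, hta, fun i => hNS _, ?_,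
    fun i => hNmin _⟩
  rw [tendsto_iff_norm_sub_tendsto_zero] at hMJ1 ⊢
  refine squeeze_zero (fun _ => norm_nonneg _) (fun i => ?_) hMJ1
  exact hNmin _ _ (S_mul (hMS _) hJS)

lemma det_quot (hg : Gg g C c) (φ : (Fin n → ℝ) →L[ℝ] V) {κ : ℝ} (hκ : 0 < κ)
    (hφ : ∀ x, κ * ‖x‖ ≤ ‖φ x‖) (ν : V) (l : (Fin n → ℝ) →L[ℝ] ℝ)
    (hvol : HasDerivAt (fun t : ℝ => (volume {x | g (φ x + (t * l x) • ν) ≤ 1}).toReal) 0 0)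
    {t : ℕ → ℝ} {N : ℕ → (Fin n → ℝ) →L[ℝ] (Fin n → ℝ)} (ht : ∀ i, 0 < t i)
    (htl : Tendsto t atTop (𝓝 0)) (hN : ∀ i, N i ∈ S g φ ν l (t i)) 
    (hN1 : Tendsto N atTop (𝓝 1)) :
    Tendsto (fun i => ((N i).det - 1) / t i) atTop (𝓝 0) := by
  have hh := hg.comp φ hκ hφ
  set v := fun t : ℝ => (volume {x | g (φ x + (t * l x) • ν) ≤ 1}).toReal with hv
  have hv0 : 0 < v 0 := by
    simp only [hv, zero_mul, zero_smul, add_zero]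
    refine ENNReal.toReal_pos ?_ ?_
    · refine ne_of_gt (lt_of_lt_of_le ((isOpen_lt hh.cont continuous_const).measure_pos volume
        ⟨0, ?_⟩) (measure_mono (s := {x | g (φ x) < 1}) ?_))
      · have := hh.zero
        show g (φ 0) < 1
        rw [this]; exact one_pos
      · intro x hx
        exact le_of_lt (show g (φ x) < 1 from hx)
    · refine ne_of_lt (lt_of_le_of_lt (measure_mono (t := Metric.closedBall 0 (1 / (c * κ))) ?_)
        (measure_closedBall_lt_top))
      intro x hx
      rw [mem_closedBall_zero_iff, le_div_iff₀ hh.cpos, mul_comm]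
      exact (hh.lo x).trans hx
  have hφ0 : ∀ x, φ x = 0 → x = 0 := by
    intro x hx
    exact hh.eq_zero (x := x) (by rw [hx, hg.zero])
  have hdet : ∀ i, |(N i).det| = v (t i) / v 0 := by
    intro i
    have hne : LinearMap.det ((N i) : (Fin n → ℝ) →ₗ[ℝ] (Fin n → ℝ)) ≠ 0 := by
      intro h
      have := LinearMap.bot_lt_ker_of_det_eq_zero h
      rw [LinearMap.ker_eq_bot.2 (S_inj hg hφ0 (hN i))] at this
      exact lt_irrefl _ this
    have h1 := Measure.addHaar_preimage_linearMap volume hne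
      {x | g (φ x + (t i * l x) • ν) ≤ 1}
    have h2 : ((N i) : (Fin n → ℝ) →ₗ[ℝ] (Fin n → ℝ)) ⁻¹' {x | g (φ x + (t i * l x) • ν) ≤ 1} =
        {x | g (φ x + (0 * l x) • ν) ≤ 1} := by
      ext x
      have := hN i x
      simp [this]
    rw [h2] at h1
    have h3 := congrArg ENNReal.toReal h1
    rw [ENNReal.toReal_mul, ENNReal.toReal_ofReal (abs_nonneg _), abs_inv] at h3
    have h4 : v 0 = |(N i).det|⁻¹ * v (t i) := h3
    have h5 : |(N i).det| ≠ 0 := abs_ne_zero.2 hne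
    rw [eq_div_iff hv0.ne', h4, ← mul_assoc, mul_inv_cancel₀ h5, one_mul]
  have hq : Tendsto (fun i => (|(N i).det| - 1) / t i) atTop (𝓝 0) := by
    have h4 := (hasFDerivWithinAt_univ.2 hvol.hasFDerivAt).lim (l := atTop)
      (c := fun i => (t i)⁻¹) (d := t) (v := 1) htl (by simp) 
      (tendsto_const_nhds.congr fun i => by rw [smul_eq_mul, inv_mul_cancel₀ (ht i).ne'])
    simp only [zero_add, ContinuousLinearMap.toSpanSingleton_apply, smul_zero] at h4
    have h5 := h4.const_mul (v 0)⁻¹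
    rw [mul_zero] at h5
    refine h5.congr fun i => ?_
    rw [hdet, smul_eq_mul]
    have := (ht i).ne'
    have := hv0.ne'
    change (v 0)⁻¹ * ((t i)⁻¹ * (v (t i) - v 0)) = _
    field_simp
  have hdc : Tendsto (fun i => (N i).det) atTop (𝓝 1) := by
    have := (det_diff (n := n)).continuous.tendsto 1
    have h1 : (1 : (Fin n → ℝ) →L[ℝ] (Fin n → ℝ)).det = 1 := by simp [ContinuousLinearMap.det]
    rw [h1] at this
    exact this.comp hN1
  refine hq.congr' ?_
  filter_upwards [hdc.eventually (lt_mem_nhds (zero_lt_one' ℝ))] with i hi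
  rw [abs_of_pos hi]

lemma core (hg : Gg g C c) (φ : (Fin n → ℝ) →L[ℝ] V) {κ : ℝ} (hκ : 0 < κ)
    (hφ : ∀ x, κ * ‖x‖ ≤ ‖φ x‖) (ν : V) (l : (Fin n → ℝ) →L[ℝ] ℝ)
    (hM : ∀ t : ℝ, (S g φ ν l t).Nonempty)
    (hvol : HasDerivAt (fun t : ℝ => (volume {x | g (φ x + (t * l x) • ν) ≤ 1}).toReal) 0 0) :
    ∃ R : (Fin n → ℝ) →L[ℝ] (Fin n → ℝ), tr R = 0 ∧ ∀ x, Np g (φ x) (φ (R x) + l x • ν) := by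
  obtain ⟨t, N, ht, htl, hN, hN1, hmin⟩ := core_a hg φ hκ hφ ν l hM
  have hq := det_quot hg φ hκ hφ ν l hvol ht htl hN hN1
  have hh := hg.comp φ hκ hφ
  set r : ℕ → ℝ := fun i => max ‖N i - 1‖ (t i) with hr
  have hr0 : ∀ i, 0 < r i := fun i => lt_max_of_lt_right (ht i)
  have hrl : Tendsto r atTop (𝓝 0) := by
    have := (tendsto_iff_norm_sub_tendsto_zero.1 hN1).max htl
    simpa using this
  set Q : ℕ → (Fin n → ℝ) →L[ℝ] (Fin n → ℝ) := fun i => (r i)⁻¹ • (N i - 1) with hQ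
  have hNQ : ∀ i, N i = 1 + r i • Q i := by
    intro i
    simp only [hQ]
    rw [smul_smul, mul_inv_cancel₀ (hr0 i).ne', one_smul, add_sub_cancel]
  set τ : ℕ → ℝ := fun i => t i / r i with hτ
  have hmem : ∀ i, (Q i, τ i) ∈ (Metric.closedBall (0 : (Fin n → ℝ) →L[ℝ] (Fin n → ℝ)) 1) ×ˢ
      Set.Icc (0 : ℝ) 1 := by
    intro i
    refine ⟨?_, ?_, ?_⟩
    · simp only [mem_closedBall_zero_iff, hQ, norm_smul, norm_inv, Real.norm_of_nonneg (hr0 i).le]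
      rw [inv_mul_le_iff₀ (hr0 i), mul_one]
      exact le_max_left _ _
    · exact div_nonneg (ht i).le (hr0 i).le
    · exact (div_le_one (hr0 i)).2 (le_max_right _ _)
  obtain ⟨⟨Q0, τ0⟩, hmem0, b, hb, hlim⟩ :=
    ((isCompact_closedBall _ _).prod isCompact_Icc).tendsto_subseq hmem
  have hQl : Tendsto (fun i => Q (b i)) atTop (𝓝 Q0) := (continuous_fst.tendsto _).comp hlim
  have hτl : Tendsto (fun i => τ (b i)) atTop (𝓝 τ0) := (continuous_snd.tendsto _).comp hlim
  have hrb : Tendsto (fun i => r (b i)) atTop (𝓝 0) := hrl.comp hb.tendsto_atTop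
  have hNb : Tendsto (fun i => N (b i)) atTop (𝓝 1) := hN1.comp hb.tendsto_atTop
  -- trace
  have htr : tr Q0 = 0 := by
    have h1 := det_lim hQl (fun i => hr0 (b i)) hrb
    have h2 := (hq.comp hb.tendsto_atTop).mul hτl
    rw [zero_mul] at h2
    refine tendsto_nhds_unique h1 (h2.congr fun i => ?_)
    simp only [Function.comp, hτ]
    rw [← hNQ]
    have := (ht (b i)).ne'
    have := (hr0 (b i)).ne'
    field_simp
  have hNp : ∀ x, Np g (φ x) (φ (Q0 x) + (τ0 * l x) • ν) := by
    intro x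
    have hlimx : ∀ {P : ℕ → (Fin n → ℝ) →L[ℝ] (Fin n → ℝ)} {P0}, Tendsto P atTop (𝓝 P0) →
        Tendsto (fun i => P i x) atTop (𝓝 (P0 x)) := fun {P P0} h =>
      ((ContinuousLinearMap.apply ℝ (Fin n → ℝ) x).continuous.tendsto P0).comp h
    have h1 : Tendsto (fun i => φ (Q (b i) x) + (τ (b i) * l (N (b i) x)) • ν) atTop
        (𝓝 (φ (Q0 x) + (τ0 * l x) • ν)) := by
      refine ((φ.continuous.tendsto _).comp (hlimx hQl)).add ?_
      exact (hτl.mul ((l.continuous.tendsto _).comp (hlimx hNb))).smul_const ν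
    refine Np.lim hg (fun i => ?_) h1
    refine Np.of_le (hr0 (b i)) (le_of_eq ?_)
    rw [← hN (b i) x]
    congr 1
    have e1 : φ (N (b i) x) = φ x + r (b i) • φ (Q (b i) x) := by
      conv_lhs => rw [hNQ]
      simp
    rw [e1, smul_add, smul_smul, ← mul_assoc, ← add_assoc]
    congr 3
    simp only [hτ]
    rw [mul_div_cancel₀ _ (hr0 (b i)).ne']
  rcases hmem0.2.1.eq_or_lt with h0 | hpos
  · -- degenerate case
    exfalso
    have h0 : τ0 = 0 := h0.symm
    have hNp' : ∀ x, Np (fun x => g (φ x)) x (Q0 x) := by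
      intro x
      have := hNp x
      rw [h0, zero_mul, zero_smul, add_zero] at this
      exact Np.comp.2 this
    have hex := key hh htr hNp'
    have hle : ∀ i, ‖N (b i) - 1‖ ≤ ‖N (b i) * NormedSpace.exp ((-r (b i)) • Q0) - 1‖ := fun i =>
      hmin _ _ (S_mul (hN _) (hex _))
    have hL : Tendsto (fun i => (r (b i))⁻¹ * ‖N (b i) - 1‖) atTop (𝓝 1) := by
      have h1 : Tendsto (fun i => ‖Q (b i)‖) atTop (𝓝 ‖Q0‖) := hQl.norm
      have h2 : ∀ i, max ‖Q (b i)‖ (τ (b i)) = 1 := by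
        intro i
        simp only [hQ, hτ, norm_smul, norm_inv, Real.norm_of_nonneg (hr0 (b i)).le, div_eq_inv_mul]
        rw [← mul_max_of_nonneg _ _ (inv_nonneg.2 (hr0 (b i)).le)]
        exact inv_mul_cancel₀ (hr0 (b i)).ne'
      have h3 := h1.max hτl
      simp only [h2, h0] at h3
      have h4 := tendsto_nhds_unique h3 tendsto_const_nhds
      rw [max_eq_left (norm_nonneg _)] at h4
      rw [h4] at h1
      refine h1.congr fun i => ?_
      simp only [hQ, norm_smul, norm_inv, Real.norm_of_nonneg (hr0 (b i)).le]
    have hR : Tendsto (fun i => (r (b i))⁻¹ *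
        ‖N (b i) * NormedSpace.exp ((-r (b i)) • Q0) - 1‖) atTop (𝓝 0) := by
      have h4 := (hasFDerivWithinAt_univ.2 (exp_deriv0 Q0).hasFDerivAt).lim (l := atTop)
        (c := fun i => (r (b i))⁻¹) (d := fun i => - r (b i)) (v := -1)
        (by simpa using hrb.neg) (by simp)
        (tendsto_const_nhds.congr fun i => by
          rw [smul_eq_mul, mul_neg, inv_mul_cancel₀ (hr0 (b i)).ne'])
      simp only [zero_add, zero_smul, NormedSpace.exp_zero,
        ContinuousLinearMap.toSpanSingleton_apply] at h4
      have h5 := (hNb.mul h4).add hQl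
      have h6 := h5.norm
      simp only [one_mul, neg_smul, one_smul, neg_add_cancel, norm_zero] at h6
      refine h6.congr fun i => ?_
      rw [← Real.norm_of_nonneg (inv_nonneg.2 (hr0 (b i)).le), ← norm_smul, 
        Real.norm_of_nonneg (inv_nonneg.2 (hr0 (b i)).le)]
      congr 1
      simp only [hQ, mul_smul_comm, ← smul_add]
      congr 1
      rw [mul_sub, mul_one]
      abel
    have := le_of_tendsto_of_tendsto' hL hR (fun i =>
      mul_le_mul_of_nonneg_left (hle i) (inv_nonneg.2 (hr0 (b i)).le))
    linarith
  · have hpos : 0 < τ0 := hpos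
    refine ⟨τ0⁻¹ • Q0, ?_, ?_⟩
    · have : tr (τ0⁻¹ • Q0) = τ0⁻¹ * tr Q0 := by simp [tr]
      rw [this, htr, mul_zero]
    · intro x
      have := (hNp x).smul (inv_nonneg.2 hpos.le)
      rw [smul_add, smul_smul, ← mul_assoc, inv_mul_cancel₀ hpos.ne', one_mul] at this
      simpa using this

/-- two-sided version -/
lemma core2 (hg : Gg g C c) (φ : (Fin n → ℝ) →L[ℝ] V) {κ : ℝ} (hκ : 0 < κ)
    (hφ : ∀ x, κ * ‖x‖ ≤ ‖φ x‖) (ν : V)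
    (hM : ∀ (l : (Fin n → ℝ) →L[ℝ] ℝ) (t : ℝ), (S g φ ν l t).Nonempty)
    (hvol : ∀ l : (Fin n → ℝ) →L[ℝ] ℝ,
      HasDerivAt (fun t : ℝ => (volume {x | g (φ x + (t * l x) • ν) ≤ 1}).toReal) 0 0)
    (l : (Fin n → ℝ) →L[ℝ] ℝ) :
    ∃ R : (Fin n → ℝ) →L[ℝ] (Fin n → ℝ), tr R = 0 ∧ ∀ x, φ (R x) + l x • ν ∈ lin hg (φ x) := by
  obtain ⟨R, hR, h1⟩ := core hg φ hκ hφ ν l (hM l) (hvol l)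
  obtain ⟨R', hR', h2⟩ := core hg φ hκ hφ ν (-l) (hM (-l)) (hvol (-l))
  refine ⟨R, hR, fun x => ⟨h1 x, ?_⟩⟩
  have hh := hg.comp φ hκ hφ
  have h3 : ∀ x, Np (fun x => g (φ x)) x ((R + R') x) := by
    intro x
    rw [Np.comp]
    have := (h1 x).add hg (h2 x)
    convert this using 1
    simp only [add_apply, map_add, neg_apply]
    module
  have h4 := key_neg hh (by simp only [tr] at *; simp [hR, hR']) h3 x
  have h5 := (h2 x).add hg (Np.comp.1 (by simpa using h4))
  convert h5 using 1
  simp only [map_add, map_neg, neg_apply]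
  module

end core

end TTR


namespace TTR

section geom
variable {V : Type*} [NormedAddCommGroup V] [NormedSpace ℝ V] {n : ℕ}

lemma gauge_Gg {B : Set V} (hBcomp : IsCompact B) (hBconv : Convex ℝ B)
    (h0 : (0 : V) ∈ interior B) : ∃ C c, Gg (gauge B) C c := by
  have hnhds : B ∈ 𝓝 (0 : V) := mem_interior_iff_mem_nhds.1 h0
  have habs : Absorbent ℝ B := absorbent_nhds_zero hnhds
  obtain ⟨r, hr, hrB⟩ := Metric.mem_nhds_iff.1 hnhds
  obtain ⟨q, hq, hqB⟩ := hBcomp.isBounded.subset_closedBall_lt 0 0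
  refine ⟨r⁻¹, q⁻¹, gauge_add_le hBconv habs, fun t ht x => ?_, fun x => ?_, fun x => ?_,
    by positivity, by positivity⟩
  · rw [gauge_smul_of_nonneg ht, smul_eq_mul]
  · rw [← div_eq_inv_mul, ← gauge_ball hr.le]
    exact gauge_mono (absorbent_ball_zero hr) hrB x
  · rw [← div_eq_inv_mul]
    exact le_gauge_of_subset_closedBall habs hq.le hqB

lemma gauge_congr {W : Type*} [AddCommGroup W] [Module ℝ W] {B : Set V} (f f' : W →ₗ[ℝ] V)
    (h : ∀ x, f x ∈ B ↔ f' x ∈ B) (x : W) : gauge B (f x) = gauge B (f' x) := by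
  rw [gauge_def', gauge_def']
  congr 1
  ext r
  simp only [← map_smul, h]

lemma span_sec {B : Set V} (hnhds : B ∈ 𝓝 (0 : V)) (Y : Submodule ℝ V) :
    Submodule.span ℝ (B ∩ (Y : Set V)) = Y := by
  apply le_antisymm
  · rw [Submodule.span_le]
    exact Set.inter_subset_right
  · intro y hy
    have h1 : Tendsto (fun t : ℝ => t • y) (𝓝[>] 0) (𝓝 0) := by
      have : Tendsto (fun t : ℝ => t • y) (𝓝 0) (𝓝 ((0 : ℝ) • y)) :=
        (continuous_id.smul continuous_const).tendsto 0
      rw [zero_smul] at this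
      exact this.mono_left nhdsWithin_le_nhds
    obtain ⟨t, htB, ht0⟩ := ((h1.eventually hnhds).and self_mem_nhdsWithin).exists
    have ht0 : 0 < t := ht0
    have h2 : y = t⁻¹ • (t • y) := by rw [smul_smul, inv_mul_cancel₀ ht0.ne', one_smul]
    rw [h2]
    exact Submodule.smul_mem _ _ (Submodule.subset_span ⟨htB, Y.smul_mem _ hy⟩)

lemma section_map {B : Set V} (hnhds : B ∈ 𝓝 (0 : V))
    (hsec : ∀ X Y : Submodule ℝ V, Module.finrank ℝ X = n → Module.finrank ℝ Y = n →
      ∃ L : (Submodule.span ℝ (B ∩ (X : Set V))) ≃ₗ[ℝ] (Submodule.span ℝ (B ∩ (Y : Set V))),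
        (fun x : Submodule.span ℝ (B ∩ (X : Set V)) => (L x : V)) ''
          {x | (x : V) ∈ (B ∩ (X : Set V))} = (B ∩ (Y : Set V)))
    (φ ψ : (Fin n → ℝ) →ₗ[ℝ] V) (hφ : Function.Injective φ) (hψ : Function.Injective ψ) :
    ∃ M : (Fin n → ℝ) →ₗ[ℝ] (Fin n → ℝ), ∀ x, gauge B (ψ (M x)) = gauge B (φ x) := by
  have hd : ∀ f : (Fin n → ℝ) →ₗ[ℝ] V, Function.Injective f →
      Module.finrank ℝ (LinearMap.range f) = n := by
    intro f hf
    rw [LinearMap.finrank_range_of_inj hf]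
    simp
  obtain ⟨L, hL⟩ := hsec _ _ (hd φ hφ) (hd ψ hψ)
  have hX := span_sec hnhds (LinearMap.range φ)
  have hY := span_sec hnhds (LinearMap.range ψ)
  set φ' : (Fin n → ℝ) →ₗ[ℝ] Submodule.span ℝ (B ∩ (LinearMap.range φ : Set V)) :=
    φ.codRestrict _ (fun x => by rw [hX]; exact ⟨x, rfl⟩) with hφ'
  set M : (Fin n → ℝ) →ₗ[ℝ] (Fin n → ℝ) :=
    (LinearEquiv.ofInjective ψ hψ).symm.toLinearMap ∘ₗ (Submodule.inclusion hY.le) ∘ₗ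
      L.toLinearMap ∘ₗ φ' with hM
  have hψM : ∀ x, ψ (M x) = (L (φ' x) : V) := by
    intro x
    have h1 := (LinearEquiv.ofInjective ψ hψ).apply_symm_apply
      (Submodule.inclusion hY.le (L (φ' x)))
    have h2 := congrArg Subtype.val h1
    exact h2
  refine ⟨M, fun x => ?_⟩
  refine gauge_congr (ψ ∘ₗ M) φ (fun x => ?_) x
  simp only [LinearMap.comp_apply, hψM]
  have hLx : (L (φ' x) : V) ∈ LinearMap.range ψ := hY.le (L (φ' x)).2
  constructor
  · intro h
    have h1 : (L (φ' x) : V) ∈ B ∩ (LinearMap.range ψ : Set V) := ⟨h, hLx⟩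
    obtain ⟨z, hz, hz2⟩ := hL.ge h1
    have h3 : z = φ' x := L.injective (Subtype.ext hz2)
    rw [h3] at hz
    exact hz.1
  · intro h
    have h1 : (L (φ' x) : V) ∈ B ∩ (LinearMap.range ψ : Set V) :=
      hL.le ⟨φ' x, ⟨h, ⟨x, rfl⟩⟩, rfl⟩
    exact h1.1

end geom

section area
variable {V : Type*} [AddCommGroup V] [Module ℝ V] {n : ℕ}
  {E : Type*} [NormedAddCommGroup E] [NormedSpace ℝ E]

lemma alt_expand (m : V [⋀^Fin n]→ₗ[ℝ] E) (v : Fin n → V) (l : Fin n → ℝ) (ν : V) (t : ℝ) :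
    m (fun i => v i + (t * l i) • ν) =
      m v + t • ∑ i, l i • m (Function.update v i ν) := by
  have h := m.toMultilinearMap.map_add_eq_map_add_linearDeriv_add v (fun i => (t * l i) • ν)
  have h1 : ∑ s : Finset (Fin n) with 2 ≤ s.card,
      m.toMultilinearMap (s.piecewise (fun i => (t * l i) • ν) v) = 0 := by
    apply Finset.sum_eq_zero
    intro s hs
    simp only [Finset.mem_filter] at hs
    obtain ⟨i, hi, j, hj, hij⟩ := Finset.one_lt_card.1 hs.2
    have e : s.piecewise (fun i => (t * l i) • ν) v =
        Function.update (Function.update (s.piecewise (fun i => (t * l i) • ν) v) i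
          ((t * l i) • ν)) j ((t * l j) • ν) := by
      ext k
      by_cases hk : k = j
      · subst hk; simp [hj]
      · by_cases hk2 : k = i
        · subst hk2; simp [hk, hi]
        · simp [hk, hk2]
    rw [e, MultilinearMap.map_update_smul, Function.update_comm hij, 
      MultilinearMap.map_update_smul]
    have : m.toMultilinearMap (Function.update (Function.update
        (s.piecewise (fun i => (t * l i) • ν) v) j ν) i ν) = 0 := by
      apply m.map_eq_zero_of_eq _ _ hij
      simp [hij.symm]
    rw [this, smul_zero, smul_zero]
  rw [h1, add_zero] at h
  have e0 : (fun i => v i + (t * l i) • ν) = v + fun i => (t * l i) • ν := rfl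
  rw [e0]
  change m.toMultilinearMap _ = _
  rw [h, MultilinearMap.linearDeriv_apply, Finset.smul_sum]
  congr 1
  apply Finset.sum_congr rfl
  intro i _
  rw [MultilinearMap.map_update_smul, mul_smul]
  rfl

lemma exists_nu (m : V [⋀^Fin n]→ₗ[ℝ] E) (v : Fin n → V)
    (D : E →L[ℝ] ℝ) (hD : D (m v) ≠ 0) (ν0 : V) (hν0 : ν0 ∉ Submodule.span ℝ (Set.range v)) :
    ∃ ν, ν ∉ Submodule.span ℝ (Set.range v) ∧ ∀ i, D (m (Function.update v i ν)) = 0 := by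
  set y : Fin n → ℝ := fun i => - D (m (Function.update v i ν0)) / D (m v) with hy
  have hmem : ∑ j, y j • v j ∈ Submodule.span ℝ (Set.range v) :=
    Submodule.sum_mem _ fun j _ => Submodule.smul_mem _ _ (Submodule.subset_span ⟨j, rfl⟩)
  refine ⟨ν0 + ∑ j, y j • v j, ?_, ?_⟩
  · intro h
    exact hν0 ((Submodule.add_mem_iff_left _ hmem).1 h)
  · intro i
    have h1 : ∀ j, m (Function.update v i (v j)) = if j = i then m v else 0 := by
      intro j
      split_ifs with hij
      · subst hij; simp
      · apply m.map_eq_zero_of_eq _ _ (Ne.symm hij)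
        simp [hij]
    have h2 : m (Function.update v i (ν0 + ∑ j, y j • v j)) =
        m (Function.update v i ν0) + y i • m v := by
      rw [AlternatingMap.map_update_add, AlternatingMap.map_update_sum]
      simp [h1]
    rw [h2, map_add, map_smul, smul_eq_mul, hy]
    field_simp
    ring

end area

end TTR

open TTR

/-- **Proposition (existence of `R`).**  Let `dim V = n + 1 ≥ 3` and let `B ⊂ V` be a convex
body with `0` in its interior all of whose intersections with `n`-dimensional linear subspaces
are linearly equivalent to one another.  Let `A : ΛⁿV → ℝ` be the affine cross-section area
function of `B` (here `ΛⁿV = ⋀[ℝ]^n V` is identified with a normed space `E` via a linear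
equivalence `e`, and `A` is prescribed by `A(0) = 0` together with
`A(w₁ ∧ ⋯ ∧ wₙ) = vol_σ(B ∩ Π_σ)⁻¹` for linearly independent `w`, where `vol_σ(B ∩ Π_σ)` is
computed as the Lebesgue measure of `{c ∈ ℝⁿ | ∑ cᵢ wᵢ ∈ B}`, i.e. the Haar measure on the
span of `w` normalized so that the parallelotope with edges `w₁, …, wₙ` has measure `1`).
Let `σ = v₁ ∧ ⋯ ∧ vₙ ≠ 0` be a point at which `A` is differentiable and let `X = Π_σ` be the
span of the `vᵢ`.  Then there are `ν ∈ V ∖ X` and a linear map `R : X* → Hom(X, X)` such that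
for every `λ ∈ X*`: (1) `tr R_λ = 0`, and (2) for every `x ∈ ∂B ∩ X` the vector
`R_λ(x) + λ(x)·ν` is tangent to `∂B` at `x`. -/
theorem exists_tangent_tensor_R
    {V : Type*} [NormedAddCommGroup V] [NormedSpace ℝ V]
    (n : ℕ) (hn : 2 ≤ n) (hdim : Module.finrank ℝ V = n + 1)
    (B : Set V) (hBcomp : IsCompact B) (hBconv : Convex ℝ B)
    (h0 : (0 : V) ∈ interior B)
    (hsec : ∀ X Y : Submodule ℝ V, Module.finrank ℝ X = n → Module.finrank ℝ Y = n →
      LinearlyEquivalent (B ∩ (X : Set V)) (B ∩ (Y : Set V)))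
    {E : Type*} [NormedAddCommGroup E] [NormedSpace ℝ E]
    (e : (⋀[ℝ]^n V) ≃ₗ[ℝ] E)
    (A : E → ℝ)
    (hA0 : A 0 = 0)
    (hAval : ∀ w : Fin n → V, LinearIndependent ℝ w →
      ∀ hw : ExteriorAlgebra.ιMulti ℝ n w ∈ ⋀[ℝ]^n V,
        A (e ⟨ExteriorAlgebra.ιMulti ℝ n w, hw⟩) =
          ((volume {c : Fin n → ℝ | ∑ i, c i • w i ∈ B}).toReal)⁻¹)
    (v : Fin n → V) (hv : LinearIndependent ℝ v)
    (hσ : ExteriorAlgebra.ιMulti ℝ n v ∈ ⋀[ℝ]^n V)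
    (hdiff : DifferentiableAt ℝ A (e ⟨ExteriorAlgebra.ιMulti ℝ n v, hσ⟩)) :
    ∃ ν : V, ν ∉ Submodule.span ℝ (Set.range v) ∧
      ∃ R : Module.Dual ℝ (Submodule.span ℝ (Set.range v)) →ₗ[ℝ]
          ((Submodule.span ℝ (Set.range v)) →ₗ[ℝ] (Submodule.span ℝ (Set.range v))),
        ∀ lam : Module.Dual ℝ (Submodule.span ℝ (Set.range v)),
          LinearMap.trace ℝ _ (R lam) = 0 ∧
          ∀ x : Submodule.span ℝ (Set.range v), (x : V) ∈ frontier B →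
            IsTangentVec B (x : V) (((R lam x : V)) + lam x • ν) := by
  have hnhds : B ∈ 𝓝 (0 : V) := mem_interior_iff_mem_nhds.1 h0
  have : FiniteDimensional ℝ V := Module.finite_of_finrank_pos (by omega)
  obtain ⟨C, c, hg⟩ := gauge_Gg hBcomp hBconv h0
  have hgB : ∀ x, gauge B x ≤ 1 ↔ x ∈ B := by
    intro x
    rw [gauge_le_one_iff_mem_closure hBconv hnhds, hBcomp.isClosed.closure_eq]
  have hgF : ∀ x, gauge B x = 1 ↔ x ∈ frontier B := fun x =>
    gauge_eq_one_iff_mem_frontier hBconv hnhds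
  -- coordinates
  set φ : (Fin n → ℝ) →L[ℝ] V := LinearMap.toContinuousLinearMap (Fintype.linearCombination ℝ v)
    with hφd
  have hφa : ∀ x, φ x = ∑ i, x i • v i := fun x => by
    simp [hφd, Fintype.linearCombination_apply]
  have hφi : Function.Injective φ := by
    have := linearIndependent_iff_injective_fintypeLinearCombination.1 hv
    exact this
  obtain ⟨κ, hκ, hφ⟩ : ∃ κ : ℝ, 0 < κ ∧ ∀ x, κ * ‖x‖ ≤ ‖φ x‖ := by
    obtain ⟨K, hK, hKa⟩ := LinearMap.exists_antilipschitzWith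
      (φ : (Fin n → ℝ) →ₗ[ℝ] V) (LinearMap.ker_eq_bot.2 hφi)
    refine ⟨(K : ℝ)⁻¹, by positivity, fun x => ?_⟩
    have h1 := hKa.le_mul_dist x 0
    rw [map_zero, dist_zero_right, dist_zero_right] at h1
    rw [inv_mul_le_iff₀ (by positivity)]
    exact h1
  have hh := hg.comp φ hκ hφ
  -- the alternating map
  set m : V [⋀^Fin n]→ₗ[ℝ] E := e.toLinearMap.compAlternatingMap (exteriorPower.ιMulti ℝ n)
    with hm
  have hAm : ∀ w : Fin n → V, LinearIndependent ℝ w →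
      A (m w) = ((volume {c : Fin n → ℝ | ∑ i, c i • w i ∈ B}).toReal)⁻¹ := fun w hw =>
    hAval w hw _
  have hdm : DifferentiableAt ℝ A (m v) := hdiff
  set D := fderiv ℝ A (m v) with hDd
  have hD : HasFDerivAt A D (m v) := hdm.hasFDerivAt
  -- positivity of the volume
  have hsetφ : {c : Fin n → ℝ | ∑ i, c i • v i ∈ B} = {x | gauge B (φ x) ≤ 1} := by
    ext x
    simp [hgB, hφa]
  have hvpos : volume {c : Fin n → ℝ | ∑ i, c i • v i ∈ B} ≠ 0 := by
    rw [hsetφ]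
    refine ne_of_gt (lt_of_lt_of_le ((isOpen_lt hh.cont continuous_const).measure_pos volume
        ⟨0, ?_⟩) (measure_mono (s := {x | gauge B (φ x) < 1}) ?_))
    · have := hh.zero
      show gauge B (φ 0) < 1
      rw [this]; exact one_pos
    · intro x hx
      exact le_of_lt (show gauge B (φ x) < 1 from hx)
  have hvfin : volume {c : Fin n → ℝ | ∑ i, c i • v i ∈ B} ≠ ⊤ := by
    rw [hsetφ]
    refine ne_of_lt (lt_of_le_of_lt (measure_mono (t := Metric.closedBall 0 (1 / (c * κ))) ?_)
        (measure_closedBall_lt_top))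
    intro x hx
    rw [mem_closedBall_zero_iff, le_div_iff₀ hh.cpos, mul_comm]
    exact (hh.lo x).trans hx
  have hApos : 0 < A (m v) := by
    rw [hAm v hv]
    exact inv_pos.2 (ENNReal.toReal_pos hvpos hvfin)
  -- homogeneity: D (m v) = A (m v)
  have hDv : D (m v) ≠ 0 := by
    have h1 : HasDerivAt (fun r : ℝ => A (r ^ n • m v)) ((n : ℝ) * D (m v)) 1 := by
      have h2 : HasDerivAt (fun r : ℝ => r ^ n • m v) ((n : ℝ) • m v) 1 := by
        have := (hasDerivAt_pow n (1 : ℝ)).smul_const (m v)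
        simpa using this
      have h3 := hD.comp_hasDerivAt_of_eq (1 : ℝ) h2 (by simp)
      refine h3.congr_deriv ?_
      simp
    have h4 : ∀ r : ℝ, 0 < r → A (r ^ n • m v) = r ^ n * A (m v) := by
      intro r hr
      have h5 : r ^ n • m v = m (fun i => r • v i) := by
        have := m.toMultilinearMap.map_smul_univ (fun _ => r) v
        simpa using this.symm
      have h6 : LinearIndependent ℝ (fun i => r • v i) :=
        hv.units_smul (fun _ => Units.mk0 r hr.ne')
      rw [h5, hAm _ h6, hAm v hv]
      have h7 : {c : Fin n → ℝ | ∑ i, c i • r • v i ∈ B} =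
          (r • ·) ⁻¹' {c : Fin n → ℝ | ∑ i, c i • v i ∈ B} := by
        ext x
        simp [smul_smul, mul_comm]
      rw [h7, Measure.addHaar_preimage_smul _ hr.ne', ENNReal.toReal_mul,
        ENNReal.toReal_ofReal (abs_nonneg _), abs_of_pos (by simp; positivity)]
      simp [mul_comm]
    have h8 : HasDerivAt (fun r : ℝ => A (r ^ n • m v)) ((n : ℝ) * A (m v)) 1 := by
      have h9 := (hasDerivAt_pow n (1 : ℝ)).mul_const (A (m v))
      simp only [one_pow, mul_one] at h9
      refine h9.congr_of_eventuallyEq ?_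
      filter_upwards [lt_mem_nhds (zero_lt_one' ℝ)] with r hr using h4 r hr
    have h10 := h1.unique h8
    have hn0 : (n : ℝ) ≠ 0 := by
      have : n ≠ 0 := by omega
      exact_mod_cast this
    rw [mul_left_cancel₀ hn0 h10]
    exact hApos.ne'
  -- a transversal vector
  obtain ⟨ν0, hν0⟩ : ∃ ν0, ν0 ∉ Submodule.span ℝ (Set.range v) := by
    by_contra hcon
    push Not at hcon
    have h1 : Submodule.span ℝ (Set.range v) = ⊤ := (Submodule.eq_top_iff' ).2 hcon
    have h2 := finrank_span_eq_card hv
    rw [h1, finrank_top, hdim] at h2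
    simp at h2
  obtain ⟨ν, hν, hDν⟩ := exists_nu m v D hDv ν0 hν0
  have hνφ : ∀ (x : Fin n → ℝ) (s : ℝ), φ x + s • ν = 0 → s = 0 := by
    intro x s hs
    by_contra hs0
    apply hν
    have h1 : ν = -s⁻¹ • φ x := by
      have h2 : φ x = -(s • ν) := eq_neg_of_add_eq_zero_left hs
      rw [h2, smul_neg, neg_smul, neg_neg, smul_smul, inv_mul_cancel₀ hs0, one_smul]
    rw [h1, hφa]
    exact Submodule.smul_mem _ _ (Submodule.sum_mem _ fun j _ =>
      Submodule.smul_mem _ _ (Submodule.subset_span ⟨j, rfl⟩))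
  have hψi : ∀ (l : (Fin n → ℝ) →L[ℝ] ℝ) (t : ℝ),
      Function.Injective (φ + ContinuousLinearMap.smulRight (t • l) ν) := by
    intro l t
    rw [injective_iff_map_eq_zero]
    intro x hx
    have hx' : φ x + (t * l x) • ν = 0 := by simpa using hx
    have h1 := hνφ x _ hx'
    rw [h1, zero_smul, add_zero] at hx'
    exact hφi (by rw [hx', map_zero])
  have hM : ∀ (l : (Fin n → ℝ) →L[ℝ] ℝ) (t : ℝ), (S (gauge B) φ ν l t).Nonempty := by
    intro l t
    obtain ⟨M, hM⟩ := section_map hnhds hsec (φ : (Fin n → ℝ) →ₗ[ℝ] V)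
      ((φ + ContinuousLinearMap.smulRight (t • l) ν : (Fin n → ℝ) →L[ℝ] V) :
        (Fin n → ℝ) →ₗ[ℝ] V) hφi (hψi l t)
    refine ⟨LinearMap.toContinuousLinearMap M, fun x => ?_⟩
    simpa using hM x
  have hvol : ∀ l : (Fin n → ℝ) →L[ℝ] ℝ,
      HasDerivAt (fun t : ℝ => (volume {x | gauge B (φ x + (t * l x) • ν) ≤ 1}).toReal) 0 0 := by
    intro l
    set a : Fin n → ℝ := fun i => l (Pi.single i 1) with ha
    have hla : ∀ x, l x = ∑ i, x i * a i := by
      intro x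
      conv_lhs => rw [pi_eq_sum_univ' x]
      simp [ha, map_sum]
    have hψa : ∀ (t : ℝ) (x : Fin n → ℝ),
        φ x + (t * l x) • ν = ∑ i, x i • (v i + (t * a i) • ν) := by
      intro t x
      simp only [smul_add, Finset.sum_add_distrib, hφa, hla, smul_smul, Finset.mul_sum,
        Finset.sum_smul]
      congr 1
      apply Finset.sum_congr rfl
      intro i _
      congr 1
      ring
    have hli : ∀ t : ℝ, LinearIndependent ℝ (fun i => v i + (t * a i) • ν) := by
      intro t
      rw [linearIndependent_iff_injective_fintypeLinearCombination]
      have h1 := hψi l t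
      convert h1 using 1
      ext x
      rw [Fintype.linearCombination_apply, ← hψa]
      simp
    have hval : ∀ t : ℝ, (volume {x | gauge B (φ x + (t * l x) • ν) ≤ 1}).toReal =
        (A (m (fun i => v i + (t * a i) • ν)))⁻¹ := by
      intro t
      rw [hAm _ (hli t), inv_inv]
      congr 2
      ext x
      simp [hgB, hψa]
    have hder : HasDerivAt (fun t : ℝ => A (m (fun i => v i + (t * a i) • ν))) 0 0 := by
      simp only [alt_expand]
      set T := ∑ i, a i • m (Function.update v i ν) with hT
      have h1 : HasDerivAt (fun t : ℝ => m v + t • T) T 0 := by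
        have := ((hasDerivAt_id (0 : ℝ)).smul_const T).const_add (m v)
        refine HasDerivAt.congr_deriv this ?_
        simp
      have h3 := hD.comp_hasDerivAt_of_eq (0 : ℝ) h1 (by simp)
      have h4 : D T = 0 := by simp [hT, map_sum, hDν]
      rw [h4] at h3
      exact h3
    simp only [hval]
    have h5 := hder.inv (by simpa using hApos.ne')
    refine h5.congr_deriv ?_
    simp
  -- the tensor
  choose R hRtr hR using fun i : Fin n =>
    core2 hg φ hκ hφ ν hM hvol (ContinuousLinearMap.proj i)
  set b := Module.Basis.span hv with hb
  have hbv : ∀ i, ((b i : Submodule.span ℝ (Set.range v)) : V) = v i := fun i => by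
    rw [hb, Module.Basis.span_apply]
  have hbx : ∀ x : Submodule.span ℝ (Set.range v), φ (b.equivFun x) = x := by
    intro x
    rw [hφa]
    have h := congrArg (Submodule.subtype _) (b.sum_equivFun x)
    rw [map_sum] at h
    simp only [map_smul, Submodule.subtype_apply, hbv] at h
    exact h
  have hbx' : ∀ y : Fin n → ℝ, ((b.equivFun.symm y : Submodule.span ℝ (Set.range v)) : V) =
      φ y := by
    intro y
    rw [← hbx, LinearEquiv.apply_symm_apply]
  refine ⟨ν, hν, ∑ i, (LinearMap.applyₗ (b i)).smulRight
    (b.equivFun.symm.conj (R i : (Fin n → ℝ) →ₗ[ℝ] (Fin n → ℝ))), fun lam => ⟨?_, ?_⟩⟩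
  · rw [LinearMap.sum_apply, map_sum]
    apply Finset.sum_eq_zero
    intro i _
    rw [LinearMap.smulRight_apply, map_smul, LinearMap.trace_conj']
    have := hRtr i
    rw [tr] at this
    rw [this, smul_zero]
  · intro x hx
    have hx1 := (hgF x).2 hx
    have hmem : (((∑ i, (LinearMap.applyₗ (b i)).smulRight
        (b.equivFun.symm.conj (R i : (Fin n → ℝ) →ₗ[ℝ] (Fin n → ℝ))) :
          Module.Dual ℝ (Submodule.span ℝ (Set.range v)) →ₗ[ℝ] _) lam x :
          Submodule.span ℝ (Set.range v)) : V) + lam x • ν ∈ lin hg (x : V) := by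
      have h1 : ∀ i, φ (R i (b.equivFun x)) + (b.equivFun x i) • ν ∈ lin hg (x : V) := by
        intro i
        have := hR i (b.equivFun x)
        rw [hbx] at this
        exact this
      have h2 := Submodule.sum_mem (lin hg (x : V)) (t := Finset.univ)
        (fun i _ => Submodule.smul_mem _ (lam (b i)) (h1 i))
      convert h2 using 1
      have h3 : lam x = ∑ i, lam (b i) * b.equivFun x i := by
        have h := congrArg lam (b.sum_equivFun x)
        rw [map_sum] at h
        rw [← h]
        refine Finset.sum_congr rfl fun i _ => ?_
        rw [map_smul, smul_eq_mul, mul_comm]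
      rw [h3, Finset.sum_smul]
      simp only [smul_add, Finset.sum_add_distrib, smul_smul]
      congr 1
      rw [LinearMap.sum_apply, LinearMap.sum_apply, Submodule.coe_sum]
      refine Finset.sum_congr rfl fun i _ => ?_
      rw [LinearMap.smulRight_apply, LinearMap.smul_apply, Submodule.coe_smul,
        LinearEquiv.conj_apply_apply, hbx', LinearEquiv.symm_symm]
      rfl
    exact ⟨forward hg (fun x h => (hgF x).1 h) hx1 hmem.1 hmem.2,
      forward hg (fun x h => (hgF x).1 h) hx1 hmem.2 (by rw [neg_neg]; exact hmem.1)⟩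
end

section
/- Let K ⊂ ℝ² be a convex body with 0 in its interior and W a nonzero homogeneous polynomial vector field on ℝ² of degree at most 3 that is tangent to ∂K. If deg W = 3, assume in addition that W vanishes at some point other than the origin. Then K is an ellipse centered at 0, i.e. the unit ball of some inner-product norm on ℝ². -/
open Filter Topology

/-- A set is an *ellipse (ellipsoid) centered at `0`* if it is the unit ball of an
inner-product norm, i.e. `{x | f x x ≤ 1}` for a symmetric positive definite bilinear form. -/
def IsEllipsoid {X : Type*} [AddCommGroup X] [Module ℝ X] (K : Set X) : Prop :=
  ∃ f : X →ₗ[ℝ] X →ₗ[ℝ] ℝ, (∀ x y, f x y = f y x) ∧ (∀ x, x ≠ 0 → 0 < f x x) ∧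
    K = {x | f x x ≤ 1}

namespace PolyEll

/-- the line through `v` in direction `W v` does not enter the open sublevel set. -/
def SuppLine (g : ℝ × ℝ → ℝ) (W : ℝ × ℝ → ℝ × ℝ) : Prop :=
  ∀ (v : ℝ × ℝ) (t : ℝ), g v ≤ g (v + t • W v)

structure Gg (g : ℝ × ℝ → ℝ) : Prop where
  cont : Continuous g
  pos : ∀ v, v ≠ 0 → 0 < g v
  hom : ∀ (r : ℝ) v, 0 ≤ r → g (r • v) = r * g v

lemma Gg.zero {g} (h : Gg g) : g 0 = 0 := by
  have := h.hom 0 0 le_rfl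
  simpa using this

lemma eig {g W} (h : Gg g) (hS : SuppLine g W) (v : ℝ × ℝ) (hv : v ≠ 0) (l : ℝ) (hl : W v = l • v) :
    l = 0 := by
  by_contra hne
  have h1 := hS v (-1 / l)
  have h2 : v + (-1 / l) • W v = 0 := by
    rw [hl, smul_smul, div_mul_cancel₀ _ hne]; simp
  rw [h2, h.zero] at h1
  exact absurd (h.pos v hv) (not_lt.mpr h1)

/-- dividing out a linear form -/
lemma divide {g W} (h : Gg g) (hS : SuppLine g W) (V : ℝ × ℝ → ℝ × ℝ) (hV : Continuous V) (a b : ℝ)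
    (hab : (a, b) ≠ ((0 : ℝ), (0 : ℝ)))
    (hW : ∀ v : ℝ × ℝ, W v = (a * v.1 + b * v.2) • V v) : SuppLine g V := by
  have key : ∀ v : ℝ × ℝ, a * v.1 + b * v.2 ≠ 0 → ∀ t : ℝ, g v ≤ g (v + t • V v) := by
    intro v hv t
    have := hS v (t / (a * v.1 + b * v.2))
    rwa [hW, smul_smul, div_mul_cancel₀ _ hv] at this
  have hn : a * a + b * b ≠ 0 := by
    intro h0
    apply hab
    have h1 : a = 0 := by nlinarith [mul_self_nonneg a, mul_self_nonneg b]
    have h2 : b = 0 := by nlinarith [mul_self_nonneg a, mul_self_nonneg b]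
    rw [h1, h2]
  intro v t
  by_cases hv : a * v.1 + b * v.2 = 0
  · have hc := h.cont
    have t1 : Tendsto (fun e : ℝ => g (v + e • (a, b))) (𝓝[≠] 0) (𝓝 (g v)) := by
      have : Continuous (fun e : ℝ => g (v + e • (a, b))) := by fun_prop
      have := (this.tendsto 0).mono_left (nhdsWithin_le_nhds (s := {0}ᶜ))
      simpa using this
    have t2 : Tendsto (fun e : ℝ => g (v + e • (a, b) + t • V (v + e • (a, b)))) (𝓝[≠] 0)
        (𝓝 (g (v + t • V v))) := by
      have : Continuous (fun e : ℝ => g (v + e • (a, b) + t • V (v + e • (a, b)))) := by fun_prop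
      have := (this.tendsto 0).mono_left (nhdsWithin_le_nhds (s := {0}ᶜ))
      simpa using this
    refine le_of_tendsto_of_tendsto t1 t2 ?_
    filter_upwards [self_mem_nhdsWithin] with e he
    apply key
    have : a * (v + e • (a, b)).1 + b * (v + e • (a, b)).2 = e * (a * a + b * b) := by
      simp; linear_combination hv
    rw [this]
    exact mul_ne_zero he hn
  · exact key v hv t

/-- linear field -/
def lin (a b c d : ℝ) : ℝ × ℝ → ℝ × ℝ := fun v => (a * v.1 + b * v.2, c * v.1 + d * v.2)

lemma lin_pow {G : ℂ → ℝ} {l : ℂ} (hG : ∀ (t : ℝ) z, G z ≤ G ((1 + t * l) * z))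
    (t : ℝ) (n : ℕ) (z : ℂ) : G z ≤ G ((1 + t * l) ^ n * z) := by
  induction n with
  | zero => simp
  | succ n ih =>
    refine ih.trans ((hG t _).trans_eq ?_)
    congr 1; ring

lemma complex_case {G : ℂ → ℝ} (hc : Continuous G) (hpos : ∀ z, z ≠ 0 → 0 < G z)
    (hhom : ∀ (r : ℝ) z, 0 ≤ r → G (r * z) = r * G z) (l : ℂ) (hl : l.im ≠ 0)
    (hG : ∀ (t : ℝ) z, G z ≤ G ((1 + t * l) * z)) (z : ℂ) : G z = ‖z‖ * G 1 := by
  have hpow := fun t n z => lin_pow hG t n z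
  have h0 : G 0 = 0 := by simpa using hhom 0 0 le_rfl
  have hns : 0 < Complex.normSq l := by
    rw [Complex.normSq_pos]; rintro rfl; simp at hl
  have hre : l.re = 0 := by
    by_contra hre
    set t : ℝ := -l.re / Complex.normSq l with ht
    have hlt : ‖(1 + t * l : ℂ)‖ < 1 := by
      rw [← sq_lt_one_iff₀ (norm_nonneg _), ← Complex.normSq_eq_norm_sq]
      have : Complex.normSq (1 + t * l) = 1 - l.re ^ 2 / Complex.normSq l := by
        have e : Complex.normSq (1 + t * l) = 1 + 2 * t * l.re + t ^ 2 * Complex.normSq l := by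
          simp [Complex.normSq_apply]; ring
        rw [e, ht]; field_simp; ring
      rw [this]
      have : 0 < l.re ^ 2 / Complex.normSq l := by positivity
      linarith
    have h1 : Tendsto (fun n : ℕ => G ((1 + t * l) ^ n * 1)) atTop (𝓝 (G (0 * 1))) :=
      (hc.tendsto _).comp ((tendsto_pow_atTop_nhds_zero_of_norm_lt_one hlt).mul_const 1)
    have h2 := ge_of_tendsto' h1 (fun n => hpow t n 1)
    rw [zero_mul, h0] at h2
    exact absurd (hpos 1 one_ne_zero) (not_lt.mpr h2)
  have hlI : l = l.im * Complex.I := by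
    apply Complex.ext <;> simp [hre]
  have hexp : ∀ (θ : ℝ) z, G z ≤ G (Complex.exp (θ * Complex.I) * z) := by
    intro θ z
    have h1 : Tendsto (fun n : ℕ => G ((1 + (θ * Complex.I) / n) ^ n * z)) atTop
        (𝓝 (G (Complex.exp (θ * Complex.I) * z))) :=
      (hc.tendsto _).comp ((Complex.tendsto_one_add_div_pow_exp (θ * Complex.I)).mul_const z)
    refine ge_of_tendsto' h1 (fun n => ?_)
    have := hpow (θ / l.im / n) n z
    have e : ((θ / l.im / n : ℝ) : ℂ) * l = θ * Complex.I / n := by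
      have hne : (l.im : ℂ) ≠ 0 := by exact_mod_cast hl
      calc ((θ / l.im / n : ℝ) : ℂ) * l = ((θ / l.im / n : ℝ) : ℂ) * (l.im * Complex.I) := by
            rw [← hlI]
        _ = θ * Complex.I / n := by push_cast; field_simp
    rwa [e] at this
  have hz := Complex.norm_mul_exp_arg_mul_I z
  rw [← hz, hhom _ _ (norm_nonneg _)]
  have e1 := hexp z.arg 1
  have e2 := hexp (-z.arg) (Complex.exp (z.arg * Complex.I))
  rw [← Complex.exp_add] at e2
  simp at e1 e2
  rw [le_antisymm e2 e1]
  simp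

lemma linear_case {g} (h : Gg g) (a b c d : ℝ) (hS : SuppLine g (lin a b c d))
    (hne : lin a b c d ≠ 0) :
    ∃ α β γ : ℝ, ∀ x y, g (x, y) ^ 2 = α * x ^ 2 + 2 * β * x * y + γ * y ^ 2 := by
  by_cases hdisc : 0 ≤ (a - d) ^ 2 + 4 * b * c
  · exfalso
    have hroot : ∀ m : ℝ, m ^ 2 - (a + d) * m + (a * d - b * c) = 0 → m = 0 := by
      intro m hm
      by_cases h1 : (b, m - a) = ((0 : ℝ), (0 : ℝ))
      · by_cases h2 : (m - d, c) = ((0 : ℝ), (0 : ℝ))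
        · simp only [Prod.mk.injEq] at h1 h2
          refine eig h hS (1, 0) (by simp) m ?_
          simp [lin]; constructor <;> linarith
        · refine eig h hS (m - d, c) h2 m ?_
          simp [lin]; exact ⟨by linear_combination (-1 : ℝ) * hm, by ring⟩
      · refine eig h hS (b, m - a) h1 m ?_
        simp [lin]; exact ⟨by ring, by linear_combination (-1 : ℝ) * hm⟩
    have hs := Real.sq_sqrt hdisc
    set s := Real.sqrt ((a - d) ^ 2 + 4 * b * c)
    have r1 := hroot ((a + d + s) / 2) (by linear_combination (1 / 4 : ℝ) * hs)
    have r2 := hroot ((a + d - s) / 2) (by linear_combination (1 / 4 : ℝ) * hs)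
    have htr : d = -a := by linarith
    have hs0 : s = 0 := by linarith
    rw [hs0] at hs
    have hdet : a * a + b * c = 0 := by rw [htr] at hs; linarith
    subst htr
    have : ∃ e, lin a b c (-a) e ≠ 0 := by
      by_contra hh; push Not at hh; exact hne (funext hh)
    obtain ⟨e, he⟩ := this
    have hle : ∀ t : ℝ, g (e + t • lin a b c (-a) e) ≤ g e := by
      intro t
      have := hS (e + t • lin a b c (-a) e) (-t)
      refine this.trans_eq ?_
      congr 1
      ext <;> simp [lin]
      · linear_combination (-t * t * e.1) * hdet
      · linear_combination (-t * t * e.2) * hdet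
    have hle2 : ∀ r : ℝ, 0 < r → g (r • e + lin a b c (-a) e) ≤ r * g e := by
      intro r hr
      have : r • e + lin a b c (-a) e = r • (e + r⁻¹ • lin a b c (-a) e) := by
        rw [smul_add, smul_smul, mul_inv_cancel₀ hr.ne', one_smul]
      rw [this, h.hom _ _ hr.le]
      exact mul_le_mul_of_nonneg_left (hle _) hr.le
    have hc := h.cont
    have t1 : Tendsto (fun r : ℝ => g (r • e + lin a b c (-a) e)) (𝓝[>] 0)
        (𝓝 (g (lin a b c (-a) e))) := by
      have : Continuous (fun r : ℝ => g (r • e + lin a b c (-a) e)) := by fun_prop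
      simpa using (this.tendsto 0).mono_left (nhdsWithin_le_nhds (s := Set.Ioi 0))
    have t2 : Tendsto (fun r : ℝ => r * g e) (𝓝[>] 0) (𝓝 0) := by
      have : Continuous (fun r : ℝ => r * g e) := by fun_prop
      simpa using (this.tendsto 0).mono_left (nhdsWithin_le_nhds (s := Set.Ioi 0))
    have := le_of_tendsto_of_tendsto t1 t2 (by
      filter_upwards [self_mem_nhdsWithin] with r hr using hle2 r hr)
    exact absurd (h.pos _ he) (not_lt.mpr this)
  · push Not at hdisc
    have hc0 : c ≠ 0 := by rintro rfl; nlinarith [sq_nonneg (a - d)]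
    have hpos : 0 < -((a - d) ^ 2 + 4 * b * c) / 4 := by linarith
    have hw2 := Real.sq_sqrt hpos.le
    have hw0 := Real.sqrt_pos.mpr hpos
    set w := Real.sqrt (-((a - d) ^ 2 + 4 * b * c) / 4)
    have hwne := hw0.ne'
    let G : ℂ → ℝ := fun z => g (z.re + z.im * ((a - d) / 2 / w), z.im * (c / w))
    have hGc : Continuous G := by
      have := h.cont
      have := Complex.continuous_re
      have := Complex.continuous_im
      fun_prop
    have key := complex_case (G := G) hGc
      (by
        intro z hz
        apply h.pos
        intro h0
        simp only [Prod.mk_eq_zero, mul_eq_zero, div_eq_zero_iff, hc0, hwne, or_false] at h0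
        apply hz
        have him := h0.2
        have hre := h0.1
        rw [him] at hre
        apply Complex.ext <;> simp_all)
      (by
        intro r z hr
        simp only [G]
        rw [← h.hom _ _ hr]
        congr 1
        ext <;> simp <;> ring)
      (⟨(a + d) / 2, w⟩ : ℂ) hwne
      (by
        intro t z
        refine (hS _ t).trans_eq ?_
        simp only [G]
        congr 1
        ext
        · simp [lin]; field_simp; linear_combination (4 * t * z.im) * hw2
        · simp [lin]; field_simp; ring)
    refine ⟨G 1 ^ 2, - ((a - d) / 2 / c) * G 1 ^ 2, (((a - d) / 2 / c) ^ 2 + (w / c) ^ 2) * G 1 ^ 2,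
      fun x y => ?_⟩
    have := key ⟨x - y * ((a - d) / 2 / c), y * w / c⟩
    have e : G ⟨x - y * ((a - d) / 2 / c), y * w / c⟩ = g (x, y) := by
      simp only [G]
      congr 1
      ext
      · simp; field_simp; ring
      · simp; field_simp
    rw [← e, this, mul_pow, ← Complex.normSq_eq_norm_sq, Complex.normSq_apply]
    simp only
    ring

def quad (a b c : ℝ) (v : ℝ × ℝ) : ℝ := a * v.1 ^ 2 + b * (v.1 * v.2) + c * v.2 ^ 2

lemma quad_factor (p q : ℝ) (hpq : (p, q) ≠ ((0 : ℝ), (0 : ℝ))) :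
    ∃ l m : ℝ, (l, m) ≠ ((0 : ℝ), (0 : ℝ)) ∧ (∀ a b c : ℝ, quad a b c (p, q) = 0 →
      ∃ a' b' : ℝ, ∀ v, quad a b c v = (l * v.1 + m * v.2) * (a' * v.1 + b' * v.2)) ∧
      (∀ a b c d : ℝ, a * p ^ 3 + b * (p ^ 2 * q) + c * (p * q ^ 2) + d * q ^ 3 = 0 →
      ∃ a' b' c' : ℝ, ∀ v : ℝ × ℝ, a * v.1 ^ 3 + b * (v.1 ^ 2 * v.2) + c * (v.1 * v.2 ^ 2) +
        d * v.2 ^ 3 = (l * v.1 + m * v.2) * quad a' b' c' v) := by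
  by_cases hp : p = 0
  · subst hp
    have hq : q ≠ 0 := by rintro rfl; exact hpq rfl
    refine ⟨1, 0, by simp, fun a b c h => ?_, fun a b c d h => ?_⟩
    · have : c = 0 := by simpa [quad, hq] using h
      exact ⟨a, b, fun v => by simp only [quad, this]; ring⟩
    · have : d = 0 := by simpa [hq] using h
      exact ⟨a, b, c, fun v => by simp only [quad, this]; ring⟩
  · obtain ⟨s, rfl⟩ : ∃ s, q = s * p := ⟨q / p, by field_simp⟩
    refine ⟨-s, 1, by simp, fun a b c h => ?_, fun a b c d h => ?_⟩
    · have h1 : a + b * s + c * s ^ 2 = 0 := by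
        have : p ^ 2 * (a + b * s + c * s ^ 2) = 0 := by
          rw [← h]; simp only [quad]; ring
        simpa [hp] using this
      exact ⟨b + s * c, c, fun v => by
        simp only [quad]; linear_combination v.1 ^ 2 * h1⟩
    · have h1 : a + b * s + c * s ^ 2 + d * s ^ 3 = 0 := by
        have : p ^ 3 * (a + b * s + c * s ^ 2 + d * s ^ 3) = 0 := by
          rw [← h]; ring
        simpa [hp] using this
      exact ⟨b + s * c + s ^ 2 * d, c + s * d, d, fun v => by
        simp only [quad]; linear_combination v.1 ^ 3 * h1⟩

lemma quadratic_case {g} (h : Gg g) (a b c a' b' c' : ℝ)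
    (hS : SuppLine g (fun v => (quad a b c v, quad a' b' c' v)))
    (hne : (fun v => (quad a b c v, quad a' b' c' v)) ≠ 0) :
    ∃ α β γ : ℝ, ∀ x y, g (x, y) ^ 2 = α * x ^ 2 + 2 * β * x * y + γ * y ^ 2 := by
  obtain ⟨p, q, hpq, hD⟩ : ∃ p q : ℝ, (p, q) ≠ ((0 : ℝ), (0 : ℝ)) ∧
      p * quad a' b' c' (p, q) = q * quad a b c (p, q) := by
    let D : ℝ → ℝ := fun θ => Real.cos θ * quad a' b' c' (Real.cos θ, Real.sin θ) -
      Real.sin θ * quad a b c (Real.cos θ, Real.sin θ)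
    have hDc : Continuous D := by
      simp only [D, quad]; fun_prop
    have hmem : (0 : ℝ) ∈ Set.uIcc (D 0) (D Real.pi) := by
      have : D Real.pi = - D 0 := by simp [D, quad]
      rw [this, Set.mem_uIcc]
      rcases le_total 0 (D 0) with h | h
      · right; constructor <;> linarith
      · left; constructor <;> linarith
    obtain ⟨θ, -, hθ⟩ := intermediate_value_uIcc hDc.continuousOn hmem
    refine ⟨Real.cos θ, Real.sin θ, ?_, sub_eq_zero.mp hθ⟩
    intro h0
    simp only [Prod.mk.injEq] at h0
    have := Real.sin_sq_add_cos_sq θ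
    rw [h0.1, h0.2] at this
    norm_num at this
  have hlam : ∃ l : ℝ, quad a b c (p, q) = l * p ∧ quad a' b' c' (p, q) = l * q := by
    by_cases hp : p = 0
    · have hq : q ≠ 0 := by rintro rfl; exact hpq (by rw [hp])
      refine ⟨quad a' b' c' (p, q) / q, ?_, by field_simp⟩
      field_simp; linarith
    · refine ⟨quad a b c (p, q) / p, by field_simp, ?_⟩
      field_simp; linarith
  obtain ⟨l, hl1, hl2⟩ := hlam
  have hl0 := eig h hS (p, q) hpq l (by simp [hl1, hl2])
  rw [hl0, zero_mul] at hl1 hl2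
  obtain ⟨l, m, hlm, hf, -⟩ := quad_factor p q hpq
  obtain ⟨x1, x2, hx⟩ := hf _ _ _ hl1
  obtain ⟨y1, y2, hy⟩ := hf _ _ _ hl2
  have hS' := divide h hS (lin x1 x2 y1 y2) (by unfold lin; fun_prop) l m hlm
    (fun v => by simp [lin, hx, hy])
  refine linear_case h _ _ _ _ hS' ?_
  intro h0
  apply hne
  funext v
  have := congrFun h0 v
  simp only [lin, Pi.zero_apply, Prod.mk_eq_zero] at this
  simp [hx, hy, this.1, this.2]

lemma poly_form {k : ℕ} (P : MvPolynomial (Fin 2) ℝ) (hP : P.IsHomogeneous k) :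
    ∃ c : ℕ → ℝ, ∀ x : Fin 2 → ℝ, MvPolynomial.eval x P =
      ∑ i ∈ Finset.range (k + 1), c i * (x 0 ^ i * x 1 ^ (k - i)) := by
  have hdeg : ∀ d ∈ P.support, d 0 + d 1 = k := by
    intro d hd
    by_contra hne
    have := hP.coeff_eq_zero (d := d) (by simpa [Finsupp.degree_eq_sum] using hne)
    exact (MvPolynomial.mem_support_iff.mp hd) this
  refine ⟨fun i => ∑ d ∈ P.support with d 0 = i, P.coeff d, fun x => ?_⟩
  rw [MvPolynomial.eval_eq', ← Finset.sum_fiberwise_of_maps_to (t := Finset.range (k + 1))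
    (g := fun d => d 0)]
  · refine Finset.sum_congr rfl fun i _ => ?_
    rw [Finset.sum_mul]
    refine Finset.sum_congr rfl fun d hd => ?_
    rw [Finset.mem_filter] at hd
    have := hdeg d hd.1
    have h2 : d 1 = k - i := by omega
    rw [Fin.prod_univ_two, h2, hd.2]
  · intro d hd
    have := hdeg d hd
    rw [Finset.mem_range]; omega

lemma tangent_line {X : Type*} [NormedAddCommGroup X] [NormedSpace ℝ X] (K : Set X)
    (hc : Convex ℝ K) (h0 : K ∈ 𝓝 (0 : X)) (x v : X) (hx : x ∈ frontier K)
    (hv : IsForwardTangent K x v) (t : ℝ) (ht : 0 ≤ t) : 1 ≤ gauge K (x + t • v) := by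
  have hx1 := (gauge_eq_one_iff_mem_frontier hc h0).mpr hx
  rcases ht.eq_or_lt with rfl | ht
  · simp [hx1]
  by_cases hv0 : v = 0
  · simp [hv0, hx1]
  obtain ⟨p, c, hp, hcp, hpx, hcv⟩ := hv
  have hvn : 0 < ‖v‖ := norm_pos_iff.mpr hv0
  have hg := continuous_gauge hc h0
  have t1 : Tendsto (fun i => gauge K (x + t • (c i • (p i - x)))) atTop
      (𝓝 (gauge K (x + t • v))) :=
    (hg.tendsto _).comp ((hcv.const_smul t).const_add x)
  refine ge_of_tendsto t1 ?_
  have e1 : ∀ᶠ i in atTop, ‖v‖ / 2 < ‖c i • (p i - x)‖ :=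
    hcv.norm.eventually (lt_mem_nhds (by linarith))
  have e2 : ∀ᶠ i in atTop, ‖p i - x‖ < t * ‖v‖ / 2 := by
    have : Tendsto (fun i => ‖p i - x‖) atTop (𝓝 0) := by
      simpa using (hpx.sub_const x).norm
    exact this.eventually (gt_mem_nhds (by positivity))
  filter_upwards [e1, e2] with i h1 h2
  rw [norm_smul, Real.norm_of_nonneg (hcp i).le] at h1
  have hci := hcp i
  have hct : 1 < t * c i := by
    by_contra hle
    push Not at hle
    have : t * c i * ‖p i - x‖ ≤ ‖p i - x‖ := by
      nlinarith [norm_nonneg (p i - x)]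
    nlinarith
  set s := (t * c i)⁻¹ with hs
  have htc : 0 < t * c i := by positivity
  have hs0 : 0 < s := by positivity
  have hs1 : s < 1 := inv_lt_one_of_one_lt₀ hct
  have hpi := (gauge_eq_one_iff_mem_frontier hc h0).mpr (hp i)
  have hcomb : p i = (1 - s) • x + s • (x + t • (c i • (p i - x))) := by
    rw [smul_add, smul_smul t, smul_smul s, hs, inv_mul_cancel₀ htc.ne']
    module
  have hle := gauge_add_le hc (absorbent_nhds_zero h0) ((1 - s) • x)
    (s • (x + t • (c i • (p i - x))))
  rw [← hcomb, gauge_smul_of_nonneg (by linarith), gauge_smul_of_nonneg hs0.le, hpi, hx1] at hle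
  simp only [smul_eq_mul] at hle
  nlinarith

end PolyEll

namespace PolyEll

lemma final_step (K : Set (EuclideanSpace ℝ (Fin 2)))
    (hKcomp : IsCompact K) (hKconv : Convex ℝ K) (hK0 : K ∈ 𝓝 (0 : EuclideanSpace ℝ (Fin 2)))
    (hpos : ∀ v : EuclideanSpace ℝ (Fin 2), v ≠ 0 → 0 < gauge K v)
    (h : ∃ α β γ : ℝ, ∀ x y, gauge K !₂[x, y] ^ 2 = α * x ^ 2 + 2 * β * x * y + γ * y ^ 2) :
    IsEllipsoid K := by
  obtain ⟨α, β, γ, hq⟩ := h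
  have hg : ∀ v : EuclideanSpace ℝ (Fin 2), gauge K v ^ 2 =
      α * v 0 ^ 2 + 2 * β * v 0 * v 1 + γ * v 1 ^ 2 := by
    intro v
    have : v = !₂[v 0, v 1] := by ext i; fin_cases i <;> rfl
    rw [← hq, ← this]
  have hf : ∀ v : EuclideanSpace ℝ (Fin 2),
      α * (v 0 * v 0) + β * (v 0 * v 1 + v 1 * v 0) + γ * (v 1 * v 1) = gauge K v ^ 2 := by
    intro v; rw [hg]; ring
  refine ⟨LinearMap.mk₂ ℝ (fun v w : EuclideanSpace ℝ (Fin 2) =>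
    α * (v 0 * w 0) + β * (v 0 * w 1 + v 1 * w 0) + γ * (v 1 * w 1)) ?_ ?_ ?_ ?_, ?_, ?_, ?_⟩
  · intros; simp; ring
  · intros; simp; ring
  · intros; simp; ring
  · intros; simp; ring
  · intros; simp; ring
  · intro v hv
    rw [LinearMap.mk₂_apply, hf]
    have := hpos v hv
    positivity
  · ext v
    rw [Set.mem_ofPred_eq, LinearMap.mk₂_apply, hf, sq_le_one_iff₀ (gauge_nonneg v),
      gauge_le_one_iff_mem_closure hKconv hK0, hKcomp.isClosed.closure_eq]

end PolyEll

/-- **Lemma.**  Let `K ⊂ ℝ²` be a convex body with `0` in its interior and `W` a nonzero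
homogeneous polynomial vector field on `ℝ²` of degree `k ≤ 3` tangent to `∂K`; if the degree
is `3`, assume in addition that `W` vanishes at some point other than the origin.  Then `K` is
an ellipse centered at `0`. -/
theorem polyField_tangent_implies_ellipse
    (K : Set (EuclideanSpace ℝ (Fin 2)))
    (hKcomp : IsCompact K) (hKconv : Convex ℝ K)
    (h0 : (0 : EuclideanSpace ℝ (Fin 2)) ∈ interior K)
    (W : EuclideanSpace ℝ (Fin 2) → EuclideanSpace ℝ (Fin 2))
    (k : ℕ) (hk : k ≤ 3)
    (P : Fin 2 → MvPolynomial (Fin 2) ℝ) (hP : ∀ i, (P i).IsHomogeneous k)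
    (hWP : ∀ (x : EuclideanSpace ℝ (Fin 2)) (i : Fin 2),
      W x i = MvPolynomial.eval (fun j => x j) (P i))
    (hW0 : W ≠ 0)
    (htang : ∀ x ∈ frontier K, IsTangentVec K x (W x))
    (hdeg3 : k = 3 → ∃ p : EuclideanSpace ℝ (Fin 2), p ≠ 0 ∧ W p = 0) :
    IsEllipsoid K := by
  classical
  have hK0 : K ∈ 𝓝 (0 : EuclideanSpace ℝ (Fin 2)) := mem_interior_iff_mem_nhds.mp h0
  have hpos : ∀ v : EuclideanSpace ℝ (Fin 2), v ≠ 0 → 0 < gauge K v := fun v hv =>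
    (gauge_pos (absorbent_nhds_zero hK0)
      (NormedSpace.isVonNBounded_of_isBounded ℝ hKcomp.isBounded)).mpr hv
  have hgc := continuous_gauge hKconv hK0
  refine PolyEll.final_step K hKcomp hKconv hK0 hpos ?_
  let g : ℝ × ℝ → ℝ := fun v => gauge K !₂[v.1, v.2]
  have hmk : Continuous (fun v : ℝ × ℝ => (!₂[v.1, v.2] : EuclideanSpace ℝ (Fin 2))) := by
    refine (PiLp.continuous_toLp 2 _).comp ?_
    refine continuous_pi fun i => ?_
    fin_cases i
    · exact continuous_fst
    · exact continuous_snd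
  have hG : PolyEll.Gg g := by
    refine ⟨hgc.comp hmk, fun v hv => hpos _ ?_, fun r v hr => ?_⟩
    · intro h
      apply hv
      have e0 := congrArg (fun u : EuclideanSpace ℝ (Fin 2) => u 0) h
      have e1 := congrArg (fun u : EuclideanSpace ℝ (Fin 2) => u 1) h
      ext
      · simpa using e0
      · simpa using e1
    · have : (!₂[(r • v).1, (r • v).2] : EuclideanSpace ℝ (Fin 2)) = r • !₂[v.1, v.2] := by
        ext i; fin_cases i <;> simp
      simp only [g]
      rw [this, gauge_smul_of_nonneg hr, smul_eq_mul]
  obtain ⟨c, hc⟩ := PolyEll.poly_form (P 0) (hP 0)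
  obtain ⟨d, hd⟩ := PolyEll.poly_form (P 1) (hP 1)
  let F : ℝ × ℝ → ℝ × ℝ := fun v =>
    (∑ i ∈ Finset.range (k + 1), c i * (v.1 ^ i * v.2 ^ (k - i)),
      ∑ i ∈ Finset.range (k + 1), d i * (v.1 ^ i * v.2 ^ (k - i)))
  have hWF : ∀ v : ℝ × ℝ, W !₂[v.1, v.2] = !₂[(F v).1, (F v).2] := by
    intro v
    ext i
    rw [hWP]
    fin_cases i
    · simp [hc, F]
    · simp [hd, F]
  have hmkv : ∀ v : EuclideanSpace ℝ (Fin 2), v = !₂[v 0, v 1] := by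
    intro v; ext i; fin_cases i <;> rfl
  have hFne : F ≠ 0 := by
    intro h
    apply hW0
    funext v
    have := hWF (v 0, v 1)
    simp only [h, Pi.zero_apply, Prod.fst_zero, Prod.snd_zero] at this
    rw [← hmkv v] at this
    rw [this]
    ext i; fin_cases i <;> simp
  have hFhom : ∀ (r : ℝ) (v : ℝ × ℝ), F (r • v) = r ^ k • F v := by
    intro r v
    ext
    · simp only [F, Prod.smul_fst, Prod.smul_snd, smul_eq_mul, Finset.mul_sum]
      refine Finset.sum_congr rfl fun i hi => ?_
      have : r ^ k = r ^ i * r ^ (k - i) := by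
        rw [← pow_add]; congr 1; rw [Finset.mem_range] at hi; omega
      rw [this]; ring
    · simp only [F, Prod.smul_fst, Prod.smul_snd, smul_eq_mul, Finset.mul_sum]
      refine Finset.sum_congr rfl fun i hi => ?_
      have : r ^ k = r ^ i * r ^ (k - i) := by
        rw [← pow_add]; congr 1; rw [Finset.mem_range] at hi; omega
      rw [this]; ring
  have hS1 : ∀ v : ℝ × ℝ, g v = 1 → ∀ t : ℝ, 1 ≤ g (v + t • F v) := by
    intro v hv t
    have hfr : (!₂[v.1, v.2] : EuclideanSpace ℝ (Fin 2)) ∈ frontier K :=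
      (gauge_eq_one_iff_mem_frontier hKconv hK0).mp hv
    obtain ⟨f1, f2⟩ := htang _ hfr
    rw [hWF] at f1 f2
    have e : (!₂[(v + t • F v).1, (v + t • F v).2] : EuclideanSpace ℝ (Fin 2)) =
        !₂[v.1, v.2] + t • !₂[(F v).1, (F v).2] := by
      ext i; fin_cases i <;> simp
    simp only [g]
    rw [e]
    rcases le_total 0 t with ht | ht
    · exact PolyEll.tangent_line K hKconv hK0 _ _ hfr f1 t ht
    · have := PolyEll.tangent_line K hKconv hK0 _ _ hfr f2 (-t) (by linarith)
      rwa [neg_smul_neg] at this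
  have hS : PolyEll.SuppLine g F := by
    intro v t
    by_cases hv : v = 0
    · rw [hv, hG.zero]; exact gauge_nonneg _
    · have hr := hG.pos v hv
      set r := g v with hrdef
      have h1 : g (r⁻¹ • v) = 1 := by
        rw [hG.hom _ _ (by positivity), ← hrdef, inv_mul_cancel₀ hr.ne']
      have h2 := hS1 _ h1 (r⁻¹ * t * r ^ k)
      have e : r⁻¹ • v + (r⁻¹ * t * r ^ k) • F (r⁻¹ • v) = r⁻¹ • (v + t • F v) := by
        rw [hFhom, smul_smul, smul_add, smul_smul]
        congr 2
        rw [mul_assoc, ← mul_pow, mul_inv_cancel₀ hr.ne', one_pow, mul_one]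
      rw [e, hG.hom _ _ (by positivity)] at h2
      rw [inv_mul_eq_div, one_le_div hr] at h2
      exact h2
  suffices hs : ∃ α β γ : ℝ, ∀ x y, g (x, y) ^ 2 = α * x ^ 2 + 2 * β * x * y + γ * y ^ 2 from hs
  have hk' : k = 0 ∨ k = 1 ∨ k = 2 ∨ k = 3 := by omega
  rcases hk' with rfl | rfl | rfl | rfl
  · exfalso
    have hconst : ∀ v, F v = (c 0, d 0) := by intro v; simp [F]
    have hne : (c 0, d 0) ≠ (0 : ℝ × ℝ) := by
      intro h; apply hFne; funext v; rw [hconst, h]; rfl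
    have := PolyEll.eig hG hS (c 0, d 0) hne 1 (by rw [hconst, one_smul])
    norm_num at this
  · have e : F = PolyEll.lin (c 1) (c 0) (d 1) (d 0) := by
      funext v
      simp only [F, PolyEll.lin, Finset.sum_range_succ, Finset.sum_range_zero]
      ext <;> simp <;> ring
    rw [e] at hS hFne
    exact PolyEll.linear_case hG _ _ _ _ hS hFne
  · have e : F = fun v => (PolyEll.quad (c 2) (c 1) (c 0) v, PolyEll.quad (d 2) (d 1) (d 0) v) := by
      funext v
      simp only [F, PolyEll.quad, Finset.sum_range_succ, Finset.sum_range_zero]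
      ext <;> simp <;> ring
    rw [e] at hS hFne
    exact PolyEll.quadratic_case hG _ _ _ _ _ _ hS hFne
  · obtain ⟨p, hp, hWp⟩ := hdeg3 rfl
    have hpq : (p 0, p 1) ≠ ((0 : ℝ), (0 : ℝ)) := by
      intro h
      apply hp
      rw [Prod.mk.injEq] at h
      ext i; fin_cases i
      · exact h.1
      · exact h.2
    have e1 : ∀ v : ℝ × ℝ, (F v).1 = c 3 * v.1 ^ 3 + c 2 * (v.1 ^ 2 * v.2) +
        c 1 * (v.1 * v.2 ^ 2) + c 0 * v.2 ^ 3 := by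
      intro v
      simp only [F, Finset.sum_range_succ, Finset.sum_range_zero]
      simp; ring
    have e2 : ∀ v : ℝ × ℝ, (F v).2 = d 3 * v.1 ^ 3 + d 2 * (v.1 ^ 2 * v.2) +
        d 1 * (v.1 * v.2 ^ 2) + d 0 * v.2 ^ 3 := by
      intro v
      simp only [F, Finset.sum_range_succ, Finset.sum_range_zero]
      simp; ring
    have hFp := hWF (p 0, p 1)
    simp only [] at hFp
    rw [← hmkv p, hWp] at hFp
    have z1 : (F (p 0, p 1)).1 = 0 := by
      have := congrArg (fun u : EuclideanSpace ℝ (Fin 2) => u 0) hFp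
      simpa using this.symm
    have z2 : (F (p 0, p 1)).2 = 0 := by
      have := congrArg (fun u : EuclideanSpace ℝ (Fin 2) => u 1) hFp
      simpa using this.symm
    rw [e1] at z1
    rw [e2] at z2
    obtain ⟨l, m, hlm, -, hf⟩ := PolyEll.quad_factor (p 0) (p 1) hpq
    obtain ⟨x1, x2, x3, hx⟩ := hf _ _ _ _ z1
    obtain ⟨y1, y2, y3, hy⟩ := hf _ _ _ _ z2
    have hFV : ∀ v : ℝ × ℝ, F v = (l * v.1 + m * v.2) •
        (PolyEll.quad x1 x2 x3 v, PolyEll.quad y1 y2 y3 v) := by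
      intro v
      ext
      · rw [e1, hx]; simp
      · rw [e2, hy]; simp
    have hS' := PolyEll.divide hG hS
      (fun v => (PolyEll.quad x1 x2 x3 v, PolyEll.quad y1 y2 y3 v))
      (by unfold PolyEll.quad; fun_prop) l m hlm hFV
    refine PolyEll.quadratic_case hG _ _ _ _ _ _ hS' ?_
    intro h
    apply hFne
    funext v
    rw [hFV]
    have := congrFun h v
    simp only [Pi.zero_apply] at this
    rw [this]; simp
end

section
/- Let V be a real vector space with dim V = n+1 ≥ 3 and B ⊂ V a convex body with 0 in its interior. Let A : ΛⁿV → ℝ be the affine cross-section area function of B, let σ ∈ ΛⁿV∖{0} be a point at which A is differentiable, let X = Π_σ and K = B ∩ X, and let ν ∈ V∖X be a vector such that the differential d_σA (a linear functional on ΛⁿV) satisfies d_σA(ν ∧ β) = 0 for all β ∈ Λ^{n−1}V. Suppose λ ∈ X* and L : X → X is a linear map such that for every x ∈ ∂K the vector L(x) + λ(x)·ν is forward tangent to ∂B at x. Then tr L = 0. -/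
open Filter Topology MeasureTheory

namespace TraceAux

variable {V : Type*} [NormedAddCommGroup V] [NormedSpace ℝ V]

/-- Convexity of the gauge along a ray. -/
lemma gauge_ray {B : Set V} (hc : Convex ℝ B) (h0 : B ∈ 𝓝 (0 : V)) (x u : V) {s t : ℝ}
    (hs : 0 ≤ s) (hst : s ≤ t) (ht : 0 < t) :
    gauge B (x + s • u) ≤ (1 - s / t) * gauge B x + s / t * gauge B (x + t • u) := by
  have h1 : 0 ≤ s / t := by positivity
  have h2 : 0 ≤ 1 - s / t := by
    have : s / t ≤ 1 := (div_le_one ht).2 hst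
    linarith
  have : x + s • u = (1 - s / t) • x + (s / t) • (x + t • u) := by
    rw [smul_add, smul_smul, div_mul_cancel₀ _ ht.ne', ← add_assoc, ← add_smul]
    simp
  rw [this]
  refine (gauge_add_le hc (absorbent_nhds_zero h0) _ _).trans ?_
  rw [gauge_smul_of_nonneg h1, gauge_smul_of_nonneg h2]
  simp

/-- Forward tangent vectors are zeros of the directional derivative of the gauge. -/
lemma tangent_gauge {B : Set V} (hc : Convex ℝ B) (h0 : B ∈ 𝓝 (0 : V)) {x u : V}
    (hx : x ∈ frontier B) (h : IsForwardTangent B x u) {δ T : ℝ} (hδ : 0 < δ) (hT : 0 < T) :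
    ∃ s, 0 < s ∧ s < T ∧ |gauge B (x + s • u) - 1| ≤ δ * s := by
  have hx1 : gauge B x = 1 := (gauge_eq_one_iff_mem_frontier hc h0).2 hx
  by_cases hu : u = 0
  · refine ⟨T / 2, by positivity, by linarith, ?_⟩
    subst hu
    simp only [smul_zero, add_zero, hx1, sub_self, abs_zero]
    positivity
  obtain ⟨p, c, hp, hcp, hpx, hcu⟩ := h
  obtain ⟨k, hk⟩ := hc.lipschitz_gauge h0
  have hu' : 0 < ‖u‖ := norm_pos_iff.2 hu
  have e1 : ∀ᶠ i in atTop, ‖u‖ / 2 < ‖c i • (p i - x)‖ :=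
    hcu.norm.eventually (lt_mem_nhds (by linarith))
  have e2 : ∀ᶠ i in atTop, dist (p i) x < T * (‖u‖ / 2) :=
    hpx.eventually (Metric.ball_mem_nhds _ (by positivity))
  have e3 : ∀ᶠ i in atTop, dist (c i • (p i - x)) u < δ / (k + 1) :=
    hcu.eventually (Metric.ball_mem_nhds _ (by positivity))
  obtain ⟨i, h1, h2, h3⟩ := (e1.and (e2.and e3)).exists
  have hci := hcp i
  refine ⟨(c i)⁻¹, by positivity, ?_, ?_⟩
  · rw [norm_smul, Real.norm_of_nonneg hci.le] at h1
    rw [dist_eq_norm] at h2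
    have : ‖u‖ / 2 < c i * (T * (‖u‖ / 2)) := h1.trans (by gcongr)
    rw [inv_lt_iff_one_lt_mul₀ hci]
    have h4 : 1 * (‖u‖ / 2) < (c i * T) * (‖u‖ / 2) := by linarith
    have := lt_of_mul_lt_mul_right h4 (by positivity)
    linarith
  · have hg : gauge B (p i) = 1 := (gauge_eq_one_iff_mem_frontier hc h0).2 (hp i)
    have h5 := hk.dist_le_mul (x + (c i)⁻¹ • u) (p i)
    rw [hg, Real.dist_eq] at h5
    refine h5.trans ?_
    have h6 : x + (c i)⁻¹ • u - p i = (c i)⁻¹ • (u - c i • (p i - x)) := by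
      rw [smul_sub, smul_smul, inv_mul_cancel₀ hci.ne', one_smul]; abel
    rw [dist_eq_norm, h6, norm_smul, Real.norm_of_nonneg (by positivity), ← dist_eq_norm,
      dist_comm]
    have h7 : (k : ℝ) * dist (c i • (p i - x)) u ≤ δ := by
      have hk0 : (0 : ℝ) ≤ k := k.2
      calc (k : ℝ) * dist (c i • (p i - x)) u ≤ (k + 1) * (δ / (k + 1)) := by
            gcongr; linarith
        _ = δ := by field_simp
    calc (k : ℝ) * ((c i)⁻¹ * dist (c i • (p i - x)) u)
        = (k * dist (c i • (p i - x)) u) * (c i)⁻¹ := by ring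
      _ ≤ δ * (c i)⁻¹ := by gcongr

lemma one_le_gauge {B : Set V} (hc : Convex ℝ B) (h0 : B ∈ 𝓝 (0 : V)) {x u : V}
    (hx : x ∈ frontier B) (h : IsForwardTangent B x u) {t : ℝ} (ht : 0 ≤ t) :
    1 ≤ gauge B (x + t • u) := by
  have hx1 : gauge B x = 1 := (gauge_eq_one_iff_mem_frontier hc h0).2 hx
  rcases ht.eq_or_lt with rfl | ht
  · simp [hx1]
  by_contra! hlt
  set g := gauge B (x + t • u) with hg
  obtain ⟨s, hs0, hst, hs⟩ := tangent_gauge hc h0 hx h (δ := (1 - g) / (2 * t)) (T := t)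
    (by have : 0 < 1 - g := by linarith
        positivity) ht
  have h1 := gauge_ray hc h0 x u hs0.le hst.le ht
  rw [hx1, ← hg] at h1
  have h2 := (abs_le.1 hs).1
  have h3 : s / t * (1 - g) ≤ (1 - g) / (2 * t) * s := by linarith
  have h4 : (1 - g) / (2 * t) * s = s / t * (1 - g) / 2 := by field_simp
  have h5 : 0 < s / t * (1 - g) := mul_pos (by positivity) (by linarith)
  linarith

section Param

variable {P : Type*} [NormedAddCommGroup P] [NormedSpace ℝ P] [FiniteDimensional ℝ P]

lemma normalize {B : Set V} (hc : Convex ℝ B) (h0 : B ∈ 𝓝 (0 : V)) (hB : IsCompact B)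
    (x : V) (hx : x ≠ 0) : 0 < gauge B x ∧ (gauge B x)⁻¹ • x ∈ frontier B := by
  have hpos : 0 < gauge B x :=
    (gauge_pos (absorbent_nhds_zero h0) (hB.isVonNBounded ℝ)).2 hx
  refine ⟨hpos, (gauge_eq_one_iff_mem_frontier hc h0).1 ?_⟩
  rw [gauge_smul_of_nonneg (by positivity), smul_eq_mul, inv_mul_cancel₀ hpos.ne']

lemma lower {B : Set V} (hc : Convex ℝ B) (h0 : B ∈ 𝓝 (0 : V)) (hB : IsCompact B)
    (ψ u : P →ₗ[ℝ] V) 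
    (h : ∀ c, ψ c ∈ frontier B → IsForwardTangent B (ψ c) (u c)) (c : P) {t : ℝ} (ht : 0 ≤ t) :
    gauge B (ψ c) ≤ gauge B (ψ c + t • u c) := by
  by_cases hx : ψ c = 0
  · rw [hx, gauge_zero]; exact gauge_nonneg _
  obtain ⟨hp, hf⟩ := normalize hc h0 hB _ hx
  rw [← map_smul] at hf
  have := one_le_gauge hc h0 hf (h _ hf) ht
  rw [map_smul, map_smul, smul_comm t, ← smul_add, gauge_smul_of_nonneg (by positivity),
    smul_eq_mul] at this
  rwa [inv_mul_eq_div, one_le_div hp] at this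

lemma upper {B : Set V} (hc : Convex ℝ B) (h0 : B ∈ 𝓝 (0 : V)) (hB : IsCompact B)
    (ψ u : P →ₗ[ℝ] V) (hψ : Function.Injective ψ)
    (h : ∀ c, ψ c ∈ frontier B → IsForwardTangent B (ψ c) (u c)) {ε : ℝ} (hε : 0 < ε) :
    ∃ T : ℝ, 0 < T ∧ ∀ t, 0 ≤ t → t ≤ T → ∀ c,
      gauge B (ψ c + t • u c) ≤ (1 + ε * t) * gauge B (ψ c) := by
  have hemb := LinearMap.isClosedEmbedding_of_injective (f := ψ) (LinearMap.ker_eq_bot.2 hψ)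
  have hfr : IsCompact (frontier B) := hB.of_isClosed_subset isClosed_frontier
    hB.isClosed.frontier_subset
  have hK : IsCompact (ψ ⁻¹' frontier B) := hemb.isCompact_preimage hfr
  have hgc : Continuous (gauge B) := continuous_gauge hc h0
  have huc : Continuous u := u.continuous_of_finiteDimensional
  have hpc : Continuous ψ := ψ.continuous_of_finiteDimensional
  have key : ∀ c ∈ ψ ⁻¹' frontier B, ∀ s t : ℝ, 0 < s → s ≤ t →
      gauge B (ψ c + t • u c) < 1 + ε * t → gauge B (ψ c + s • u c) < 1 + ε * s := by
    intro c hcf s t hs hst hlt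
    have ht : 0 < t := hs.trans_le hst
    have h1 := gauge_ray hc h0 (ψ c) (u c) hs.le hst ht
    rw [(gauge_eq_one_iff_mem_frontier hc h0).2 hcf] at h1
    refine h1.trans_lt ?_
    have : s / t * gauge B (ψ c + t • u c) < s / t * (1 + ε * t) := by gcongr
    have h2 : s / t * (1 + ε * t) = s / t + ε * s := by field_simp
    linarith
  have hT : ∃ T : ℝ, 0 < T ∧ ∀ c ∈ ψ ⁻¹' frontier B, gauge B (ψ c + T • u c) < 1 + ε * T := by
    refine hK.induction_on (p := fun S => ∃ T : ℝ, 0 < T ∧ ∀ c ∈ ψ ⁻¹' frontier B, c ∈ S →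
      gauge B (ψ c + T • u c) < 1 + ε * T) ⟨1, one_pos, by simp⟩ ?_ ?_ ?_ |>.imp
      fun T hT => ⟨hT.1, fun c hc => hT.2 c hc hc⟩
    · rintro S S' hS ⟨T, hT, hT'⟩
      exact ⟨T, hT, fun c hc hcS => hT' c hc (hS hcS)⟩
    · rintro S S' ⟨T, hT, h1⟩ ⟨T', hT', h2⟩
      refine ⟨min T T', lt_min hT hT', fun c hc hcS => ?_⟩
      rcases hcS with hcS | hcS
      · exact key c hc _ _ (lt_min hT hT') (min_le_left _ _) (h1 c hc hcS)
      · exact key c hc _ _ (lt_min hT hT') (min_le_right _ _) (h2 c hc hcS)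
    · intro c hcf
      obtain ⟨s, hs0, -, hs⟩ := tangent_gauge hc h0 hcf (h c hcf) (half_pos hε) one_pos
      have hlt : gauge B (ψ c + s • u c) < 1 + ε * s := by
        have := (abs_le.1 hs).2
        have : 0 < ε * s := by positivity
        linarith
      have hopen : IsOpen {c | gauge B (ψ c + s • u c) < 1 + ε * s} :=
        isOpen_lt (hgc.comp (hpc.add (huc.const_smul s))) continuous_const
      exact ⟨_, mem_nhdsWithin_of_mem_nhds (hopen.mem_nhds hlt), s, hs0, fun c _ h => h⟩
  obtain ⟨T, hT0, hT⟩ := hT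
  refine ⟨T, hT0, fun t ht0 htT c => ?_⟩
  by_cases hx : ψ c = 0
  · have : c = 0 := hψ (by simpa using hx)
    subst this; simp
  rcases ht0.eq_or_lt with rfl | ht0
  · simp
  obtain ⟨hp, hf⟩ := normalize hc h0 hB _ hx
  rw [← map_smul] at hf
  have := (key _ hf t T ht0 htT (hT _ hf)).le
  rw [map_smul, map_smul, smul_comm t, ← smul_add, gauge_smul_of_nonneg (by positivity),
    smul_eq_mul] at this
  rwa [inv_mul_le_iff₀ hp, mul_comm] at this

end Param

lemma multilinear_continuous {n : ℕ} [FiniteDimensional ℝ V] {E : Type*} [NormedAddCommGroup E]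
    [NormedSpace ℝ E] (F : MultilinearMap ℝ (fun _ : Fin n => V) E) : Continuous F := by
  classical
  let b := Module.finBasis ℝ V
  have h : ∀ w : Fin n → V, F w = ∑ r : Fin n → Fin (Module.finrank ℝ V),
      (∏ i, b.repr (w i) (r i)) • F (fun i => b (r i)) := by
    intro w
    conv_lhs => rw [show w = fun i => ∑ j, b.repr (w i) j • b j from
      funext fun i => (b.sum_repr (w i)).symm]
    rw [F.map_sum]
    refine Finset.sum_congr rfl fun r _ => ?_
    exact F.map_smul_univ _ _
  have h2 : (F : (Fin n → V) → E) = fun w => ∑ r : Fin n → Fin (Module.finrank ℝ V),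
      (∏ i, b.repr (w i) (r i)) • F (fun i => b (r i)) := funext h
  rw [h2]
  refine continuous_finsetSum _ fun r _ => Continuous.smul ?_ continuous_const
  refine continuous_finsetProd _ fun i _ => ?_
  exact ((b.coord (r i)).continuous_of_finiteDimensional).comp (continuous_apply i)

lemma multilinear_deriv {n : ℕ} [FiniteDimensional ℝ V] {E : Type*} [NormedAddCommGroup E]
    [NormedSpace ℝ E] (F : MultilinearMap ℝ (fun _ : Fin n => V) E) (v u : Fin n → V) :
    HasDerivAt (fun t : ℝ => F (v + t • u)) (∑ i, F (Function.update v i (u i))) 0 := by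
  let G : ContinuousMultilinearMap ℝ (fun _ : Fin n => V) E := ⟨F, multilinear_continuous F⟩
  have h1 : HasDerivAt (fun t : ℝ => v + t • u) u 0 := by
    simpa using ((hasDerivAt_id (0 : ℝ)).smul_const u).const_add v
  have h2 := (G.hasFDerivAt (v + (0 : ℝ) • u)).comp_hasDerivAt (0 : ℝ) h1
  rw [ContinuousMultilinearMap.linearDeriv_apply] at h2
  have h3 : v + (0 : ℝ) • u = v := by simp
  rw [h3] at h2
  exact h2

/-- Replacing vectors by their images under a linear map and summing gives the trace. -/
lemma sum_update_trace {n : ℕ} {E : Type*} [AddCommGroup E] [Module ℝ E]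
    (F : V [⋀^Fin n]→ₗ[ℝ] E) (v : Fin n → V) (hv : LinearIndependent ℝ v)
    (L : (Submodule.span ℝ (Set.range v)) →ₗ[ℝ] (Submodule.span ℝ (Set.range v))) :
    ∑ i, F (Function.update v i (L (Module.Basis.span hv i) : V))
      = LinearMap.trace ℝ _ L • F v := by
  classical
  let b := Module.Basis.span hv
  have hb : ∀ i, (b i : V) = v i := fun i => congrArg Subtype.val (Module.Basis.span_apply hv i)
  rw [LinearMap.trace_eq_matrix_trace ℝ b, Matrix.trace, Finset.sum_smul]
  refine Finset.sum_congr rfl fun i _ => ?_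
  have h1 : (L (b i) : V) = ∑ j, b.repr (L (b i)) j • v j := by
    conv_lhs => rw [← b.sum_repr (L (b i))]
    rw [Submodule.coe_sum]
    exact Finset.sum_congr rfl fun j _ => by rw [Submodule.coe_smul, hb]
  change F (Function.update v i (L (b i) : V)) = _
  rw [h1, F.map_update_sum, Finset.sum_eq_single i]
  · rw [F.map_update_smul, Function.update_eq_self, Matrix.diag_apply, LinearMap.toMatrix_apply]
  · intro j _ hj
    rw [F.map_update_smul, F.map_update_self _ hj.symm, smul_zero]
  · simp

/-- A wedge containing `ν` is of the form `ν ∧ β`. -/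
lemma exists_wedge {n : ℕ} (hn : 1 ≤ n) (v : Fin n → V) (i : Fin n) (ν : V) :
    ∃ β : ExteriorAlgebra ℝ V, β ∈ ⋀[ℝ]^(n-1) V ∧
      ExteriorAlgebra.ιMulti ℝ n (Function.update v i ν) = ExteriorAlgebra.ι ℝ ν * β := by
  obtain ⟨m, rfl⟩ : ∃ m, n = m + 1 := ⟨n - 1, by omega⟩
  have hmem : ∀ w : Fin m → V, ExteriorAlgebra.ιMulti ℝ m w ∈ ⋀[ℝ]^(m + 1 - 1) V :=
    fun w => ExteriorAlgebra.ιMulti_range ℝ m ⟨w, rfl⟩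
  by_cases hi : i = 0
  · subst hi
    refine ⟨_, hmem (Matrix.vecTail (Function.update v 0 ν)), ?_⟩
    rw [ExteriorAlgebra.ιMulti_succ_apply, Function.update_self]
  · refine ⟨- ExteriorAlgebra.ιMulti ℝ m
      (Matrix.vecTail (Function.update v i ν ∘ Equiv.swap 0 i)), neg_mem (hmem _), ?_⟩
    have h1 := (ExteriorAlgebra.ιMulti ℝ (m + 1)).map_swap (Function.update v i ν)
      (Ne.symm hi)
    rw [ExteriorAlgebra.ιMulti_succ_apply] at h1
    simp only [Function.comp_apply, Equiv.swap_apply_left, Function.update_self] at h1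
    rw [mul_neg, h1, neg_neg]

end TraceAux

open scoped Pointwise

/-- **Lemma (trace vanishes).**  Let `dim V = n + 1 ≥ 3` and `B ⊂ V` a convex body with `0` in
its interior.  Let `A : ΛⁿV → ℝ` be the affine cross-section area function of `B` (here
`ΛⁿV = ⋀[ℝ]^n V` is identified with a normed space `E` via a linear equivalence `e`, and `A`
is prescribed by `A(0) = 0` and `A(w₁ ∧ ⋯ ∧ wₙ) = vol_σ(B ∩ Π_σ)⁻¹` for linearly independent
`w`, where `vol_σ(B ∩ Π_σ)` is the Lebesgue measure of `{c ∈ ℝⁿ | ∑ cᵢ wᵢ ∈ B}`, i.e. the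
Haar measure on the span of `w` giving the parallelotope with edges `w₁, …, wₙ` measure `1`).
Let `σ = v₁ ∧ ⋯ ∧ vₙ ≠ 0` be a point where `A` is differentiable, `X = Π_σ` the span of the
`vᵢ`, `K = B ∩ X`, and let `ν ∈ V ∖ X` satisfy `d_σA(ν ∧ β) = 0` for all `β ∈ Λ^{n-1}V`.
If `λ ∈ X*` and `L : X → X` is linear and for every `x ∈ ∂K` the vector `L(x) + λ(x)·ν` is
forward tangent to `∂B` at `x` (here `∂K = ∂B ∩ X`), then `tr L = 0`. -/
theorem trace_eq_zero_of_forwardTangent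
    {V : Type*} [NormedAddCommGroup V] [NormedSpace ℝ V]
    (n : ℕ) (hn : 2 ≤ n) (hdim : Module.finrank ℝ V = n + 1)
    (B : Set V) (hBcomp : IsCompact B) (hBconv : Convex ℝ B)
    (h0 : (0 : V) ∈ interior B)
    {E : Type*} [NormedAddCommGroup E] [NormedSpace ℝ E]
    (e : (⋀[ℝ]^n V) ≃ₗ[ℝ] E)
    (A : E → ℝ)
    (hA0 : A 0 = 0)
    (hAval : ∀ w : Fin n → V, LinearIndependent ℝ w →
      ∀ hw : ExteriorAlgebra.ιMulti ℝ n w ∈ ⋀[ℝ]^n V,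
        A (e ⟨ExteriorAlgebra.ιMulti ℝ n w, hw⟩) =
          ((volume {c : Fin n → ℝ | ∑ i, c i • w i ∈ B}).toReal)⁻¹)
    (v : Fin n → V) (hv : LinearIndependent ℝ v)
    (hσ : ExteriorAlgebra.ιMulti ℝ n v ∈ ⋀[ℝ]^n V)
    (hdiff : DifferentiableAt ℝ A (e ⟨ExteriorAlgebra.ιMulti ℝ n v, hσ⟩))
    (ν : V) (hν : ν ∉ Submodule.span ℝ (Set.range v))
    (hker : ∀ β : ExteriorAlgebra ℝ V, β ∈ ⋀[ℝ]^(n-1) V →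
      ∀ hβ : ExteriorAlgebra.ι ℝ ν * β ∈ ⋀[ℝ]^n V,
        fderiv ℝ A (e ⟨ExteriorAlgebra.ιMulti ℝ n v, hσ⟩)
          (e ⟨ExteriorAlgebra.ι ℝ ν * β, hβ⟩) = 0)
    (lam : Module.Dual ℝ (Submodule.span ℝ (Set.range v)))
    (L : (Submodule.span ℝ (Set.range v)) →ₗ[ℝ] (Submodule.span ℝ (Set.range v)))
    (htang : ∀ x : Submodule.span ℝ (Set.range v), (x : V) ∈ frontier B →
      IsForwardTangent B (x : V) (((L x : V)) + lam x • ν)) :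
    LinearMap.trace ℝ _ L = 0 := by
  classical
  have : FiniteDimensional ℝ V := Module.finite_of_finrank_pos (by omega)
  have hB0 : B ∈ 𝓝 (0 : V) := mem_interior_iff_mem_nhds.1 h0
  let F : V [⋀^Fin n]→ₗ[ℝ] E := e.toLinearMap.compAlternatingMap (exteriorPower.ιMulti ℝ n)
  have hF : ∀ w hw, F w = e ⟨ExteriorAlgebra.ιMulti ℝ n w, hw⟩ := fun w hw => rfl
  have hmem : ∀ w : Fin n → V, ExteriorAlgebra.ιMulti ℝ n w ∈ ⋀[ℝ]^n V :=
    fun w => ExteriorAlgebra.ιMulti_range ℝ n ⟨w, rfl⟩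
  let S : (Fin n → V) → Set (Fin n → ℝ) := fun w => {c | ∑ i, c i • w i ∈ B}
  have hAF : ∀ w, LinearIndependent ℝ w → A (F w) = ((volume (S w)).toReal)⁻¹ :=
    fun w hw => hAval w hw (hmem w)
  rw [← hF v hσ] at hdiff hker
  set D := fderiv ℝ A (F v) with hD
  have hAD : HasFDerivAt A D (F v) := hdiff.hasFDerivAt
  -- derivative along curves
  have hcurve : ∀ u : Fin n → V, HasDerivAt (fun t : ℝ => A (F (v + t • u)))
      (D (∑ i, F (Function.update v i (u i)))) 0 := by
    intro u
    have h1 := TraceAux.multilinear_deriv F.toMultilinearMap v u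
    have h2 : HasFDerivAt A D (F (v + (0 : ℝ) • u)) := by simpa using hAD
    exact h2.comp_hasDerivAt (0 : ℝ) h1
  -- the coordinate map
  let Ψ : (Fin n → V) → (Fin n → ℝ) →ₗ[ℝ] V := fun w => Fintype.linearCombination ℝ w
  have hΨ : ∀ w c, Ψ w c = ∑ i, c i • w i := fun w c => rfl
  have hinj : ∀ w, LinearIndependent ℝ w → Function.Injective (Ψ w) := fun w hw =>
    linearIndependent_iff_injective_fintypeLinearCombination.1 hw
  have hBg : ∀ x, x ∈ B ↔ gauge B x ≤ 1 := fun x => by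
    rw [gauge_le_one_iff_mem_closure hBconv hB0, hBcomp.isClosed.closure_eq]
  have hSg : ∀ w c, c ∈ S w ↔ gauge B (Ψ w c) ≤ 1 := fun w c => hBg _
  have hfin : volume (S v) ≠ ⊤ := by
    have hemb := LinearMap.isClosedEmbedding_of_injective (f := Ψ v)
      (LinearMap.ker_eq_bot.2 (hinj v hv))
    exact (hemb.isCompact_preimage hBcomp).measure_ne_top
  have hpos : 0 < volume (S v) := by
    have hc : Continuous (Ψ v) := (Ψ v).continuous_of_finiteDimensional
    have : (Ψ v) ⁻¹' B ∈ 𝓝 0 := hc.continuousAt (by simpa using hB0)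
    exact Measure.measure_pos_of_mem_nhds volume this
  have hposR : 0 < (volume (S v)).toReal := ENNReal.toReal_pos hpos.ne' hfin
  set a0 := A (F v) with ha0
  have ha0v : a0 = ((volume (S v)).toReal)⁻¹ := hAF v hv
  have ha0pos : 0 < a0 := by rw [ha0v]; positivity
  have hsmulS : ∀ r : ℝ, 0 < r → (volume (r⁻¹ • S v)).toReal = (r ^ n)⁻¹ * (volume (S v)).toReal := by
    intro r hr
    rw [Measure.addHaar_smul, ENNReal.toReal_mul, ENNReal.toReal_ofReal (abs_nonneg _),
      abs_of_pos (by positivity)]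
    simp
  -- homogeneity
  have hhom : D (F v) = a0 := by
    have h1 := hcurve v
    have h2 : ∑ i, F (Function.update v i (v i)) = (n : ℝ) • F v := by
      simp [Nat.cast_smul_eq_nsmul]
    rw [h2, map_smul, smul_eq_mul] at h1
    have h3 : HasDerivAt (fun t : ℝ => (1 + t) ^ n * a0) (n * a0) 0 := by
      have := (((hasDerivAt_id (0 : ℝ)).const_add 1).pow n).mul_const a0
      simpa using this
    have h4 : (fun t : ℝ => A (F (v + t • v))) =ᶠ[𝓝 0] fun t : ℝ => (1 + t) ^ n * a0 := by
      have : ∀ᶠ t : ℝ in 𝓝 0, -1 < t := lt_mem_nhds (by norm_num)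
      filter_upwards [this] with t ht
      have hr : 0 < 1 + t := by linarith
      have e1 : v + t • v = (1 + t) • v := by rw [add_smul, one_smul]
      have hli : LinearIndependent ℝ ((1 + t) • v) := by
        exact hv.units_smul (fun _ => Units.mk0 (1 + t) hr.ne')
      have e2 : S ((1 + t) • v) = (1 + t)⁻¹ • S v := by
        ext c
        rw [Set.mem_inv_smul_set_iff₀ hr.ne']
        simp only [S, Set.mem_ofPred_eq, Pi.smul_apply, smul_eq_mul, smul_smul, mul_comm]
      rw [e1, hAF _ hli, e2, hsmulS _ hr, ha0v, mul_inv, inv_inv]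
    have h5 := (h3.congr_of_eventuallyEq h4).unique h1
    have hn0 : (n : ℝ) ≠ 0 := by positivity
    exact (mul_left_cancel₀ hn0 h5).symm
  -- the main curve
  let b := Module.Basis.span hv
  have hb : ∀ i, (b i : V) = v i := fun i => congrArg Subtype.val (Module.Basis.span_apply hv i)
  let U : (Submodule.span ℝ (Set.range v)) →ₗ[ℝ] V :=
    (Submodule.subtype _).comp L + lam.smulRight ν
  have hU : ∀ x, U x = (L x : V) + lam x • ν := fun x => rfl
  let u : Fin n → V := fun i => U (b i)
  have hDu : D (∑ i, F (Function.update v i (u i))) = LinearMap.trace ℝ _ L * a0 := by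
    have h1 : ∀ i, F (Function.update v i (u i)) =
        F (Function.update v i (L (b i) : V)) + lam (b i) • F (Function.update v i ν) := by
      intro i
      rw [← F.map_update_smul, ← F.map_update_add]
      rfl
    have h2 : ∀ i, D (F (Function.update v i ν)) = 0 := by
      intro i
      obtain ⟨β, hβ, hβ2⟩ := TraceAux.exists_wedge (by omega) v i ν
      have hm : ExteriorAlgebra.ι ℝ ν * β ∈ ⋀[ℝ]^n V := hβ2 ▸ hmem _
      rw [← hker β hβ hm, hF _ (hmem _)]
      congr 3
    simp_rw [h1]
    rw [Finset.sum_add_distrib, TraceAux.sum_update_trace F v hv L, map_add, map_smul, hhom,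
      map_sum]
    simp [h2]
  have hmain := hcurve u
  rw [hDu] at hmain
  have hlin : ∀ (t : ℝ) (c : Fin n → ℝ), Ψ (v + t • u) c = Ψ v c + t • Ψ u c := by
    intro t c
    simp only [hΨ, Pi.add_apply, Pi.smul_apply, smul_add, Finset.sum_add_distrib, Finset.smul_sum]
    congr 1
    exact Finset.sum_congr rfl fun i _ => smul_comm _ _ _
  have htan : ∀ c, Ψ v c ∈ frontier B → IsForwardTangent B (Ψ v c) (Ψ u c) := by
    intro c hc
    have e1 : Ψ v c = ((∑ i, c i • b i : Submodule.span ℝ (Set.range v)) : V) := by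
      simp [hΨ, hb]
    have e2 : Ψ u c = U (∑ i, c i • b i) := by
      simp [hΨ, u]
    rw [e1] at hc ⊢
    rw [e2, hU]
    exact htang _ hc
  have hLI : ∀ᶠ t : ℝ in 𝓝 0, LinearIndependent ℝ (v + t • u) := by
    have hc : ContinuousAt (fun t : ℝ => v + t • u) 0 := by fun_prop
    have := hv.eventually (𝕜 := ℝ)
    exact hc.eventually (by simpa using this)
  have hmono : ∀ t : ℝ, 0 ≤ t → S (v + t • u) ⊆ S v := by
    intro t ht c hc
    rw [hSg, hlin] at hc
    rw [hSg]
    exact (TraceAux.lower hBconv hB0 hBcomp (Ψ v) (Ψ u) htan c ht).trans hc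
  have hbd : ∀ ε : ℝ, 0 < ε → ∀ᶠ t : ℝ in 𝓝[>] 0,
      a0 ≤ A (F (v + t • u)) ∧ A (F (v + t • u)) ≤ (1 + ε * t) ^ n * a0 := by
    intro ε hε
    obtain ⟨T, hT0, hT⟩ := TraceAux.upper hBconv hB0 hBcomp (Ψ v) (Ψ u) (hinj v hv) htan hε
    have hTe : ∀ᶠ t : ℝ in 𝓝[>] 0, t < T := mem_nhdsWithin_of_mem_nhds (gt_mem_nhds hT0)
    filter_upwards [hTe, self_mem_nhdsWithin, mem_nhdsWithin_of_mem_nhds hLI] with t htT ht0 hli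
    have ht0' : 0 < t := ht0
    have hr : 0 < 1 + ε * t := by positivity
    have hsub : (1 + ε * t)⁻¹ • S v ⊆ S (v + t • u) := by
      intro c hc
      rw [Set.mem_inv_smul_set_iff₀ hr.ne', hSg, map_smul, gauge_smul_of_nonneg hr.le] at hc
      rw [hSg, hlin]
      exact (hT t ht0'.le htT.le c).trans hc
    have hfin' : volume (S (v + t • u)) ≠ ⊤ :=
      ne_top_of_le_ne_top hfin (measure_mono (hmono t ht0'.le))
    have i1 : (volume (S (v + t • u))).toReal ≤ (volume (S v)).toReal :=
      ENNReal.toReal_mono hfin (measure_mono (hmono t ht0'.le))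
    have i2 : ((1 + ε * t) ^ n)⁻¹ * (volume (S v)).toReal ≤ (volume (S (v + t • u))).toReal := by
      rw [← hsmulS _ hr]
      exact ENNReal.toReal_mono hfin' (measure_mono hsub)
    have i3 : 0 < ((1 + ε * t) ^ n)⁻¹ * (volume (S v)).toReal := by positivity
    rw [hAF _ hli, ha0v]
    refine ⟨inv_anti₀ (i3.trans_le i2) i1, ?_⟩
    refine (inv_anti₀ i3 i2).trans ?_
    rw [mul_inv, inv_inv]
  -- compare derivatives
  have hcmp : ∀ (f g : ℝ → ℝ) (f' g' : ℝ), HasDerivAt f f' 0 → HasDerivAt g g' 0 → f 0 = g 0 →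
      (∀ᶠ t : ℝ in 𝓝[>] 0, f t ≤ g t) → f' ≤ g' := by
    intro f g f' g' hf hg h00 hle
    have h1 := hf.tendsto_slope_zero_right
    have h2 := hg.tendsto_slope_zero_right
    refine le_of_tendsto_of_tendsto h1 h2 ?_
    filter_upwards [hle, self_mem_nhdsWithin] with t ht ht0
    have ht0' : 0 < t := ht0
    simp only [zero_add, smul_eq_mul, h00]
    gcongr
  have hz : A (F (v + (0 : ℝ) • u)) = a0 := by simp [ha0]
  have hlow : 0 ≤ LinearMap.trace ℝ _ L * a0 :=
    hcmp _ _ _ _ (hasDerivAt_const (0 : ℝ) a0) hmain hz.symm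
      ((hbd 1 one_pos).mono fun t ht => ht.1)
  have hup : ∀ ε : ℝ, 0 < ε → LinearMap.trace ℝ _ L * a0 ≤ n * ε * a0 := by
    intro ε hε
    have h3 : HasDerivAt (fun t : ℝ => (1 + ε * t) ^ n * a0) (n * ε * a0) 0 := by
      have := ((((hasDerivAt_id (0 : ℝ)).const_mul ε).const_add 1).pow n).mul_const a0
      simpa using this
    exact hcmp _ _ _ _ hmain h3 (by simpa using hz) ((hbd ε hε).mono fun t ht => ht.2)
  have h1 : 0 ≤ LinearMap.trace ℝ _ L := nonneg_of_mul_nonneg_left hlow ha0pos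
  refine le_antisymm (le_of_forall_pos_le_add fun δ hδ => ?_) h1
  have hn0 : (0 : ℝ) < n := by positivity
  have := le_of_mul_le_mul_right (hup (δ / n) (by positivity)) ha0pos
  rw [mul_div_cancel₀ _ hn0.ne'] at this
  linarith
end

section
/- Let X be a real vector space with dim X = 3, K ⊂ X a convex body with 0 in its interior, and R : X* → End(X) a linear map with tr R(λ) = 0 for all λ ∈ X*, satisfying the tangency assumption: for every λ ∈ X* and every x ∈ ∂K with λ(x) = 0, the vector R_λ(x) is tangent to ∂K at x. Assume that R is degenerate at every p ∈ X∖{0}, i.e. dim T^R_p ≤ 1 for all p ≠ 0. Then for every λ ∈ X* and every x ∈ ∂K, the vector R_λ(x) is tangent to ∂K at x. -/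
open Filter Topology

/-- For a linear map `R : X* → End(X)` and `p ∈ X`, the set
`T^R_p = {R_λ(p) : λ ∈ X*, λ(p) = 0}`. -/
def TR {X : Type*} [AddCommGroup X] [Module ℝ X]
    (R : Module.Dual ℝ X →ₗ[ℝ] (X →ₗ[ℝ] X)) (p : X) : Set X :=
  {y | ∃ lam : Module.Dual ℝ X, lam p = 0 ∧ R lam p = y}

/-- forward tangency gives a supporting inequality for the gauge in the opposite direction -/
theorem gauge_ge_of_forward {X : Type*} [NormedAddCommGroup X] [NormedSpace ℝ X]
    {K : Set X} (hKconv : Convex ℝ K) (h0 : K ∈ 𝓝 (0 : X)) {x v : X} (hx : x ∈ frontier K)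
    (h : IsForwardTangent K x v) {s : ℝ} (hs : 0 ≤ s) : 1 ≤ gauge K (x - s • v) := by
  obtain ⟨p, c, hp, hc, -, hlim⟩ := h
  have hcont := continuous_gauge hKconv h0
  have ht : Tendsto (fun i => gauge K (x - s • (c i • (p i - x)))) atTop
      (𝓝 (gauge K (x - s • v))) :=
    (hcont.tendsto _).comp (tendsto_const_nhds.sub (hlim.const_smul s))
  refine ge_of_tendsto' ht fun i => ?_
  have hgx : gauge K x = 1 := (gauge_eq_one_iff_mem_frontier hKconv h0).2 hx
  have hgp : gauge K (p i) = 1 := (gauge_eq_one_iff_mem_frontier hKconv h0).2 (hp i)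
  have hk : 0 ≤ s * c i := mul_nonneg hs (hc i).le
  have e : (1 + s * c i) • x = (x - s • (c i • (p i - x))) + (s * c i) • p i := by
    module
  have h1 := gauge_add_le hKconv (absorbent_nhds_zero h0) (x - s • (c i • (p i - x))) ((s * c i) • p i)
  rw [← e, gauge_smul_of_nonneg (by linarith), gauge_smul_of_nonneg hk, hgx, hgp] at h1
  simp only [smul_eq_mul] at h1
  linarith

theorem gauge_ge_of_tangent {X : Type*} [NormedAddCommGroup X] [NormedSpace ℝ X]
    {K : Set X} (hKconv : Convex ℝ K) (h0 : K ∈ 𝓝 (0 : X)) {x v : X} (hx : x ∈ frontier K)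
    (h : IsTangentVec K x v) (s : ℝ) : 1 ≤ gauge K (x + s • v) := by
  rcases le_total 0 s with hs | hs
  · simpa using gauge_ge_of_forward hKconv h0 hx h.2 hs
  · have := gauge_ge_of_forward hKconv h0 hx h.1 (neg_nonneg.2 hs)
    simpa using this

/-- If `id + s V` never decreases the gauge, then `V x` is forward tangent. -/
theorem forward_of_gauge {X : Type*} [NormedAddCommGroup X] [NormedSpace ℝ X]
    {K : Set X} (hKconv : Convex ℝ K) (h0 : K ∈ 𝓝 (0 : X))
    (V : X →ₗ[ℝ] X) (hV : ∀ (x : X) (s : ℝ), gauge K x ≤ gauge K (x + s • V x))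
    {x : X} (hx : x ∈ frontier K) : IsForwardTangent K x (V x) := by
  have hgx : gauge K x = 1 := (gauge_eq_one_iff_mem_frontier hKconv h0).2 hx
  have hbd : ∀ t : ℝ, gauge K (x + t • V x) ≤ 1 + t ^ 2 * gauge K (-(V (V x))) := by
    intro t
    have h1 := hV (x + t • V x) (-t)
    have e : x + t • V x + (-t) • V (x + t • V x) = x + (t ^ 2) • (-(V (V x))) := by
      simp only [map_add, map_smul]; module
    rw [e] at h1
    have h2 := gauge_add_le hKconv (absorbent_nhds_zero h0) x ((t ^ 2) • (-(V (V x))))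
    rw [gauge_smul_of_nonneg (sq_nonneg t), hgx, smul_eq_mul] at h2
    linarith
  have hG : HasDerivAt (fun t : ℝ => gauge K (x + t • V x)) 0 0 := by
    rw [hasDerivAt_iff_isLittleO_nhds_zero]
    have hO : (fun h : ℝ => gauge K (x + (0 + h) • V x) - gauge K (x + (0:ℝ) • V x) - h • (0:ℝ))
        =O[𝓝 0] (fun h : ℝ => h ^ 2) := by
      refine Asymptotics.IsBigO.of_bound (gauge K (-(V (V x)))) (Eventually.of_forall fun t => ?_)
      have h1 := hbd t
      have h2 := hV x t
      simp only [zero_add, zero_smul, add_zero, smul_zero, sub_zero, hgx] at *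
      rw [Real.norm_eq_abs, abs_of_nonneg (by linarith), Real.norm_eq_abs,
        abs_of_nonneg (sq_nonneg t)]
      linarith
    refine hO.trans_isLittleO ?_
    simpa using Asymptotics.isLittleO_pow_pow (𝕜 := ℝ) (m := 1) (n := 2) (by norm_num)
  have hpos : ∀ t : ℝ, 1 ≤ gauge K (x + t • V x) := fun t => hgx ▸ hV x t
  have hL : HasDerivAt (fun t : ℝ => x + t • V x) (V x) 0 := by
    simpa using ((hasDerivAt_id (0:ℝ)).smul_const (V x)).const_add x
  have hF := (hG.inv (by have := hpos 0; positivity)).smul hL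
  set F : ℝ → X := fun t => (gauge K (x + t • V x))⁻¹ • (x + t • V x) with hFdef
  have hF' : HasDerivAt F (V x) 0 := by
    exact hF.congr_deriv (by simp [hgx])
  have hF0 : F 0 = x := by simp [hFdef, hgx]
  have ht0 : Tendsto (fun i : ℕ => 1 / ((i : ℝ) + 1)) atTop (𝓝 0) :=
    tendsto_one_div_add_atTop_nhds_zero_nat
  have ht1 : Tendsto (fun i : ℕ => 1 / ((i : ℝ) + 1)) atTop (𝓝[≠] 0) :=
    tendsto_nhdsWithin_iff.2 ⟨ht0, Eventually.of_forall fun i => by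
      simp only [Set.mem_compl_iff, Set.mem_singleton_iff]; positivity⟩
  refine ⟨fun i => F (1 / ((i : ℝ) + 1)), fun i => (1 / ((i : ℝ) + 1))⁻¹, fun i => ?_,
    fun i => by positivity, ?_, ?_⟩
  · rw [← gauge_eq_one_iff_mem_frontier hKconv h0]
    have := hpos (1 / ((i : ℝ) + 1))
    simp only [hFdef]
    rw [gauge_smul_of_nonneg (by positivity), smul_eq_mul, inv_mul_cancel₀ (by positivity)]
  · have := hF'.continuousAt.tendsto.comp ht0
    rwa [hF0] at this
  · have := (hasDerivAt_iff_tendsto_slope_zero.1 hF').comp ht1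
    simpa [Function.comp_def, hF0] using this

theorem isTangentVec_of_gauge {X : Type*} [NormedAddCommGroup X] [NormedSpace ℝ X]
    {K : Set X} (hKconv : Convex ℝ K) (h0 : K ∈ 𝓝 (0 : X))
    (V : X →ₗ[ℝ] X) (hV : ∀ (x : X) (s : ℝ), gauge K x ≤ gauge K (x + s • V x))
    {x : X} (hx : x ∈ frontier K) : IsTangentVec K x (V x) := by
  refine ⟨forward_of_gauge hKconv h0 V hV hx, ?_⟩
  have := forward_of_gauge hKconv h0 (-V) (fun x s => by simpa using hV x (-s)) hx
  simpa using this

/-- If `id + s U` never decreases the gauge of a convex body, `U` is trace free. -/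
theorem trace_eq_zero_of_gauge {X : Type*} [NormedAddCommGroup X] [NormedSpace ℝ X]
    [FiniteDimensional ℝ X]
    {K : Set X} (hKcomp : IsCompact K) (hKconv : Convex ℝ K) (h0 : K ∈ 𝓝 (0 : X))
    (U : X →ₗ[ℝ] X) (hU : ∀ (x : X) (s : ℝ), gauge K x ≤ gauge K (x + s • U x)) :
    LinearMap.trace ℝ X U = 0 := by
  let _ : MeasurableSpace X := borel X
  have _ : BorelSpace X := ⟨rfl⟩
  let μ : MeasureTheory.Measure X := MeasureTheory.Measure.addHaar
  have hpos : μ K ≠ 0 := (MeasureTheory.Measure.measure_pos_of_mem_nhds μ h0).ne'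
  have hfin : μ K ≠ ⊤ := hKcomp.measure_lt_top.ne
  have hmemK : ∀ x, gauge K x ≤ 1 ↔ x ∈ K := fun x => by
    rw [gauge_le_one_iff_mem_closure hKconv h0, hKcomp.isClosed.closure_eq]
  have hdet : ∀ s : ℝ, LinearMap.det (1 + s • U) ≠ 0 → 1 ≤ |LinearMap.det (1 + s • U)| := by
    intro s hs
    have hsub : (⇑(1 + s • U : X →ₗ[ℝ] X)) ⁻¹' K ⊆ K := by
      intro x hx
      rw [Set.mem_preimage, ← hmemK] at hx
      rw [← hmemK]
      have := hU x s
      simp only [LinearMap.add_apply, Module.End.one_apply, LinearMap.smul_apply] at hx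
      linarith
    have h1 := MeasureTheory.measure_mono (μ := μ) hsub
    rw [MeasureTheory.Measure.addHaar_preimage_linearMap μ hs] at h1
    have h2 : ENNReal.ofReal |(LinearMap.det (1 + s • U))⁻¹| ≤ 1 := by
      by_contra hlt
      push Not at hlt
      have : 1 * μ K < ENNReal.ofReal |(LinearMap.det (1 + s • U))⁻¹| * μ K :=
        ENNReal.mul_lt_mul_left hpos hfin hlt
      rw [one_mul] at this
      exact absurd h1 (not_le.2 this)
    rw [ENNReal.ofReal_le_one, abs_inv] at h2
    exact (inv_le_one₀ (abs_pos.2 hs)).1 h2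
  let b := Module.finBasis ℝ X
  let M := LinearMap.toMatrix b b U
  let q : Polynomial ℝ := (Matrix.det (1 + (Polynomial.X : Polynomial ℝ) • M.map Polynomial.C)).divX.divX
  have hform : ∀ s : ℝ, LinearMap.det (1 + s • U) =
      1 + LinearMap.trace ℝ X U * s + q.eval s * s ^ 2 := by
    intro s
    rw [← LinearMap.det_toMatrix b, LinearMap.trace_eq_matrix_trace ℝ b]
    rw [map_add, map_smul, LinearMap.toMatrix_one]
    exact Matrix.det_one_add_smul s M
  set T := LinearMap.trace ℝ X U
  have hf : HasDerivAt (fun s : ℝ => 1 + T * s + q.eval s * s ^ 2) T 0 := by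
    have := (((hasDerivAt_id (0:ℝ)).const_mul T).const_add 1).add
      ((q.hasDerivAt 0).mul ((hasDerivAt_id (0:ℝ)).pow 2))
    exact (this.congr_deriv (by simp))
  have hmin : IsLocalMin (fun s : ℝ => 1 + T * s + q.eval s * s ^ 2) 0 := by
    have hev : ∀ᶠ s in 𝓝 (0:ℝ), 0 < 1 + T * s + q.eval s * s ^ 2 :=
      hf.continuousAt.eventually (lt_mem_nhds (by simp))
    filter_upwards [hev] with s hs
    have := hdet s (by rw [hform]; exact hs.ne')
    rw [hform, abs_of_pos hs] at this
    simpa using this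
  exact hmin.hasDerivAt_eq_zero hf

theorem scalar_aux (d2 a c d b d3 D2 A C D B D3 : ℝ)
    (h : ∀ s t : ℝ, (1 + s * d2 + t * a - s * (s * c + t * d)) * (s * B + t * D3 - t * (s * C + t * D))
      = (s * b + t * d3 - t * (s * c + t * d)) * (s * D2 + t * A - s * (s * C + t * D))) :
    B = 0 ∧ D3 = 0 ∧ ((b ≠ 0 ∨ c + d2 * d3 - d3 ^ 2 ≠ 0 ∨ a * d3 + d ≠ 0) →
      D2 = 0 ∧ A = 0 ∧ C = 0 ∧ D = 0) ∧ (b = 0 → C = - d3 * D2 ∧ D = - d3 * A) := by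
  have p1 := h 1 0
  have p2 := h (-1) 0
  have p3 := h 2 0
  have p4 := h 0 1
  have p5 := h 0 (-1)
  have p6 := h 0 2
  have p7 := h 1 1
  have p8 := h 1 (-1)
  have p9 := h (-1) 1
  ring_nf at p1 p2 p3 p4 p5 p6 p7 p8 p9
  have hB : B = 0 := by linarith
  have hD3 : D3 = 0 := by linarith
  subst hB hD3
  have k1 : b * D2 = 0 := by linarith
  have k2 : D + d3 * A = 0 := by linarith
  have k3 : b * C = 0 := by linarith
  have k4 : a * D = d * A := by linarith
  have k5 : C + b * A + d3 * D2 = 0 := by linarith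
  have k6 : d2 * C = b * D + d3 * C + c * D2 := by linarith
  have k7 : d2 * D + a * C = d3 * D + c * A + d * D2 := by linarith
  have hD : D = - d3 * A := by linarith
  refine ⟨rfl, rfl, ?_, ?_⟩
  · intro hh
    by_cases hb : b = 0
    · subst hb
      have hC : C = - d3 * D2 := by linarith
      have m1 : (c + d2 * d3 - d3 ^ 2) * D2 = 0 := by rw [hC] at k6; linarith
      have m2 : (c + d2 * d3 - d3 ^ 2) * A + (a * d3 + d) * D2 = 0 := by
        rw [hC, hD] at k7; linarith
      have m3 : (a * d3 + d) * A = 0 := by rw [hD] at k4; linarith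
      have : D2 = 0 ∧ A = 0 := by
        rcases hh with hh | hh | hh
        · exact absurd rfl hh
        · have e : D2 = 0 := by simpa [hh] using m1
          rw [e] at m2
          exact ⟨e, by simpa [hh] using m2⟩
        · have e : A = 0 := by simpa [hh] using m3
          rw [e] at m2
          exact ⟨by simpa [hh] using m2, e⟩
      obtain ⟨e1, e2⟩ := this
      exact ⟨e1, e2, by rw [hC, e1, mul_zero], by rw [hD, e2, mul_zero]⟩
    · have e1 : D2 = 0 := by simpa [hb] using k1
      have e2 : C = 0 := by simpa [hb] using k3
      have e3 : A = 0 := by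
        rw [e1, e2] at k5
        have : b * A = 0 := by linarith
        simpa [hb] using this
      exact ⟨e1, e3, e2, by rw [hD, e3, mul_zero]⟩
  · intro hb
    subst hb
    exact ⟨by linarith, hD⟩

theorem exists_dual_eq_one {X : Type*} [AddCommGroup X] [Module ℝ X] {v : X} (hv : v ≠ 0) :
    ∃ α : Module.Dual ℝ X, α v = 1 := by
  by_contra hcon
  apply hv
  rw [← Module.forall_dual_apply_eq_zero_iff ℝ]
  intro f
  by_contra hf
  exact hcon ⟨(f v)⁻¹ • f, by simp [hf]⟩

theorem exists_adapted {X : Type*} [AddCommGroup X] [Module ℝ X]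
    (hdim : Module.finrank ℝ X = 3) (p : X) (hp : p ≠ 0) (mu : Module.Dual ℝ X) (hmu : mu ≠ 0)
    (hmp : mu p = 0) : ∃ b : Module.Basis (Fin 3) ℝ X, b 0 = p ∧ b.coord 1 = mu := by
  have : FiniteDimensional ℝ X := Module.finite_of_finrank_pos (by omega)
  obtain ⟨z, hz⟩ : ∃ z, mu z = 1 := LinearMap.surjective hmu 1
  have hker : Module.finrank ℝ (LinearMap.ker mu) = 2 := by
    have h1 := LinearMap.finrank_range_add_finrank_ker mu
    rw [LinearMap.range_eq_top.2 (LinearMap.surjective hmu), finrank_top, Module.finrank_self,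
      hdim] at h1
    omega
  obtain ⟨w, hw, hwp⟩ : ∃ w, mu w = 0 ∧ w ∉ Submodule.span ℝ {p} := by
    by_contra hcon
    push Not at hcon
    have hle : LinearMap.ker mu ≤ Submodule.span ℝ {p} := fun w hw => hcon w hw
    have := Submodule.finrank_mono hle
    rw [hker, finrank_span_singleton hp] at this
    omega
  have hli : LinearIndependent ℝ ![p, z, w] := by
    rw [Fintype.linearIndependent_iff]
    intro g hg
    simp only [Fin.sum_univ_three, Matrix.cons_val_zero, Matrix.cons_val_one, Matrix.cons_val] at hg
    have h1 : g 1 = 0 := by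
      have := congrArg mu hg
      simpa [hmp, hz, hw] using this
    have h2 : g 2 = 0 := by
      by_contra h2
      apply hwp
      rw [Submodule.mem_span_singleton]
      refine ⟨-(g 0 / g 2), ?_⟩
      rw [h1, zero_smul, add_zero] at hg
      have : w = (g 2)⁻¹ • (g 0 • p + g 2 • w) - (g 0 / g 2) • p := by
        rw [smul_add, smul_smul, smul_smul, inv_mul_cancel₀ h2, div_eq_inv_mul]; module
      rw [this, hg]; module
    have h3 : g 0 = 0 := by
      rw [h1, h2] at hg
      simpa [hp] using hg
    intro i
    fin_cases i <;> assumption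
  let b := basisOfLinearIndependentOfCardEqFinrank hli (by simp [hdim])
  have hb : ⇑b = ![p, z, w] := coe_basisOfLinearIndependentOfCardEqFinrank hli _
  refine ⟨b, by simp [hb], ?_⟩
  apply b.ext
  intro i
  rw [Module.Basis.coord_apply, Module.Basis.repr_self, hb]
  fin_cases i <;> simp [hmp, hz, hw]

theorem classify {X : Type*} [AddCommGroup X] [Module ℝ X]
    (hdim : Module.finrank ℝ X = 3)
    (R : Module.Dual ℝ X →ₗ[ℝ] (X →ₗ[ℝ] X))
    (hdeg : ∀ (p : X) (lam mu : Module.Dual ℝ X), lam p = 0 → mu p = 0 →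
      ∀ α β : Module.Dual ℝ X, α (R lam p) * β (R mu p) = α (R mu p) * β (R lam p)) :
    (∃ v : X, ∀ (lam : Module.Dual ℝ X) (p : X), lam p = 0 → ∃ k : ℝ, R lam p = k • v) ∨
    (∃ (a : X) (U : X →ₗ[ℝ] X) (b : X), ∀ (lam : Module.Dual ℝ X) (p : X),
      R lam p = lam a • U p + lam p • b) := by
  have : FiniteDimensional ℝ X := Module.finite_of_finrank_pos (by omega)
  by_cases hz : ∀ (lam : Module.Dual ℝ X) (p : X), lam p = 0 → R lam p = 0
  · exact Or.inl ⟨0, fun lam p h => ⟨0, by simp [hz lam p h]⟩⟩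
  push Not at hz
  obtain ⟨mu, p, hmp, hv⟩ := hz
  have hp : p ≠ 0 := by rintro rfl; simp at hv
  have hmu : mu ≠ 0 := by rintro rfl; simp at hv
  obtain ⟨bs, hb0, hb1⟩ := exists_adapted hdim p hp mu hmu hmp
  set v := R mu p with hvdef
  obtain ⟨α, hα⟩ : ∃ α : Module.Dual ℝ X, α v = 1 := exists_dual_eq_one hv
  -- a vector is determined by all functionals
  have sep : ∀ y z : X, (∀ β : Module.Dual ℝ X, β y = β z) → y = z := fun y z h => by
    rw [← sub_eq_zero, ← Module.forall_dual_apply_eq_zero_iff ℝ]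
    intro β; rw [map_sub, h, sub_self]
  have hpar : ∀ (lam : Module.Dual ℝ X), lam p = 0 → R lam p = α (R lam p) • v := by
    intro lam hl
    apply sep
    intro β
    have := hdeg p mu lam hmp hl α β
    rw [← hvdef, hα] at this
    rw [map_smul, smul_eq_mul]; linarith
  set cc := α (R (bs.coord 2) p) with hcc
  have hc2p : bs.coord 2 p = 0 := by rw [← hb0]; simp
  -- the adapted dual system
  obtain ⟨e1, e2, e3, l1, l2, l3, hx, hl, hl2, he1, h31, h11, h12, h13, h21, h22, h23, h3a, h32, h33⟩ :
      ∃ (e1 e2 e3 : X) (l1 l2 l3 : Module.Dual ℝ X),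
      (∀ x, x = l1 x • e1 + l2 x • e2 + l3 x • e3) ∧
      (∀ l : Module.Dual ℝ X, l = l e1 • l1 + l e2 • l2 + l e3 • l3) ∧ l2 = mu ∧ e1 = p ∧
      R l3 e1 = 0 ∧ l1 e1 = 1 ∧ l1 e2 = 0 ∧ l1 e3 = 0 ∧ l2 e1 = 0 ∧ l2 e2 = 1 ∧ l2 e3 = 0 ∧
      l3 e1 = 0 ∧ l3 e2 = 0 ∧ l3 e3 = 1 := by
    have hx : ∀ x, x = bs.coord 0 x • bs 0 + bs.coord 1 x • (bs 1 + cc • bs 2)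
        + (bs.coord 2 - cc • bs.coord 1) x • bs 2 := by
      intro x
      have h := bs.sum_repr x
      rw [Fin.sum_univ_three] at h
      conv_lhs => rw [← h]
      simp only [LinearMap.sub_apply, LinearMap.smul_apply, Module.Basis.coord_apply, smul_eq_mul]
      module
    refine ⟨bs 0, bs 1 + cc • bs 2, bs 2, bs.coord 0, bs.coord 1, bs.coord 2 - cc • bs.coord 1,
      hx, ?_, hb1, hb0, ?_, ?_, ?_, ?_, ?_, ?_, ?_, ?_, ?_, ?_⟩
    · intro l
      ext x
      conv_lhs => rw [hx x]
      simp only [map_add, map_smul, LinearMap.add_apply, LinearMap.smul_apply, smul_eq_mul]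
      ring
    · rw [hb0, hb1, map_sub, map_smul, LinearMap.sub_apply, LinearMap.smul_apply, hpar _ hc2p,
        ← hvdef, ← hcc, sub_self]
    all_goals simp
  subst hl2 he1
  -- the scalar identities
  have key : ∀ β : Module.Dual ℝ X, β v = 0 → _ := fun β hβ =>
    scalar_aux (α (R l2 e2 - R l1 e1)) (α (R l2 e3)) (α (R l1 e2)) (α (R l1 e3)) (α (R l3 e2))
      (α (R l3 e3 - R l1 e1)) (β (R l2 e2 - R l1 e1)) (β (R l2 e3)) (β (R l1 e2)) (β (R l1 e3))
      (β (R l3 e2)) (β (R l3 e3 - R l1 e1)) (by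
        intro s t
        have h := hdeg (e1 + s • e2 + t • e3) (l2 - s • l1) (l3 - t • l1)
          (by simp [h11, h12, h13, h21, h22, h23]) (by simp [h11, h12, h13, h3a, h32, h33]) α β
        simp only [map_add, map_sub, map_smul, LinearMap.sub_apply, LinearMap.smul_apply,
          smul_eq_mul, h31, map_zero, ← hvdef, hα, hβ] at h ⊢
        linear_combination h)
  have hβ0 : ∀ β : Module.Dual ℝ X, (β - β v • α) v = 0 := by intro β; simp [hα]
  have par : ∀ y : X, (∀ β : Module.Dual ℝ X, β v = 0 → β y = 0) → y = α y • v := by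
    intro y hy
    apply sep
    intro β
    have := hy _ (hβ0 β)
    simp only [LinearMap.sub_apply, LinearMap.smul_apply, smul_eq_mul] at this
    rw [map_smul, smul_eq_mul]; linarith
  have hexp : ∀ (lam : Module.Dual ℝ X) (x : X), R lam x =
      lam e1 • (l1 x • R l1 e1 + l2 x • R l1 e2 + l3 x • R l1 e3) +
      lam e2 • (l1 x • v + l2 x • (R l2 e2) + l3 x • R l2 e3) +
      lam e3 • (l2 x • R l3 e2 + l3 x • (R l3 e3)) := by
    intro lam x
    conv_lhs => rw [hl lam, hx x]
    simp only [map_add, map_smul, LinearMap.add_apply, LinearMap.smul_apply, ← hvdef, h31]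
    module
  have hpair : ∀ (lam : Module.Dual ℝ X) (x : X), lam x = l1 x * lam e1 + l2 x * lam e2 + l3 x * lam e3 := by
    intro lam x
    conv_lhs => rw [hx x]
    simp
  have hB := par _ fun β hβ => (key β hβ).1
  have hD3 := par _ fun β hβ => (key β hβ).2.1
  by_cases hgen : α (R l3 e2) ≠ 0 ∨ α (R l1 e2) + α (R l2 e2 - R l1 e1) * α (R l3 e3 - R l1 e1)
      - α (R l3 e3 - R l1 e1) ^ 2 ≠ 0 ∨ α (R l2 e3) * α (R l3 e3 - R l1 e1) + α (R l1 e3) ≠ 0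
  · left
    have hD2 := par _ fun β hβ => ((key β hβ).2.2.1 hgen).1
    have hA := par _ fun β hβ => ((key β hβ).2.2.1 hgen).2.1
    have hC := par _ fun β hβ => ((key β hβ).2.2.1 hgen).2.2.1
    have hD := par _ fun β hβ => ((key β hβ).2.2.1 hgen).2.2.2
    refine ⟨v, fun lam x h0 => ?_⟩
    rw [hexp, hC, hD, hA, hB, sub_eq_iff_eq_add.1 hD2, sub_eq_iff_eq_add.1 hD3]
    rw [hpair] at h0
    have h0' : (l1 x * lam e1 + l2 x * lam e2 + l3 x * lam e3) • R l1 e1 = 0 := by rw [h0, zero_smul]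
    generalize α (R l1 e2) = k1
    generalize α (R l1 e3) = k2
    generalize α (R l2 e3) = k3
    generalize α (R l3 e2) = k4
    generalize α (R l2 e2 - R l1 e1) = k5
    generalize α (R l3 e3 - R l1 e1) = k6
    refine ⟨lam e1 * (l2 x * k1 + l3 x * k2) + lam e2 * (l1 x + l2 x * k5 + l3 x * k3)
      + lam e3 * (l2 x * k4 + l3 x * k6), ?_⟩
    rw [← sub_eq_zero, ← h0']
    module
  · right
    push Not at hgen
    obtain ⟨g1, g2, g3⟩ := hgen
    rw [g1, zero_smul] at hB
    set δ := α (R l3 e3 - R l1 e1) with hδ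
    have hC : R l1 e2 = -δ • (R l2 e2 - R l1 e1 - δ • v) := by
      have := par (R l1 e2 + δ • (R l2 e2 - R l1 e1)) fun β hβ => by
        rw [map_add, map_smul, ((key β hβ).2.2.2 g1).1, smul_eq_mul]; ring
      rw [map_add, map_smul, smul_eq_mul,
        show α (R l1 e2) + δ * α (R l2 e2 - R l1 e1) = δ ^ 2 by linarith] at this
      rw [eq_sub_of_add_eq this]; module
    have hD : R l1 e3 = -δ • R l2 e3 := by
      have := par (R l1 e3 + δ • (R l2 e3)) fun β hβ => by
        rw [map_add, map_smul, ((key β hβ).2.2.2 g1).2, smul_eq_mul]; ring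
      rw [map_add, map_smul, smul_eq_mul,
        show α (R l1 e3) + δ * α (R l2 e3) = 0 by linarith] at this
      rw [eq_sub_of_add_eq this]; module
    refine ⟨e2 - δ • e1, l1.smulRight v + l2.smulRight (R l2 e2 - R l1 e1 - δ • v)
      + l3.smulRight (R l2 e3), R l1 e1 + δ • v, fun lam x => ?_⟩
    rw [hexp, hB, hC, hD, sub_eq_iff_eq_add.1 hD3, hpair lam x]
    simp only [LinearMap.add_apply, LinearMap.smulRight_apply, map_sub, map_smul, smul_eq_mul]
    generalize R l1 e1 = w1
    module

/-- If `R_λ p = 0` whenever `λ p = 0` and `R` is trace free then `R = 0`. -/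
theorem eq_zero_of_vanish {X : Type*} [AddCommGroup X] [Module ℝ X]
    (hdim : Module.finrank ℝ X = 3)
    (R : Module.Dual ℝ X →ₗ[ℝ] (X →ₗ[ℝ] X))
    (htr : ∀ lam : Module.Dual ℝ X, LinearMap.trace ℝ X (R lam) = 0)
    (hz : ∀ (lam : Module.Dual ℝ X) (p : X), lam p = 0 → R lam p = 0)
    (lam : Module.Dual ℝ X) (x : X) : R lam x = 0 := by
  have : FiniteDimensional ℝ X := Module.finite_of_finrank_pos (by omega)
  -- `R_λ x = λ(x) b_λ`
  have h1 : ∀ (lam : Module.Dual ℝ X), ∃ b : X, R lam = lam.smulRight b := by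
    intro lam
    by_cases hl : lam = 0
    · exact ⟨0, by ext; simp [hl]⟩
    obtain ⟨z, hzz⟩ : ∃ z, lam z = 1 := LinearMap.surjective hl 1
    refine ⟨R lam z, ?_⟩
    ext x
    have := hz lam (x - lam x • z) (by simp [hzz])
    rw [map_sub, map_smul, sub_eq_zero] at this
    simpa using this
  obtain ⟨b, hb⟩ := h1 lam
  have h2 : lam b = 0 := by
    have := htr lam
    rwa [hb, LinearMap.trace_smulRight] at this
  by_cases hl : lam = 0
  · simp [hl]
  obtain ⟨z, hzz⟩ : ∃ z, lam z = 1 := LinearMap.surjective hl 1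
  -- `b` is proportional to nothing outside the kernel of each functional
  have hbz : b = 0 := by
    rw [← Module.forall_dual_apply_eq_zero_iff ℝ]
    by_contra hcon
    push Not at hcon
    obtain ⟨mu, hmu⟩ := hcon
    -- subtract a multiple of `λ` so that `mu z = 0`
    have hm1 : (mu - mu z • lam) z = 0 := by simp [hzz]
    have hm2 : (mu - mu z • lam) b ≠ 0 := by simpa [h2] using hmu
    generalize mu - mu z • lam = nu at hm1 hm2
    obtain ⟨c, hc⟩ := h1 nu
    have hnc : nu c = 0 := by
      have := htr nu
      rwa [hc, LinearMap.trace_smulRight] at this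
    -- evaluate at `z + y` with `nu y = 1`, `lam y = 0`
    have hy := hz (lam - nu) (z + (nu b)⁻¹ • b) (by simp [hzz, h2, hm1, hm2])
    simp only [map_sub, LinearMap.sub_apply, hb, hc, LinearMap.smulRight_apply, map_add, map_smul,
      hzz, h2, hm1, one_smul] at hy
    have hy' := congrArg nu hy
    simp only [map_add, map_sub, map_smul, map_zero, hnc, smul_eq_mul] at hy'
    apply hm2
    linarith
  rw [hb, hbz]; simp

theorem line_case {X : Type*} [NormedAddCommGroup X] [NormedSpace ℝ X]
    {K : Set X} (hKcomp : IsCompact K) (hKconv : Convex ℝ K) (h0 : K ∈ 𝓝 (0 : X))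
    (R : Module.Dual ℝ X →ₗ[ℝ] (X →ₗ[ℝ] X))
    (H : ∀ (lam : Module.Dual ℝ X) (x : X), lam x = 0 → ∀ s : ℝ,
      gauge K x ≤ gauge K (x + s • R lam x))
    (v : X) (hv : ∀ (lam : Module.Dual ℝ X) (p : X), lam p = 0 → ∃ k : ℝ, R lam p = k • v)
    (lam : Module.Dual ℝ X) (p : X) (hlp : lam p = 0) : R lam p = 0 := by
  by_cases hv0 : v = 0
  · obtain ⟨k, hk⟩ := hv lam p hlp
    rw [hk, hv0, smul_zero]
  by_cases hp : p = 0
  · rw [hp, map_zero]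
  obtain ⟨α, hα⟩ := exists_dual_eq_one hv0
  obtain ⟨mu, hmu⟩ := exists_dual_eq_one hp
  have habs : Absorbent ℝ K := absorbent_nhds_zero h0
  have hgv : 0 < gauge K v :=
    (gauge_pos habs (NormedSpace.isVonNBounded_of_isBounded ℝ hKcomp.isBounded)).2 hv0
  -- no point far away in direction `v` has `v` as a tangent direction
  have hfar : ∀ τ : ℝ, 0 < τ → gauge K p + gauge K (-p) < τ * gauge K v →
      ∀ nu : Module.Dual ℝ X, nu (p + τ • v) = 0 → α (R nu (p + τ • v)) = 0 := by
    intro τ hτ hlt nu hnu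
    obtain ⟨k, hk⟩ := hv nu _ hnu
    rw [hk, map_smul, hα, smul_eq_mul, mul_one]
    by_contra hk0
    have h1 := H nu _ hnu (-τ / k)
    rw [hk, smul_smul, div_mul_cancel₀ _ hk0] at h1
    rw [show p + τ • v + -τ • v = p by module] at h1
    have h2 := gauge_add_le hKconv habs (p + τ • v) (-p)
    rw [show p + τ • v + -p = τ • v by module, gauge_smul_of_nonneg hτ.le, smul_eq_mul] at h2
    linarith
  obtain ⟨T, hT0, hT⟩ : ∃ T : ℝ, 0 < T ∧ gauge K p + gauge K (-p) < T * gauge K v := by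
    refine ⟨(gauge K p + gauge K (-p) + 1) / gauge K v, ?_, ?_⟩
    · have := gauge_nonneg (s := K) p
      have := gauge_nonneg (s := K) (-p)
      positivity
    · rw [div_mul_cancel₀ _ hgv.ne']; linarith
  have hq : ∀ τ : ℝ, T ≤ τ →
      α (R ((1 + τ * mu v) • lam - (τ * lam v) • mu) (p + τ • v)) = 0 := by
    intro τ hτ
    refine hfar τ (by linarith) (lt_of_lt_of_le hT ?_) _ ?_
    · exact mul_le_mul_of_nonneg_right hτ hgv.le
    · simp [hlp, hmu]; ring
  have q1 := hq T le_rfl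
  have q2 := hq (2 * T) (by linarith)
  have q3 := hq (3 * T) (by linarith)
  simp only [map_sub, map_smul, map_add, LinearMap.sub_apply, LinearMap.smul_apply,
    smul_eq_mul] at q1 q2 q3
  have hzero : α (R lam p) = 0 := by linear_combination 3 * q1 - 3 * q2 + q3
  obtain ⟨k, hk⟩ := hv lam p hlp
  rw [hk, map_smul, hα, smul_eq_mul, mul_one] at hzero
  rw [hk, hzero, zero_smul]

/-- In the rank one case `R_λ = λ(a) U + λ ⊗ b`, the map `id + s U` never decreases the gauge. -/
theorem expand_case {X : Type*} [NormedAddCommGroup X] [NormedSpace ℝ X]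
    (hdim : Module.finrank ℝ X = 3)
    {K : Set X} (hKconv : Convex ℝ K) (h0 : K ∈ 𝓝 (0 : X))
    (R : Module.Dual ℝ X →ₗ[ℝ] (X →ₗ[ℝ] X))
    (H : ∀ (lam : Module.Dual ℝ X) (x : X), lam x = 0 → ∀ s : ℝ,
      gauge K x ≤ gauge K (x + s • R lam x))
    (a : X) (U : X →ₗ[ℝ] X) (b : X) (hR : ∀ (lam : Module.Dual ℝ X) (p : X),
      R lam p = lam a • U p + lam p • b) (ha : a ≠ 0) (x : X) (s : ℝ) :
    gauge K x ≤ gauge K (x + s • U x) := by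
  have : FiniteDimensional ℝ X := Module.finite_of_finrank_pos (by omega)
  have hcont := continuous_gauge hKconv h0
  have hUc : Continuous U := U.continuous_of_finiteDimensional
  -- points with a functional killing them but not `a`
  have h1 : ∀ (lam : Module.Dual ℝ X) (y : X), lam y = 0 → lam a = 1 →
      gauge K y ≤ gauge K (y + s • U y) := by
    intro lam y hy hla
    have := H lam y hy s
    rwa [hR, hla, hy, one_smul, zero_smul, add_zero] at this
  obtain ⟨α, hα⟩ := exists_dual_eq_one ha
  -- a nonzero functional killing `a`
  obtain ⟨w, hw⟩ : ∃ w, w ∉ Submodule.span ℝ {a} := by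
    by_contra hcon
    push Not at hcon
    have htop : Submodule.span ℝ {a} = ⊤ := by ext y; simp [hcon y]
    have := finrank_span_singleton (K := ℝ) ha
    rw [htop, finrank_top, hdim] at this
    omega
  have hw0 : w - α w • a ≠ 0 := by
    intro h
    apply hw
    rw [sub_eq_zero.1 h]
    exact Submodule.smul_mem _ _ (Submodule.mem_span_singleton_self a)
  obtain ⟨nu0, hnu0⟩ := exists_dual_eq_one hw0
  have hgood : ∀ nu : Module.Dual ℝ X, nu a = 0 → ∀ y, nu y ≠ 0 →
      gauge K y ≤ gauge K (y + s • U y) := by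
    intro nu hna y hny
    refine h1 (α - (α y / nu y) • nu) y ?_ ?_
    · simp [hny]
    · simp [hna, hα]
  set nu := nu0 - nu0 a • α with hnu
  have hna : nu a = 0 := by simp [hnu, hα]
  have hnw : nu (w - α w • a) = 1 := by
    rw [hnu, LinearMap.sub_apply, hnu0]; simp [hα]
  generalize w - α w • a = z at hnw
  by_cases hx : nu x = 0
  · have ht0 : Tendsto (fun i : ℕ => 1 / ((i : ℝ) + 1)) atTop (𝓝 0) :=
      tendsto_one_div_add_atTop_nhds_zero_nat
    have hy : Tendsto (fun i : ℕ => x + (1 / ((i : ℝ) + 1)) • z) atTop (𝓝 x) := by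
      simpa using (ht0.smul_const z).const_add x
    refine le_of_tendsto_of_tendsto' ((hcont.tendsto x).comp hy)
      (((hcont.comp (continuous_id.add (hUc.const_smul s))).tendsto x).comp hy) fun i => ?_
    refine hgood nu hna _ ?_
    rw [map_add, map_smul, hx, hnw, smul_eq_mul, zero_add, mul_one]
    positivity
  · exact hgood nu hna x hx

/-- **Proposition (everywhere degenerate case).**  Let `dim X = 3`, `K ⊂ X` a convex body
with `0` in its interior and `R : X* → End(X)` a linear map with trace-free values satisfying
the tangency assumption: `R_λ(x)` is tangent to `∂K` at `x` whenever `x ∈ ∂K` and `λ(x) = 0`.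
If `R` is degenerate at every `p ≠ 0`, i.e. `dim T^R_p ≤ 1` for all `p ≠ 0`, then `R_λ(x)`
is tangent to `∂K` at `x` for every `λ ∈ X*` and every `x ∈ ∂K`. -/
theorem R_tangent_of_fully_degenerate
    {X : Type*} [NormedAddCommGroup X] [NormedSpace ℝ X]
    (hdim : Module.finrank ℝ X = 3)
    (K : Set X) (hKcomp : IsCompact K) (hKconv : Convex ℝ K)
    (h0 : (0 : X) ∈ interior K)
    (R : Module.Dual ℝ X →ₗ[ℝ] (X →ₗ[ℝ] X))
    (htr : ∀ lam : Module.Dual ℝ X, LinearMap.trace ℝ X (R lam) = 0)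
    (htang : ∀ lam : Module.Dual ℝ X, ∀ x ∈ frontier K, lam x = 0 →
      IsTangentVec K x (R lam x))
    (hdeg : ∀ p : X, p ≠ 0 → Module.finrank ℝ (Submodule.span ℝ (TR R p)) ≤ 1) :
    ∀ lam : Module.Dual ℝ X, ∀ x ∈ frontier K, IsTangentVec K x (R lam x) := by
  have hfd : FiniteDimensional ℝ X := Module.finite_of_finrank_pos (by omega)
  have hK0 : K ∈ 𝓝 (0 : X) := mem_interior_iff_mem_nhds.1 h0
  have hpos : ∀ x : X, x ≠ 0 → 0 < gauge K x := fun x hx =>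
    (gauge_pos (absorbent_nhds_zero hK0)
      (NormedSpace.isVonNBounded_of_isBounded ℝ hKcomp.isBounded)).2 hx
  have H : ∀ (lam : Module.Dual ℝ X) (x : X), lam x = 0 → ∀ s : ℝ,
      gauge K x ≤ gauge K (x + s • R lam x) := by
    intro lam x hlx s
    by_cases hx : x = 0
    · rw [hx, gauge_zero]; exact gauge_nonneg _
    have hr := hpos x hx
    have hy : (gauge K x)⁻¹ • x ∈ frontier K := by
      rw [← gauge_eq_one_iff_mem_frontier hKconv hK0, gauge_smul_of_nonneg (by positivity),
        smul_eq_mul, inv_mul_cancel₀ hr.ne']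
    have h1 := gauge_ge_of_tangent hKconv hK0 hy (htang lam _ hy (by simp [hlx])) s
    rw [map_smul, smul_comm s, ← smul_add, gauge_smul_of_nonneg (by positivity), smul_eq_mul,
      ← div_eq_inv_mul, one_le_div hr] at h1
    exact h1
  have hdeg' : ∀ (p : X) (lam mu : Module.Dual ℝ X), lam p = 0 → mu p = 0 →
      ∀ α β : Module.Dual ℝ X, α (R lam p) * β (R mu p) = α (R mu p) * β (R lam p) := by
    intro p lam mu hl hm α β
    by_cases hp : p = 0
    · simp [hp]
    obtain ⟨w, hw⟩ := finrank_le_one_iff.1 (hdeg p hp)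
    obtain ⟨c, hc⟩ := hw ⟨R lam p, Submodule.subset_span ⟨lam, hl, rfl⟩⟩
    obtain ⟨d, hd⟩ := hw ⟨R mu p, Submodule.subset_span ⟨mu, hm, rfl⟩⟩
    have hc' : c • (w : X) = R lam p := congrArg Subtype.val hc
    have hd' : d • (w : X) = R mu p := congrArg Subtype.val hd
    rw [← hc', ← hd']
    simp only [map_smul, smul_eq_mul]
    ring
  have hfin : ∀ lam : Module.Dual ℝ X, (∀ (x : X) (s : ℝ),
      gauge K x ≤ gauge K (x + s • R lam x)) → ∀ x ∈ frontier K, IsTangentVec K x (R lam x) :=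
    fun lam h x hx => isTangentVec_of_gauge hKconv hK0 (R lam) h hx
  intro lam
  refine hfin lam fun x s => ?_
  rcases classify hdim R hdeg' with ⟨v, hv⟩ | ⟨a, U, b, hR⟩
  · rw [eq_zero_of_vanish hdim R htr (line_case hKcomp hKconv hK0 R H v hv) lam x]
    simp
  · have htrace : ∀ mu : Module.Dual ℝ X, mu a * LinearMap.trace ℝ X U + mu b = 0 := by
      intro mu
      have h1 : R mu = mu a • U + mu.smulRight b := by ext y; simp [hR]
      have h2 := htr mu
      rwa [h1, map_add, map_smul, LinearMap.trace_smulRight, smul_eq_mul] at h2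
    have hb : ∀ c : ℝ, (∀ mu : Module.Dual ℝ X, mu a * c = 0) →
        c = LinearMap.trace ℝ X U → b = 0 := by
      intro c hc hcT
      rw [← Module.forall_dual_apply_eq_zero_iff ℝ]
      intro mu
      have := htrace mu
      rw [← hcT, hc mu, zero_add] at this
      exact this
    by_cases ha : a = 0
    · have hb0 := hb _ (fun mu => by simp [ha]) rfl
      rw [hR, hb0, ha]; simp
    · have hE := expand_case hdim hKconv hK0 R H a U b hR ha
      have hb0 := hb 0 (by simp) (trace_eq_zero_of_gauge hKcomp hKconv hK0 U hE).symm
      rw [hR, hb0, smul_zero, add_zero, smul_smul]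
      exact hE x _
end
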